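/- Let f ∈ L_p^0(T²), 1<p<∞, θ=min(2,p), τ=max(2,p), β₁,β₂,r₁,r₂>0, δ₁,δ₂ ∈ (0,1/2). (a) If (∫₀¹∫₀¹ t₁^{−r₁θ−1} t₂^{−r₂θ−1} ω_{r₁+β₁,r₂+β₂}(f,t₁,t₂)_p^θ dt₁ dt₂)^{1/θ} < ∞, then f has a mixed Weyl derivative f^{(r₁,r₂)} ∈ L_p(T²) and ω_{β₁,β₂}(f^{(r₁,r₂)},δ₁,δ₂)_p ≲ (∫₀^{δ₁}∫₀^{δ₂} t₁^{−r₁θ−1} t₂^{−r₂θ−1} ω_{r₁+β₁,r₂+β₂}(f,t₁,t₂)_p^θ dt₁ dt₂)^{1/θ}. (b) Conversely, if f has a mixed Weyl derivative f^{(r₁,r₂)} ∈ L_p(T²), then (∫₀^{δ₁}∫₀^{δ₂} t₁^{−r₁τ−1} t₂^{−r₂τ−1} ω_{r₁+β₁,r₂+β₂}(f,t₁,t₂)_p^τ dt₁ dt₂)^{1/τ} ≲ ω_{β₁,β₂}(f^{(r₁,r₂)},δ₁,δ₂)_p. -/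

import Mathlib

open MeasureTheory Real
open scoped ENNReal

noncomputable section

/-- The `L_p` norm of a function of two variables over the period square `(0,2π]²`. -/
def Lp2Norm (p : ℝ) (f : ℝ → ℝ → ℝ) : ℝ≥0∞ :=
  (∫⁻ x in Set.Ioc (0:ℝ) (2*π), ∫⁻ y in Set.Ioc (0:ℝ) (2*π),
      ENNReal.ofReal (|f x y| ^ p)) ^ (1/p)

/-- `f ∈ L_p^0(T²)`: measurable, `2π`-periodic in each variable, finite `L_p` norm,
and zero mean in each variable separately. -/
structure MemLp0 (p : ℝ) (f : ℝ → ℝ → ℝ) : Prop where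
  meas : Measurable (Function.uncurry f)
  periodic_x : ∀ y, Function.Periodic (fun x => f x y) (2*π)
  periodic_y : ∀ x, Function.Periodic (f x) (2*π)
  norm_ne_top : Lp2Norm p f ≠ ⊤
  mean_x : ∀ᵐ (y : ℝ) ∂volume, (∫ x in (0:ℝ)..(2*π), f x y) = 0
  mean_y : ∀ᵐ (x : ℝ) ∂volume, (∫ y in (0:ℝ)..(2*π), f x y) = 0

/-- Generalized (fractional) binomial coefficient `C(α,ν) = α(α-1)⋯(α-ν+1)/ν!`. -/
def fracBinom (α : ℝ) : ℕ → ℝ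
  | 0 => 1
  | n+1 => fracBinom α n * (α - (n : ℝ)) / ((n : ℝ) + 1)

/-- Fractional difference of order `α` with step `h` in the first variable. -/
def diffX (α h : ℝ) (f : ℝ → ℝ → ℝ) : ℝ → ℝ → ℝ :=
  fun x y => ∑' ν : ℕ, (-1 : ℝ) ^ ν * fracBinom α ν * f (x + (α - (ν : ℝ)) * h) y

/-- Fractional difference of order `α` with step `h` in the second variable. -/
def diffY (α h : ℝ) (f : ℝ → ℝ → ℝ) : ℝ → ℝ → ℝ :=
  fun x y => ∑' ν : ℕ, (-1 : ℝ) ^ ν * fracBinom α ν * f x (y + (α - (ν : ℝ)) * h)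

/-- The mixed (fractional) modulus of smoothness `ω_{α₁,α₂}(f, δ₁, δ₂)_p`. -/
def mixedMod (p α₁ α₂ δ₁ δ₂ : ℝ) (f : ℝ → ℝ → ℝ) : ℝ≥0∞ :=
  ⨆ (h₁ : ℝ) (_ : |h₁| ≤ δ₁) (h₂ : ℝ) (_ : |h₂| ≤ δ₂),
    Lp2Norm p (diffX α₁ h₁ (diffY α₂ h₂ f))

/-- Complex Fourier coefficient of a (real-valued) function on `T²`. -/
def fourierCoefZ (f : ℝ → ℝ → ℝ) (m₁ m₂ : ℤ) : ℂ :=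
  (((2*π)^2)⁻¹ : ℝ) * ∫ x in (0:ℝ)..(2*π), ∫ y in (0:ℝ)..(2*π),
    (f x y : ℂ) * Complex.exp (-Complex.I * ((m₁ : ℂ) * (x : ℂ) + (m₂ : ℂ) * (y : ℂ)))

/-- `g` is the mixed Weyl derivative `f^{(ρ₁,ρ₂)}` of `f` (and `g ∈ L_p^0(T²)`):
the Fourier coefficients of `g` arise from those of `f` by multiplication
with `(i m₁)^{ρ₁} (i m₂)^{ρ₂}`. -/
def HasWeylDeriv (p ρ₁ ρ₂ : ℝ) (f g : ℝ → ℝ → ℝ) : Prop :=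
  MemLp0 p g ∧ ∀ m₁ m₂ : ℤ,
    fourierCoefZ g m₁ m₂ =
      (Complex.I * (m₁ : ℂ)) ^ (ρ₁ : ℂ) * (Complex.I * (m₂ : ℂ)) ^ (ρ₂ : ℂ) * fourierCoefZ f m₁ m₂

/-- `(∫₀^a ∫₀^b t₁^{-r₁s-1} t₂^{-r₂s-1} ω_{r₁+β₁,r₂+β₂}(f,t₁,t₂)_p^s dt₁ dt₂)^{1/s}`. -/
def derivMajorant (p β₁ β₂ r₁ r₂ s a b : ℝ) (f : ℝ → ℝ → ℝ) : ℝ≥0∞ :=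
  (∫⁻ t₁ in Set.Ioo (0:ℝ) a, ∫⁻ t₂ in Set.Ioo (0:ℝ) b,
      ENNReal.ofReal (t₁ ^ (-r₁*s-1) * t₂ ^ (-r₂*s-1)) *
        mixedMod p (r₁+β₁) (r₂+β₂) t₁ t₂ f ^ s) ^ (1/s)

/-- The signed coefficients of the fractional difference of order `α`. -/
def diffCoeff (α : ℝ) (ν : ℕ) : ℝ := (-1) ^ ν * fracBinom α ν

theorem diffCoeff_zero (α : ℝ) : diffCoeff α 0 = 1 := by simp [diffCoeff, fracBinom]

theorem diffCoeff_succ (α : ℝ) (ν : ℕ) :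
    diffCoeff α (ν + 1) = diffCoeff α ν * ((ν - α) / (ν + 1)) := by
  simp only [diffCoeff, fracBinom, pow_succ]; ring

theorem summable_abs_diffCoeff {α : ℝ} (hα : 0 < α) : Summable fun ν => |diffCoeff α ν| := by
  set N := ⌈α⌉₊
  rw [← summable_nat_add_iff N]
  have hN : α ≤ N := Nat.le_ceil α
  have step : ∀ k, α * |diffCoeff α (k + N)| =
      (k + N : ℕ) * |diffCoeff α (k + N)| - (k + 1 + N : ℕ) * |diffCoeff α (k + 1 + N)| := by
    intro k
    rw [show k + 1 + N = (k + N) + 1 by ring, diffCoeff_succ, abs_mul, abs_div]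
    have h1 : (0 : ℝ) ≤ ((k + N : ℕ) : ℝ) - α := by push_cast; linarith [(k.cast_nonneg : (0:ℝ) ≤ k)]
    have h2 : (0 : ℝ) < ((k + N : ℕ) : ℝ) + 1 := by positivity
    rw [abs_of_nonneg h1, abs_of_pos h2]
    push_cast at h2 ⊢
    field_simp
    ring
  refine summable_of_sum_range_le (c := N * |diffCoeff α N| / α) (fun _ => abs_nonneg _) fun n => ?_
  rw [le_div_iff₀ hα, mul_comm, Finset.mul_sum, Finset.sum_congr rfl fun k _ => step k,
    Finset.sum_range_sub' (fun k => ((k + N : ℕ) : ℝ) * |diffCoeff α (k + N)|)]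
  simp only [zero_add]
  linarith [mul_nonneg (Nat.cast_nonneg (n + N) : (0:ℝ) ≤ _) (abs_nonneg (diffCoeff α (n + N)))]

theorem choose_eq_fracBinom (α : ℝ) (n : ℕ) : Ring.choose α n = fracBinom α n := by
  induction n with
  | zero => simp [fracBinom]
  | succ n ih =>
    rw [fracBinom, ← ih, Ring.choose_eq_smul, Ring.choose_eq_smul, descPochhammer_succ_right,
      Polynomial.smeval_mul, Nat.factorial_succ]
    simp [Polynomial.smeval_natCast]
    field_simp

theorem hasSum_diffCoeff_of_lt {α : ℝ} {w : ℂ} (hw : ‖w‖ < 1) :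
    HasSum (fun ν => (diffCoeff α ν : ℂ) * w ^ ν) ((1 - w) ^ (α : ℂ)) := by
  have h := (Complex.one_add_cpow_hasFPowerSeriesOnBall_zero (a := (α : ℂ))).hasSum (y := -w)
    (by
      rw [Metric.mem_eball, edist_zero_right, enorm_neg, ← ofReal_norm, ENNReal.ofReal_lt_one]
      exact hw)
  simp only [zero_add, binomialSeries_apply] at h
  rw [← sub_eq_add_neg] at h
  have e : (fun ν => (diffCoeff α ν : ℂ) * w ^ ν) =
      fun n => Ring.choose (α : ℂ) n • (List.ofFn fun _ : Fin n => -w).prod := by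
    ext ν
    rw [← Complex.ofReal_choose, choose_eq_fracBinom, diffCoeff]
    simp [neg_pow w ν]
    ring
  rw [e]
  exact h

theorem hasSum_diffCoeff {α : ℝ} (hα : 0 < α) {w : ℂ} (hw : ‖w‖ ≤ 1) :
    HasSum (fun ν => (diffCoeff α ν : ℂ) * w ^ ν) ((1 - w) ^ (α : ℂ)) := by
  have hs := summable_abs_diffCoeff hα
  have hb : ∀ ν (z : ℂ), ‖z‖ ≤ 1 → ‖(diffCoeff α ν : ℂ) * z ^ ν‖ ≤ |diffCoeff α ν| := by
    intro ν z hz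
    rw [norm_mul, norm_pow, Complex.norm_real, Real.norm_eq_abs]
    exact mul_le_of_le_one_right (abs_nonneg _) (pow_le_one₀ (norm_nonneg _) hz)
  have hsum : Summable (fun ν => (diffCoeff α ν : ℂ) * w ^ ν) :=
    Summable.of_norm_bounded hs fun ν => hb ν w hw
  have hlim : Filter.Tendsto (fun r : ℝ => (r : ℂ) * w) (nhdsWithin 1 (Set.Iio 1)) (nhds w) := by
    have : Continuous fun r : ℝ => (r : ℂ) * w := by fun_prop
    simpa using (this.tendsto 1).mono_left nhdsWithin_le_nhds
  have hev : ∀ᶠ r : ℝ in nhdsWithin 1 (Set.Iio 1), ‖(r : ℂ) * w‖ < 1 := by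
    have : ∀ᶠ r : ℝ in nhdsWithin 1 (Set.Iio 1), 0 < r :=
      nhdsWithin_le_nhds (lt_mem_nhds one_pos)
    filter_upwards [this, self_mem_nhdsWithin] with r h0 h1
    rw [norm_mul, Complex.norm_real, Real.norm_eq_abs, abs_of_pos h0]
    exact lt_of_le_of_lt (mul_le_of_le_one_right h0.le hw) h1
  have h1 := tendsto_tsum_of_dominated_convergence (𝓕 := nhdsWithin (1 : ℝ) (Set.Iio 1))
    (f := fun (r : ℝ) ν => (diffCoeff α ν : ℂ) * (r * w) ^ ν)
    (g := fun ν => (diffCoeff α ν : ℂ) * w ^ ν) hs (fun ν => (hlim.pow ν).const_mul _)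
    (hev.mono fun r hr ν => hb ν _ hr.le)
  have h2 : Filter.Tendsto (fun r : ℝ => (1 - (r : ℂ) * w) ^ (α : ℂ))
      (nhdsWithin 1 (Set.Iio 1)) (nhds ((1 - w) ^ (α : ℂ))) := by
    have hc : ContinuousAt (fun z : ℂ => z ^ (α : ℂ)) (1 - w) := by
      by_cases h0 : 1 - w = 0
      · rw [h0]
        exact Complex.continuousAt_cpow_const_of_re_pos (Or.inl le_rfl) (by simpa using hα)
      · refine Complex.continuousAt_cpow_const_of_re_pos (Or.inl ?_) (by simpa using hα)
        have := Complex.re_le_norm w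
        simp; linarith
    exact hc.tendsto.comp (hlim.const_sub 1)
  have h3 := tendsto_nhds_unique (h1.congr' (hev.mono fun r hr => (hasSum_diffCoeff_of_lt hr).tsum_eq)) h2
  rw [← h3]
  exact hsum.hasSum

/-- The symbol of the fractional difference of order `α`. -/
def diffSymbol (α θ : ℝ) : ℂ := ∑' ν : ℕ, (diffCoeff α ν : ℂ) * Complex.exp (((α - ν) * θ : ℝ) * Complex.I)

theorem diffSymbol_eq {α : ℝ} (hα : 0 < α) (θ : ℝ) :
    diffSymbol α θ = Complex.exp ((α * θ : ℝ) * Complex.I) *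
      (1 - Complex.exp (-(θ * Complex.I))) ^ (α : ℂ) := by
  have h := hasSum_diffCoeff hα (w := Complex.exp (-(θ * Complex.I)))
    (by rw [← neg_mul, ← Complex.ofReal_neg, Complex.norm_exp_ofReal_mul_I])
  rw [← h.tsum_eq, ← tsum_mul_left, diffSymbol]
  congr 1; ext ν
  rw [← Complex.exp_nat_mul, mul_left_comm, ← Complex.exp_add]
  congr 2; push_cast; ring

theorem diffSymbol_neg (α θ : ℝ) : diffSymbol α (-θ) = starRingEnd ℂ (diffSymbol α θ) := by
  rw [diffSymbol, diffSymbol, Complex.conj_tsum]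
  congr 1; ext ν
  simp [← Complex.exp_conj]

theorem one_sub_exp_eq (θ : ℝ) : 1 - Complex.exp (-(θ * Complex.I)) =
    (2 * Real.sin (θ / 2) : ℝ) * Complex.exp (((π - θ) / 2 : ℝ) * Complex.I) := by
  have h1 : Complex.exp (((π - θ) / 2 : ℝ) * Complex.I) =
      Complex.I * Complex.exp (-((θ / 2 : ℝ) * Complex.I)) := by
    rw [show (((π - θ) / 2 : ℝ) * Complex.I) = (π / 2 : ℂ) * Complex.I + (-((θ / 2 : ℝ) * Complex.I)) by
      push_cast; ring, Complex.exp_add, Complex.exp_pi_div_two_mul_I]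
  rw [h1]
  have h2 : Complex.exp (-(θ * Complex.I)) = Complex.exp (-((θ / 2 : ℝ) * Complex.I)) ^ 2 := by
    rw [← Complex.exp_nat_mul]; congr 1; push_cast; ring
  have h3 : Complex.exp ((θ / 2 : ℝ) * Complex.I) * Complex.exp (-((θ / 2 : ℝ) * Complex.I)) = 1 := by
    rw [← Complex.exp_add]; simp
  rw [h2]
  have h4 : ((2 * Real.sin (θ / 2) : ℝ) : ℂ) = (Complex.exp (-((θ / 2 : ℝ) * Complex.I)) -
      Complex.exp ((θ / 2 : ℝ) * Complex.I)) * Complex.I := by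
    push_cast
    rw [Complex.sin, mul_div_cancel₀ _ two_ne_zero]; ring_nf
  rw [h4]
  linear_combination (-1 : ℂ) * h3 + (Complex.exp (-((θ / 2 : ℝ) * Complex.I))^2 - Complex.exp ((θ / 2 : ℝ) * Complex.I) * Complex.exp (-((θ / 2 : ℝ) * Complex.I))) * (-Complex.I_sq)

theorem diffSymbol_of_mem {α θ : ℝ} (hα : 0 < α) (h0 : 0 ≤ θ) (h1 : θ < 2 * π) :
    diffSymbol α θ = Complex.exp ((α * π / 2 : ℝ) * Complex.I) *
      Complex.exp ((α * θ / 2 : ℝ) * Complex.I) * ((2 * Real.sin (θ / 2)) ^ α : ℝ) := by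
  rw [diffSymbol_eq hα, one_sub_exp_eq]
  rcases h0.eq_or_lt with rfl | h0
  · simp [hα.ne']
  have hs : 0 < 2 * Real.sin (θ / 2) := by
    have := Real.sin_pos_of_pos_of_lt_pi (x := θ / 2) (by linarith) (by linarith); linarith
  rw [Complex.cpow_def_of_ne_zero (mul_ne_zero (by exact_mod_cast hs.ne') (Complex.exp_ne_zero _)),
    Complex.log_ofReal_mul hs (Complex.exp_ne_zero _), Complex.log_exp, add_mul, Complex.exp_add,
    Real.rpow_def_of_pos hs, Complex.ofReal_exp]
  · simp only [← Complex.exp_add]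
    congr 1; push_cast; ring
  · simp; linarith
  · simp; linarith

/-- A strongly continuous `2 * π`-periodic group of isometries of a complex Banach space. -/
structure IsoFlow (X : Type*) [NormedAddCommGroup X] [NormedSpace ℂ X] where
  T : ℝ → X →L[ℂ] X
  zero' : ∀ x, T 0 x = x
  add' : ∀ s t x, T (s + t) x = T s (T t x)
  norm' : ∀ s x, ‖T s x‖ = ‖x‖
  cont' : ∀ x, Continuous fun s => T s x
  periodic' : ∀ s x, T (s + 2 * π) x = T s x

/-- The character `h ↦ e^{imh}`. -/
def chr (m : ℤ) (h : ℝ) : ℂ := Complex.exp (((m * h : ℝ) : ℂ) * Complex.I)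

theorem norm_chr (m : ℤ) (h : ℝ) : ‖chr m h‖ = 1 := Complex.norm_exp_ofReal_mul_I _

theorem chr_zero_left (h : ℝ) : chr 0 h = 1 := by simp [chr]

theorem chr_zero_right (m : ℤ) : chr m 0 = 1 := by simp [chr]

theorem chr_add_right (m : ℤ) (s t : ℝ) : chr m (s + t) = chr m s * chr m t := by
  rw [chr, chr, chr, ← Complex.exp_add]; congr 1; push_cast; ring

theorem chr_add_left (m l : ℤ) (t : ℝ) : chr (m + l) t = chr m t * chr l t := by
  rw [chr, chr, chr, ← Complex.exp_add]; congr 1; push_cast; ring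

theorem chr_neg_left (m : ℤ) (t : ℝ) : chr (-m) t = starRingEnd ℂ (chr m t) := by
  simp [chr, ← Complex.exp_conj]

theorem chr_neg_right (m : ℤ) (t : ℝ) : chr m (-t) = chr (-m) t := by
  rw [chr, chr]; congr 2; push_cast; ring

theorem chr_neg_mul (m : ℤ) (t : ℝ) : chr (-m) t * chr m t = 1 := by
  rw [← chr_add_left]; simp [chr_zero_left]

theorem chr_two_pi (m : ℤ) : chr m (2 * π) = 1 := by
  rw [chr, Complex.exp_eq_one_iff]; exact ⟨m, by push_cast; ring⟩

theorem continuous_chr (m : ℤ) : Continuous (chr m) := by unfold chr; fun_prop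

theorem chr_periodic (m : ℤ) : Function.Periodic (chr m) (2 * π) := fun t => by
  rw [chr_add_right, chr_two_pi, mul_one]

namespace IsoFlow

variable {X : Type*} [NormedAddCommGroup X] [NormedSpace ℂ X] (F : IsoFlow X)

theorem continuous_chr_smul (m : ℤ) (x : X) : Continuous fun h => chr m h • F.T h x :=
  (continuous_chr m).smul (F.cont' x)

theorem periodic_chr_smul (m : ℤ) (x : X) :
    Function.Periodic (fun h => chr m h • F.T h x) (2 * π) := fun t => by
  simp only [chr_periodic m t, F.periodic']

/-- The `m`-th spectral projection of the flow. -/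
def S (m : ℤ) : X →L[ℂ] X :=
  LinearMap.mkContinuous
    { toFun := fun x => (2 * π)⁻¹ • ∫ h in (0:ℝ)..2 * π, chr (-m) h • F.T h x
      map_add' := fun x y => by
        simp only [map_add, smul_add]
        rw [intervalIntegral.integral_add, smul_add]
        · exact (F.continuous_chr_smul _ _).intervalIntegrable _ _
        · exact (F.continuous_chr_smul _ _).intervalIntegrable _ _
      map_smul' := fun c x => by
        have e : ∀ h, chr (-m) h • F.T h (c • x) = c • (chr (-m) h • F.T h x) := fun h => by
          rw [map_smul, smul_comm]
        simp only [e, RingHom.id_apply]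
        rw [intervalIntegral.integral_smul, smul_comm] } 1
    (fun x => by
      simp only [LinearMap.coe_mk, AddHom.coe_mk, one_mul]
      rw [norm_smul, Real.norm_eq_abs, abs_of_pos (by positivity)]
      have := intervalIntegral.norm_integral_le_of_norm_le_const (a := 0) (b := 2 * π) (C := ‖x‖)
        (f := fun h => chr (-m) h • F.T h x)
        (fun h _ => by rw [norm_smul, norm_chr, one_mul, F.norm'])
      rw [sub_zero, abs_of_pos (by positivity)] at this
      rw [inv_mul_le_iff₀ (by positivity)]
      linarith)

theorem S_apply (m : ℤ) (x : X) :
    F.S m x = (2 * π)⁻¹ • ∫ h in (0:ℝ)..2 * π, chr (-m) h • F.T h x := rfl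

theorem norm_S_le (m : ℤ) (x : X) : ‖F.S m x‖ ≤ ‖x‖ := by
  have := ContinuousLinearMap.le_of_opNorm_le (F.S m)
    (LinearMap.mkContinuous_norm_le _ zero_le_one _) x
  rwa [one_mul] at this

variable [CompleteSpace X]

theorem comm_S (A : X →L[ℂ] X) (hA : ∀ s x, A (F.T s x) = F.T s (A x)) (m : ℤ) (x : X) :
    A (F.S m x) = F.S m (A x) := by
  rw [S_apply, S_apply, A.map_smul_of_tower, ← A.intervalIntegral_comp_comm]
  · simp [hA]
  · exact (F.continuous_chr_smul _ _).intervalIntegrable _ _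

omit [CompleteSpace X] in
theorem T_comm (s t : ℝ) (x : X) : F.T s (F.T t x) = F.T t (F.T s x) := by
  rw [← F.add', ← F.add', add_comm]

theorem T_S_comm (s : ℝ) (m : ℤ) (x : X) : F.T s (F.S m x) = F.S m (F.T s x) :=
  F.comm_S (F.T s) (fun t x => F.T_comm s t x) m x

omit [CompleteSpace X] in
theorem S_T (m : ℤ) (s : ℝ) (x : X) : F.S m (F.T s x) = chr m s • F.S m x := by
  have hp := F.periodic_chr_smul (-m) x
  have e : ∀ h, chr (-m) h • F.T h (F.T s x) = chr m s • (chr (-m) (h + s) • F.T (h + s) x) := by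
    intro h
    rw [F.add', chr_add_right, smul_smul, mul_comm (chr (-m) h), ← mul_assoc, mul_comm (chr m s),
      chr_neg_mul, one_mul]
  rw [S_apply, S_apply]
  simp only [e]
  rw [intervalIntegral.integral_smul, smul_comm]
  congr 2
  rw [intervalIntegral.integral_comp_add_right (fun h => chr (-m) h • F.T h x)]
  have := hp.intervalIntegral_add_eq s 0
  rw [zero_add] at this
  rw [zero_add, ← this, add_comm]

theorem T_S (m : ℤ) (s : ℝ) (x : X) : F.T s (F.S m x) = chr m s • F.S m x := by
  rw [T_S_comm, S_T]

theorem S_S (m l : ℤ) (x : X) : F.S m (F.S l x) = if m = l then F.S l x else 0 := by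
  rw [S_apply]
  simp only [T_S, smul_smul]
  rw [intervalIntegral.integral_smul_const]
  have : (∫ h in (0:ℝ)..2 * π, chr (-m) h * chr l h) = if m = l then (2 * π : ℂ) else 0 := by
    simp only [← chr_add_left]
    split_ifs with h
    · subst h; simp [chr_zero_left]
    · have hne : ((-m + l : ℤ) : ℂ) ≠ 0 := by
        exact_mod_cast fun h' => h (by omega)
      have : ∀ x : ℝ, chr (-m + l) x = Complex.exp ((((-m + l : ℤ) : ℂ) * Complex.I) * x) := by
        intro x; rw [chr]; congr 1; push_cast; ring
      simp only [this]
      rw [integral_exp_mul_complex (mul_ne_zero hne Complex.I_ne_zero), ← this, chr_two_pi]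
      simp
  rw [this]
  split_ifs
  · rw [← Complex.coe_smul, smul_smul]
    have : ((2 * π : ℝ) : ℂ) ≠ 0 := by exact_mod_cast (by positivity : (2 * π : ℝ) ≠ 0)
    push_cast at *
    rw [inv_mul_cancel₀ this, one_smul]
  · simp

end IsoFlow

/-- A continuous `2 * π`-periodic function with vanishing Fourier coefficients is zero. -/
theorem eq_zero_of_integral_chr_eq_zero {g : ℝ → ℂ} (hg : Continuous g)
    (hp : Function.Periodic g (2 * π))
    (h0 : ∀ m : ℤ, ∫ h in (0:ℝ)..2 * π, chr (-m) h * g h = 0) (t : ℝ) : g t = 0 := by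
  have : Fact (0 < 2 * π) := ⟨by positivity⟩
  let G : C(AddCircle (2 * π), ℂ) :=
    ⟨hp.lift, continuous_coinduced_dom.mpr hg⟩
  have hc : ∀ m, fourierCoeff G m = 0 := by
    intro m
    rw [fourierCoeff_eq_intervalIntegral _ _ 0, zero_add]
    have : (fun x : ℝ => fourier (-m) (x : AddCircle (2 * π)) • G x) =
        fun x => chr (-m) x * g x := by
      ext x
      rw [fourier_coe_apply, smul_eq_mul, chr]
      congr 2
      have : (π : ℂ) ≠ 0 := by exact_mod_cast Real.pi_ne_zero
      push_cast; field_simp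
    rw [this, h0, smul_zero]
  have hs := has_pointwise_sum_fourier_series_of_summable (f := G)
    (by
      have hz : fourierCoeff G = fun _ => 0 := funext hc
      rw [hz]; exact summable_zero) (t : AddCircle (2 * π))
  have hz : (fun m => fourierCoeff G m • fourier m (t : AddCircle (2 * π))) = fun _ => 0 := by
    ext m; rw [hc, zero_smul]
  rw [hz] at hs
  exact (hs.unique hasSum_zero : G t = 0)

namespace IsoFlow

variable {X : Type*} [NormedAddCommGroup X] [NormedSpace ℂ X] [CompleteSpace X] (F : IsoFlow X)

theorem eq_zero_of_S_eq_zero {x : X} (hx : ∀ m, F.S m x = 0) : x = 0 := by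
  refine SeparatingDual.eq_zero_of_forall_dual_eq_zero (R := ℂ) fun φ => ?_
  have := eq_zero_of_integral_chr_eq_zero (g := fun h => φ (F.T h x)) (φ.continuous.comp (F.cont' x))
    (fun t => by simp only [F.periodic']) (fun m => ?_) 0
  · simpa [F.zero'] using this
  have h := hx m
  rw [S_apply, smul_eq_zero_iff_right (by positivity)] at h
  have h2 := φ.intervalIntegral_comp_comm
    ((F.continuous_chr_smul (-m) x).intervalIntegrable (0:ℝ) (2 * π)) (μ := volume)
  rw [h, map_zero] at h2
  simpa using h2

theorem ext_S {x y : X} (h : ∀ m, F.S m x = F.S m y) : x = y :=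
  sub_eq_zero.1 (F.eq_zero_of_S_eq_zero fun m => by rw [map_sub, h, sub_self])

/-- The finite Fourier multiplier with symbol `μ` on the frequency set `s`. -/
def mul (s : Finset ℤ) (μ : ℤ → ℂ) : X →L[ℂ] X := ∑ m ∈ s, μ m • F.S m

omit [CompleteSpace X] in
theorem mul_apply (s : Finset ℤ) (μ : ℤ → ℂ) (x : X) : F.mul s μ x = ∑ m ∈ s, μ m • F.S m x := by
  simp [mul]

theorem S_mul (s : Finset ℤ) (μ : ℤ → ℂ) (m : ℤ) (x : X) :
    F.S m (F.mul s μ x) = if m ∈ s then μ m • F.S m x else 0 := by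
  rw [mul_apply, map_sum]
  simp only [map_smul, S_S, smul_ite, smul_zero, Finset.sum_ite_eq]

theorem mul_mul (s t : Finset ℤ) (μ ν : ℤ → ℂ) (x : X) :
    F.mul s μ (F.mul t ν x) = F.mul (s ∩ t) (fun m => μ m * ν m) x := by
  refine F.ext_S fun m => ?_
  simp only [S_mul, Finset.mem_inter]
  split_ifs <;> simp_all [smul_smul]

omit [CompleteSpace X] in
theorem mul_congr {s : Finset ℤ} {μ ν : ℤ → ℂ} (h : ∀ m ∈ s, μ m = ν m) (x : X) :
    F.mul s μ x = F.mul s ν x := by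
  rw [mul_apply, mul_apply]
  exact Finset.sum_congr rfl fun m hm => by rw [h m hm]

theorem comm_mul (A : X →L[ℂ] X) (hA : ∀ s x, A (F.T s x) = F.T s (A x)) (s : Finset ℤ) (μ : ℤ → ℂ)
    (x : X) : A (F.mul s μ x) = F.mul s μ (A x) := by
  simp only [mul_apply, map_sum, map_smul, F.comm_S A hA]

theorem T_mul (t : ℝ) (s : Finset ℤ) (μ : ℤ → ℂ) (x : X) :
    F.T t (F.mul s μ x) = F.mul s (fun m => chr m t * μ m) x := by
  simp only [mul_apply, map_sum, map_smul, T_S, smul_smul, mul_comm]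

/-- The fractional difference of order `α` with step `h` along the flow. -/
def diff (α h : ℝ) : X →L[ℂ] X := ∑' ν : ℕ, (diffCoeff α ν : ℂ) • F.T ((α - ν) * h)

omit [CompleteSpace X] in
theorem norm_T_le (s : ℝ) : ‖F.T s‖ ≤ 1 :=
  ContinuousLinearMap.opNorm_le_bound _ zero_le_one fun x => by rw [F.norm', one_mul]

omit [CompleteSpace X] in
theorem norm_diff_term_le (α h : ℝ) (ν : ℕ) :
    ‖(diffCoeff α ν : ℂ) • F.T ((α - ν) * h)‖ ≤ |diffCoeff α ν| := by
  rw [norm_smul, Complex.norm_real, Real.norm_eq_abs]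
  exact mul_le_of_le_one_right (abs_nonneg _) (F.norm_T_le _)

theorem summable_diff {α : ℝ} (hα : 0 < α) (h : ℝ) :
    Summable fun ν : ℕ => (diffCoeff α ν : ℂ) • F.T ((α - ν) * h) :=
  Summable.of_norm_bounded (summable_abs_diffCoeff hα) (F.norm_diff_term_le α h)

theorem hasSum_diff {α : ℝ} (hα : 0 < α) (h : ℝ) (x : X) :
    HasSum (fun ν : ℕ => (diffCoeff α ν : ℂ) • F.T ((α - ν) * h) x) (F.diff α h x) := by
  exact (F.summable_diff hα h).hasSum.mapL (ContinuousLinearMap.apply ℂ X x)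

/-- The total variation `∑ |C(α,ν)|`, bounding the norm of the difference operators. -/
def _root_.diffNorm (α : ℝ) : ℝ := ∑' ν : ℕ, |diffCoeff α ν|

theorem _root_.one_le_diffNorm {α : ℝ} (hα : 0 < α) : 1 ≤ diffNorm α := by
  have := (summable_abs_diffCoeff hα).le_tsum 0 (fun _ _ => abs_nonneg _)
  simpa [diffCoeff_zero, diffNorm] using this

omit [CompleteSpace X] in
theorem norm_diff_le {α : ℝ} (hα : 0 < α) (h : ℝ) (x : X) : ‖F.diff α h x‖ ≤ diffNorm α * ‖x‖ :=
  ContinuousLinearMap.le_of_opNorm_le _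
    (tsum_of_norm_bounded (summable_abs_diffCoeff hα).hasSum (F.norm_diff_term_le α h)) x

theorem comm_diff (A : X →L[ℂ] X) (hA : ∀ s x, A (F.T s x) = F.T s (A x)) {α : ℝ} (hα : 0 < α)
    (h : ℝ) (x : X) : A (F.diff α h x) = F.diff α h (A x) := by
  have h1 := (F.hasSum_diff hα h x).mapL A
  simp only [map_smul, hA] at h1
  exact h1.unique (F.hasSum_diff hα h (A x))

theorem S_diff {α : ℝ} (hα : 0 < α) (h : ℝ) (m : ℤ) (x : X) :
    F.S m (F.diff α h x) = diffSymbol α (m * h) • F.S m x := by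
  have h1 := (F.hasSum_diff hα h x).mapL (F.S m)
  rw [← h1.tsum_eq, diffSymbol]
  simp only [map_smul, S_T, smul_smul]
  rw [Summable.tsum_smul_const]
  · congr 1
    refine tsum_congr fun ν => ?_
    rw [chr]; congr 3; push_cast; ring
  · refine Summable.of_norm_bounded (summable_abs_diffCoeff hα) fun ν => ?_
    rw [norm_mul, norm_chr, mul_one, Complex.norm_real, Real.norm_eq_abs]

theorem mul_diff {α : ℝ} (hα : 0 < α) (h : ℝ) (s : Finset ℤ) (μ : ℤ → ℂ) (x : X) :
    F.mul s μ (F.diff α h x) = F.mul s (fun m => μ m * diffSymbol α (m * h)) x := by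
  simp only [mul_apply, S_diff _ hα, smul_smul]

theorem diff_mul {α : ℝ} (hα : 0 < α) (h : ℝ) (s : Finset ℤ) (μ : ℤ → ℂ) (x : X) :
    F.diff α h (F.mul s μ x) = F.mul s (fun m => μ m * diffSymbol α (m * h)) x := by
  refine F.ext_S fun m => ?_
  simp only [S_diff _ hα, S_mul]
  split_ifs <;> simp [smul_smul, mul_comm]

end IsoFlow

/-- **Abel summation**, nonincreasing weights. -/
theorem norm_sum_smul_le_of_antitone {E : Type*} [NormedAddCommGroup E] [NormedSpace ℂ E]
    {u : ℕ → E} {ρ : ℕ → ℝ} {A B : ℕ} {K M : ℝ} (hM : 0 ≤ M)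
    (hu : ∀ a b, A ≤ a → b ≤ B → ‖∑ j ∈ Finset.Ico a b, u j‖ ≤ M)
    (hρ : AntitoneOn ρ (Set.Ico A B)) (h0 : ∀ j ∈ Set.Ico A B, 0 ≤ ρ j)
    (hK : ∀ j ∈ Set.Ico A B, ρ j ≤ K) (hK0 : 0 ≤ K) {a b : ℕ} (ha : A ≤ a) (hb : b ≤ B) :
    ‖∑ j ∈ Finset.Ico a b, (ρ j : ℂ) • u j‖ ≤ K * M := by
  rcases le_or_gt b a with hab | hab
  · rw [Finset.Ico_eq_empty (by omega)]; simpa using mul_nonneg hK0 hM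
  rw [Finset.sum_Ico_eq_sum_range, Finset.sum_range_by_parts]
  have hG : ∀ n, a + n ≤ B → ‖∑ i ∈ Finset.range n, u (a + i)‖ ≤ M := fun n hn => by
    have := hu a (a + n) ha hn
    rwa [Finset.sum_Ico_eq_sum_range, Nat.add_sub_cancel_left] at this
  set n := b - a with hn
  have h1 : ‖((ρ (a + (n - 1)) : ℝ) : ℂ) • ∑ i ∈ Finset.range n, u (a + i)‖ ≤ ρ (a + (n - 1)) * M := by
    have h0' := h0 (a + (n - 1)) ⟨by omega, by omega⟩
    rw [norm_smul, Complex.norm_real, Real.norm_of_nonneg h0']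
    exact mul_le_mul_of_nonneg_left (hG n (by omega)) h0'
  have h2 : ‖∑ i ∈ Finset.range (n - 1), (((ρ (a + (i + 1)) : ℝ) : ℂ) - ((ρ (a + i) : ℝ) : ℂ)) •
      ∑ i ∈ Finset.range (i + 1), u (a + i)‖ ≤ (ρ a - ρ (a + (n - 1))) * M := by
    have := Finset.sum_range_sub' (fun i => ρ (a + i)) (n - 1)
    simp only [add_zero] at this
    rw [← this, Finset.sum_mul]
    refine norm_sum_le_of_le _ fun i hi => ?_
    have hi := Finset.mem_range.1 hi
    have h3 : ρ (a + (i + 1)) ≤ ρ (a + i) :=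
      hρ ⟨by omega, by omega⟩ ⟨by omega, by omega⟩ (by omega)
    rw [norm_smul, ← Complex.ofReal_sub, Complex.norm_real, Real.norm_of_nonpos (by linarith), neg_sub]
    exact mul_le_mul_of_nonneg_left (hG _ (by omega)) (by linarith)
  refine (norm_sub_le _ _).trans ((add_le_add h1 h2).trans ?_)
  have := mul_le_mul_of_nonneg_right (hK a ⟨ha, by omega⟩) hM
  linarith

/-- **Abel summation**, nondecreasing weights. -/
theorem norm_sum_smul_le_of_monotone {E : Type*} [NormedAddCommGroup E] [NormedSpace ℂ E]
    {u : ℕ → E} {ρ : ℕ → ℝ} {A B : ℕ} {K M : ℝ} (hM : 0 ≤ M)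
    (hu : ∀ a b, A ≤ a → b ≤ B → ‖∑ j ∈ Finset.Ico a b, u j‖ ≤ M)
    (hρ : MonotoneOn ρ (Set.Ico A B)) (h0 : ∀ j ∈ Set.Ico A B, 0 ≤ ρ j)
    (hK : ∀ j ∈ Set.Ico A B, ρ j ≤ K) (hK0 : 0 ≤ K) {a b : ℕ} (ha : A ≤ a) (hb : b ≤ B) :
    ‖∑ j ∈ Finset.Ico a b, (ρ j : ℂ) • u j‖ ≤ 2 * K * M := by
  have h1 := norm_sum_smul_le_of_antitone (ρ := fun j => K - ρ j) hM hu
    (fun i hi j hj hij => sub_le_sub_left (hρ hi hj hij) K) (fun j hj => sub_nonneg.2 (hK j hj))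
    (fun j hj => sub_le_self K (h0 j hj)) hK0 ha hb
  have h2 : ‖(K : ℂ) • ∑ j ∈ Finset.Ico a b, u j‖ ≤ K * M := by
    rw [norm_smul, Complex.norm_real, Real.norm_of_nonneg hK0]
    exact mul_le_mul_of_nonneg_left (hu a b ha hb) hK0
  have h3 : ∑ j ∈ Finset.Ico a b, (ρ j : ℂ) • u j = (K : ℂ) • ∑ j ∈ Finset.Ico a b, u j -
      ∑ j ∈ Finset.Ico a b, ((K - ρ j : ℝ) : ℂ) • u j := by
    simp only [Complex.ofReal_sub, sub_smul, Finset.sum_sub_distrib, Finset.smul_sum, sub_sub_cancel]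
  rw [h3]
  refine (norm_sub_le _ _).trans ((add_le_add h2 h1).trans ?_)
  linarith

/-- The symmetric frequency block `A ≤ |m| < B`. -/
def blk (A B : ℕ) : Finset ℤ := (Finset.Ioo (-B : ℤ) B).filter fun m => A ≤ m.natAbs

theorem mem_blk {A B : ℕ} {m : ℤ} : m ∈ blk A B ↔ A ≤ m.natAbs ∧ m.natAbs < B := by
  simp only [blk, Finset.mem_filter, Finset.mem_Ioo]; omega

theorem sum_blk {E : Type*} [AddCommMonoid E] {A : ℕ} (hA : 1 ≤ A) (B : ℕ) (f : ℤ → E) :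
    ∑ m ∈ blk A B, f m = ∑ j ∈ Finset.Ico A B, f j + ∑ j ∈ Finset.Ico A B, f (-j) := by
  have h : blk A B = ((Finset.Ico A B).image fun j : ℕ => (j : ℤ)) ∪
      (Finset.Ico A B).image fun j : ℕ => (-j : ℤ) := by
    ext m
    simp only [mem_blk, Finset.mem_union, Finset.mem_image, Finset.mem_Ico]
    constructor
    · intro h
      rcases le_or_gt 0 m with h0 | h0
      · exact Or.inl ⟨m.natAbs, h, by omega⟩
      · exact Or.inr ⟨m.natAbs, h, by omega⟩
    · rintro (⟨j, h, rfl⟩ | ⟨j, h, rfl⟩) <;> omega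
  rw [h, Finset.sum_union, Finset.sum_image (by intro a _ b _ h; simpa using h),
    Finset.sum_image (by intro a _ b _ h; simpa using h)]
  rw [Finset.disjoint_left]
  simp only [Finset.mem_image, Finset.mem_Ico, not_exists, not_and]
  rintro _ ⟨j, h, rfl⟩ k hk hjk
  omega

/-- A unimodular symbol which on each of the half-lines `m ≥ 0`, `m < 0` is a constant times
a character. -/
def IsPhase (φ : ℤ → ℂ) : Prop :=
  ∃ a b c : ℝ, ∀ m : ℤ, φ m = Complex.exp (((c * m + if 0 ≤ m then a else b : ℝ) : ℂ) * Complex.I)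

theorem IsPhase.one : IsPhase fun _ => 1 := ⟨0, 0, 0, fun m => by simp⟩

theorem IsPhase.mul {φ ψ : ℤ → ℂ} (h : IsPhase φ) (h' : IsPhase ψ) : IsPhase fun m => φ m * ψ m := by
  obtain ⟨a, b, c, h⟩ := h
  obtain ⟨a', b', c', h'⟩ := h'
  refine ⟨a + a', b + b', c + c', fun m => ?_⟩
  beta_reduce
  rw [h, h', ← Complex.exp_add]
  congr 1
  split_ifs <;> push_cast <;> ring

theorem IsPhase.inv {φ : ℤ → ℂ} (h : IsPhase φ) : IsPhase fun m => (φ m)⁻¹ := by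
  obtain ⟨a, b, c, h⟩ := h
  refine ⟨-a, -b, -c, fun m => ?_⟩
  beta_reduce
  rw [h, ← Complex.exp_neg]
  congr 1
  split_ifs <;> push_cast <;> ring

theorem IsPhase.ne_zero {φ : ℤ → ℂ} (h : IsPhase φ) (m : ℤ) : φ m ≠ 0 := by
  obtain ⟨a, b, c, h⟩ := h
  rw [h]; exact Complex.exp_ne_zero _

theorem exists_phase_diffSymbol {α : ℝ} (hα : 0 < α) (h : ℝ) :
    ∃ φ, IsPhase φ ∧ ∀ m : ℤ, |(m : ℝ)| * |h| < 2 * π →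
      diffSymbol α (m * h) = φ m * ((2 * Real.sin (|(m : ℝ)| * |h| / 2)) ^ α : ℝ) := by
  have key : ∀ h : ℝ, 0 ≤ h → ∃ φ, IsPhase φ ∧ ∀ m : ℤ, |(m : ℝ)| * h < 2 * π →
      diffSymbol α (m * h) = φ m * ((2 * Real.sin (|(m : ℝ)| * h / 2)) ^ α : ℝ) := by
    intro h hh
    refine ⟨_, ⟨α * π / 2, -(α * π / 2), α * h / 2, fun m => rfl⟩, fun m hm => ?_⟩
    split_ifs with hm0
    · have : (0 : ℝ) ≤ m := by exact_mod_cast hm0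
      rw [abs_of_nonneg this] at hm ⊢
      rw [diffSymbol_of_mem hα (mul_nonneg this hh) hm, ← Complex.exp_add]
      congr 2; push_cast; ring
    · have : (m : ℝ) ≤ 0 := by exact_mod_cast (not_le.1 hm0).le
      rw [abs_of_nonpos this] at hm ⊢
      rw [show (m * h : ℝ) = -(-m * h) by ring, diffSymbol_neg,
        diffSymbol_of_mem hα (mul_nonneg (by linarith) hh) hm, map_mul, map_mul, Complex.conj_ofReal,
        ← Complex.exp_conj, ← Complex.exp_conj, ← Complex.exp_add]
      congr 2
      simp only [map_mul, Complex.conj_ofReal, Complex.conj_I]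
      push_cast; ring
  rcases le_total 0 h with hh | hh
  · rw [abs_of_nonneg hh]; exact key h hh
  · rw [abs_of_nonpos hh]
    obtain ⟨φ, ⟨a, b, c, hφ⟩, H⟩ := key (-h) (by linarith)
    refine ⟨fun m => starRingEnd ℂ (φ m), ⟨-a, -b, -c, fun m => ?_⟩, fun m hm => ?_⟩
    · beta_reduce
      rw [hφ, ← Complex.exp_conj]
      congr 1
      simp only [map_mul, Complex.conj_ofReal, Complex.conj_I]
      split_ifs <;> push_cast <;> ring
    · rw [show (m * h : ℝ) = -(m * (-h)) by ring, diffSymbol_neg, H m hm, map_mul,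
        Complex.conj_ofReal]

theorem exists_phase_one_sub_chr (h : ℝ) :
    ∃ φ, IsPhase φ ∧ ∀ m : ℤ, 1 - chr m h = φ m * ((2 * Real.sin (|(m : ℝ)| * h / 2) : ℝ) : ℂ) := by
  refine ⟨_, ⟨-π / 2, π / 2, h / 2, fun m => rfl⟩, fun m => ?_⟩
  split_ifs with hm0
  · have : (0 : ℝ) ≤ m := by exact_mod_cast hm0
    rw [abs_of_nonneg this]
    have h1 := congrArg (starRingEnd ℂ) (one_sub_exp_eq (m * h))
    simp only [map_sub, map_one, map_mul, Complex.conj_ofReal, ← Complex.exp_conj, map_neg,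
      Complex.conj_I] at h1
    rw [mul_neg, neg_neg] at h1
    rw [chr, h1, mul_comm]
    congr 2; push_cast; ring
  · have : (m : ℝ) ≤ 0 := by exact_mod_cast (not_le.1 hm0).le
    rw [abs_of_nonpos this]
    have h1 := one_sub_exp_eq (-(m * h))
    have e : (-((-(m * h) : ℝ) * Complex.I)) = ((m * h : ℝ) : ℂ) * Complex.I := by push_cast; ring
    rw [e] at h1
    rw [chr, h1, mul_comm]
    congr 2
    · congr 1; push_cast; ring
    · congr 3; ring

theorem exists_phase_I_mul_cpow (r : ℝ) :
    ∃ φ, IsPhase φ ∧ ∀ m : ℤ, m ≠ 0 →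
      (Complex.I * (m : ℂ)) ^ (r : ℂ) = φ m * ((|(m : ℝ)| ^ r : ℝ) : ℂ) := by
  refine ⟨_, ⟨r * π / 2, -(r * π / 2), 0, fun m => rfl⟩, fun m hm => ?_⟩
  have key : ∀ z : ℂ, z ≠ 0 → ∀ t : ℝ, 0 < t → (((t : ℝ) : ℂ) * z) ^ (r : ℂ) =
      Complex.exp (Complex.log z * r) * ((t ^ r : ℝ) : ℂ) := by
    intro z hz t ht
    rw [Complex.cpow_def_of_ne_zero (mul_ne_zero (by exact_mod_cast ht.ne') hz),
      Complex.log_ofReal_mul ht hz, add_mul, Complex.exp_add, Real.rpow_def_of_pos ht, mul_comm]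
    push_cast; rfl
  split_ifs with hm0
  · have h0 : (0 : ℝ) < m := by exact_mod_cast lt_of_le_of_ne hm0 (Ne.symm hm)
    rw [abs_of_pos h0, mul_comm Complex.I]
    have := key Complex.I Complex.I_ne_zero m h0
    rw [Complex.ofReal_intCast] at this
    rw [this, Complex.log_I]
    congr 2; push_cast; ring
  · have h0 : (m : ℝ) < 0 := by exact_mod_cast not_le.1 hm0
    rw [abs_of_neg h0]
    have := key (-Complex.I) (neg_ne_zero.2 Complex.I_ne_zero) (-m) (by linarith)
    rw [Complex.ofReal_neg, Complex.ofReal_intCast] at this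
    rw [show Complex.I * (m : ℂ) = -(m : ℂ) * -Complex.I by ring, this, Complex.log_neg_I]
    congr 2; push_cast; ring

namespace IsoFlow

variable {X : Type*} [NormedAddCommGroup X] [NormedSpace ℂ X] (F : IsoFlow X)

/-- Uniform boundedness of the frequency projections onto intervals. -/
def RieszBound (R : ℝ) : Prop :=
  0 < R ∧ ∀ (a b : ℤ) (x : X), ‖∑ m ∈ Finset.Ico a b, F.S m x‖ ≤ R * ‖x‖

variable {F} [CompleteSpace X]

omit [CompleteSpace X] in
theorem RieszBound.norm_mul_le {R : ℝ} (hR : F.RieszBound R) {A B : ℕ} (hA : 1 ≤ A) {μ φ : ℤ → ℂ}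
    (hφ : IsPhase φ) {ρ₁ ρ₂ : ℝ → ℝ} {M₁ M₂ : ℝ} (hM₁ : 0 ≤ M₁) (hM₂ : 0 ≤ M₂)
    (ha₁ : AntitoneOn ρ₁ (Set.Ico (A : ℝ) B)) (h₁ : ∀ ξ ∈ Set.Ico (A : ℝ) B, 0 ≤ ρ₁ ξ ∧ ρ₁ ξ ≤ M₁)
    (ha₂ : MonotoneOn ρ₂ (Set.Ico (A : ℝ) B)) (h₂ : ∀ ξ ∈ Set.Ico (A : ℝ) B, 0 ≤ ρ₂ ξ ∧ ρ₂ ξ ≤ M₂)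
    (hμ : ∀ m ∈ blk A B, μ m = φ m * ((ρ₁ |(m : ℝ)| * ρ₂ |(m : ℝ)| : ℝ) : ℂ)) (x : X) :
    ‖F.mul (blk A B) μ x‖ ≤ 4 * R * (M₁ * M₂) * ‖x‖ := by
  rcases le_or_gt B A with hAB | hAB
  · have : blk A B = ∅ := Finset.eq_empty_of_forall_notMem fun m hm => by
      rw [mem_blk] at hm; omega
    rw [this, mul_apply, Finset.sum_empty, norm_zero]
    have := hR.1
    positivity
  have cast_mem : ∀ j ∈ Set.Ico A B, (j : ℝ) ∈ Set.Ico (A : ℝ) B := fun j hj =>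
    ⟨by exact_mod_cast hj.1, by exact_mod_cast hj.2⟩
  have abel : ∀ u : ℕ → X, (∀ a b, ‖∑ j ∈ Finset.Ico a b, u j‖ ≤ R * ‖x‖) →
      ‖∑ j ∈ Finset.Ico A B, ((ρ₁ j * ρ₂ j : ℝ) : ℂ) • u j‖ ≤ 2 * M₂ * (M₁ * (R * ‖x‖)) := by
    intro u hu
    have hx : 0 ≤ R * ‖x‖ := mul_nonneg hR.1.le (norm_nonneg _)
    have s1 := fun a b (ha : A ≤ a) (hb : b ≤ B) => norm_sum_smul_le_of_antitone
      (ρ := fun j => ρ₁ j) (u := u) hx (fun a b _ _ => hu a b)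
      (fun i hi j hj hij => ha₁ (cast_mem i hi) (cast_mem j hj) (by exact_mod_cast hij))
      (fun j hj => (h₁ j (cast_mem j hj)).1) (fun j hj => (h₁ j (cast_mem j hj)).2) hM₁ ha hb
    have s2 := norm_sum_smul_le_of_monotone (ρ := fun j => ρ₂ j) (mul_nonneg hM₁ hx) s1
      (fun i hi j hj hij => ha₂ (cast_mem i hi) (cast_mem j hj) (by exact_mod_cast hij))
      (fun j hj => (h₂ j (cast_mem j hj)).1) (fun j hj => (h₂ j (cast_mem j hj)).2) hM₂ le_rfl le_rfl
    simpa only [smul_smul, ← Complex.ofReal_mul, mul_comm] using s2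
  obtain ⟨a, b, c, hφ⟩ := hφ
  have e : F.mul (blk A B) μ x =
      Complex.exp (a * Complex.I) • ∑ j ∈ Finset.Ico A B, ((ρ₁ j * ρ₂ j : ℝ) : ℂ) • F.S j (F.T c x) +
      Complex.exp (b * Complex.I) •
        ∑ j ∈ Finset.Ico A B, ((ρ₁ j * ρ₂ j : ℝ) : ℂ) • F.S (-j) (F.T c x) := by
    rw [mul_apply, sum_blk hA, Finset.smul_sum, Finset.smul_sum]
    congr 1 <;> refine Finset.sum_congr rfl fun j hj => ?_ <;> rw [Finset.mem_Ico] at hj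
    · rw [hμ j (by rw [mem_blk]; omega), hφ, S_T, smul_smul, smul_smul, if_pos (by omega), chr,
        mul_right_comm, ← Complex.exp_add]
      congr 2
      · congr 1; push_cast; ring
      · simp
    · rw [hμ (-j) (by rw [mem_blk]; omega), hφ, S_T, smul_smul, smul_smul, if_neg (by omega), chr,
        mul_right_comm, ← Complex.exp_add]
      congr 2
      · congr 1; push_cast; ring
      · simp
  have t1 := abel (fun j => F.S j (F.T c x)) fun a b => by
    have := hR.2 a b (F.T c x)
    rw [F.norm'] at this
    convert this using 2
    refine Finset.sum_bij (fun j _ => (j : ℤ)) ?_ ?_ ?_ ?_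
    · intro j hj; simp only [Finset.mem_Ico] at *; omega
    · intro i _ j _ h; simpa using h
    · intro m hm
      simp only [Finset.mem_Ico] at hm
      exact ⟨m.toNat, by simp only [Finset.mem_Ico]; omega, by omega⟩
    · intro j _; rfl
  have t2 := abel (fun j => F.S (-j) (F.T c x)) fun a b => by
    have := hR.2 (1 - b) (1 - a) (F.T c x)
    rw [F.norm'] at this
    convert this using 2
    refine Finset.sum_bij (fun j _ => -(j : ℤ)) ?_ ?_ ?_ ?_
    · intro j hj; simp only [Finset.mem_Ico] at *; omega
    · intro i _ j _ h; simpa using h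
    · intro m hm
      simp only [Finset.mem_Ico] at hm
      exact ⟨(-m).toNat, by simp only [Finset.mem_Ico]; omega, by omega⟩
    · intro j _; rfl
  rw [e]
  refine (norm_add_le _ _).trans ?_
  rw [norm_smul, norm_smul, Complex.norm_exp_ofReal_mul_I, Complex.norm_exp_ofReal_mul_I]
  linarith

end IsoFlow

/-- A power-type smoothness inequality for a norm. -/
structure SmoothNorm (X : Type*) [NormedAddCommGroup X] (θ K : ℝ) : Prop where
  one_le : 1 ≤ θ
  le_two : θ ≤ 2
  nonneg : 0 ≤ K
  le : ∀ u v : X, ‖u + v‖ ^ θ + ‖u - v‖ ^ θ ≤ 2 * ‖u‖ ^ θ + K * ‖v‖ ^ θ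

/-- Convexity of `‖·‖^θ` at midpoints. -/
theorem norm_rpow_half_add_le {X : Type*} [NormedAddCommGroup X] [NormedSpace ℂ X] {θ : ℝ}
    (hθ : 1 ≤ θ) (u v : X) : ‖(2⁻¹ : ℂ) • (u + v)‖ ^ θ ≤ (‖u‖ ^ θ + ‖v‖ ^ θ) / 2 := by
  have h1 : ‖(2⁻¹ : ℂ) • (u + v)‖ ≤ (1 / 2) * ‖u‖ + (1 / 2) * ‖v‖ := by
    rw [norm_smul]
    norm_num
    linarith [norm_add_le u v]
  have h2 := (convexOn_rpow hθ).2 (Set.mem_Ici.2 (norm_nonneg u)) (Set.mem_Ici.2 (norm_nonneg v))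
    (by norm_num : (0 : ℝ) ≤ 1 / 2) (by norm_num : (0 : ℝ) ≤ 1 / 2) (by norm_num)
  simp only [smul_eq_mul] at h2
  calc _ ≤ ((1 / 2) * ‖u‖ + (1 / 2) * ‖v‖) ^ θ :=
        Real.rpow_le_rpow (norm_nonneg _) h1 (by linarith)
    _ ≤ _ := h2
    _ = _ := by ring

theorem SmoothNorm.step {X : Type*} [NormedAddCommGroup X] [NormedSpace ℂ X] {θ K : ℝ}
    (h : SmoothNorm X θ K) (T T' : X →L[ℂ] X) (hT : ∀ x, ‖T x‖ = ‖x‖) (hT' : ∀ x, ‖T' x‖ = ‖x‖)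
    (hTT : ∀ x, T' (T x) = x) (a B : X) :
    ‖a + (B - T B)‖ ^ θ ≤ ‖a‖ ^ θ + 3 * K * ‖B‖ ^ θ + K * ‖T' a - a‖ ^ θ := by
  have hθ := h.one_le
  set Φ : X → ℝ := fun x => ‖x‖ ^ θ with hΦ
  have mono : ∀ x y : X, ‖x‖ ≤ ‖y‖ → Φ x ≤ Φ y := fun x y hxy =>
    Real.rpow_le_rpow (norm_nonneg _) hxy (by linarith)
  have cvx := fun u v : X => norm_rpow_half_add_le hθ u v
  have two : (2 : ℝ) ^ θ ≤ 4 := by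
    calc (2 : ℝ) ^ θ ≤ 2 ^ (2 : ℝ) := Real.rpow_le_rpow_of_exponent_le (by norm_num) h.le_two
      _ = 4 := by norm_num
  have hm : ∀ x y : X, x = (2⁻¹ : ℂ) • (x + y) + (2⁻¹ : ℂ) • (x - y) := fun x y => by module
  have hm' : ∀ x y : X, y = (2⁻¹ : ℂ) • (x + y) - (2⁻¹ : ℂ) • (x - y) := fun x y => by module
  have sm : ∀ x y : X, Φ x + Φ y ≤ 2 * Φ ((2⁻¹ : ℂ) • (x + y)) + K * Φ ((2⁻¹ : ℂ) • (x - y)) := by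
    intro x y
    have := h.le ((2⁻¹ : ℂ) • (x + y)) ((2⁻¹ : ℂ) • (x - y))
    rwa [← hm, ← hm'] at this
  set ε := T' a - a with hε
  have e1 : Φ (a - T B) = Φ (a - B + ε) := by
    have : ‖a - T B‖ = ‖a - B + ε‖ := by
      rw [← hT' (a - T B), map_sub, hTT, hε]; congr 1; abel
    simp only [hΦ, this]
  have s1 := sm (a + (B - T B)) a
  have s2 := cvx (a + B) (a - T B)
  have e2 : a + (B - T B) + a = a + B + (a - T B) := by abel
  rw [e2] at s1
  have s3 := sm (a + B) (a - B + ε)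
  have s4 : Φ ((2⁻¹ : ℂ) • (a + B + (a - B + ε))) ≤ Φ a := by
    have h4 := cvx a (T' a)
    rw [hT'] at h4
    have : a + B + (a - B + ε) = a + T' a := by rw [hε]; abel
    rw [this]
    refine h4.trans (le_of_eq ?_); simp only [hΦ]; ring
  have s5 : Φ ((2⁻¹ : ℂ) • (a + (B - T B) - a)) ≤ Φ B := by
    refine mono _ _ ?_
    rw [norm_smul, add_sub_cancel_left]
    have := norm_sub_le B (T B)
    rw [hT] at this
    norm_num; linarith
  have s6 : Φ ((2⁻¹ : ℂ) • (a + B - (a - B + ε))) ≤ 2 * Φ B + Φ ε := by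
    have h6 := cvx ((2 : ℂ) • B) (-ε)
    have : a + B - (a - B + ε) = (2 : ℂ) • B + -ε := by rw [two_smul]; abel
    rw [this]
    refine h6.trans ?_
    rw [norm_smul, norm_neg, Real.mul_rpow (norm_nonneg _) (norm_nonneg _)]
    have n2 : ‖(2 : ℂ)‖ = 2 := by norm_num
    rw [n2]
    have p1 : 0 ≤ ‖B‖ ^ θ := by positivity
    have p2 : 0 ≤ ‖ε‖ ^ θ := by positivity
    have := mul_le_mul_of_nonneg_right two p1
    simp only [hΦ]; linarith
  have s7 := mul_le_mul_of_nonneg_left s5 h.nonneg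
  have s8 := mul_le_mul_of_nonneg_left s6 h.nonneg
  simp only [hΦ] at *
  linarith

/-- **Schur's test** for finite sums. -/
theorem sum_rpow_sum_mul_le {ι κ : Type*} (s : Finset ι) (t : Finset κ) {k : ι → κ → ℝ} {y : κ → ℝ}
    {M θ : ℝ} (hθ : 1 ≤ θ) (hk : ∀ i j, 0 ≤ k i j) (hy : ∀ j, 0 ≤ y j) (hM : 0 ≤ M)
    (h1 : ∀ i ∈ s, ∑ j ∈ t, k i j ≤ M) (h2 : ∀ j ∈ t, ∑ i ∈ s, k i j ≤ M) :
    ∑ i ∈ s, (∑ j ∈ t, k i j * y j) ^ θ ≤ M ^ θ * ∑ j ∈ t, y j ^ θ := by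
  have hθ0 : 0 < θ := by linarith
  have step : ∀ i ∈ s, (∑ j ∈ t, k i j * y j) ^ θ ≤ M ^ (θ - 1) * ∑ j ∈ t, k i j * y j ^ θ := by
    intro i hi
    have hP : 0 ≤ ∑ j ∈ t, k i j * y j ^ θ :=
      Finset.sum_nonneg fun j _ => mul_nonneg (hk i j) (Real.rpow_nonneg (hy j) _)
    have hQ : 0 ≤ ∑ j ∈ t, k i j := Finset.sum_nonneg fun j _ => hk i j
    have := Real.inner_le_weight_mul_Lp_of_nonneg t hθ (k i) y (hk i) hy
    calc (∑ j ∈ t, k i j * y j) ^ θ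
        ≤ ((∑ j ∈ t, k i j) ^ (1 - θ⁻¹) * (∑ j ∈ t, k i j * y j ^ θ) ^ θ⁻¹) ^ θ :=
          Real.rpow_le_rpow (Finset.sum_nonneg fun j _ => mul_nonneg (hk i j) (hy j)) this hθ0.le
      _ = (∑ j ∈ t, k i j) ^ (θ - 1) * ∑ j ∈ t, k i j * y j ^ θ := by
          rw [Real.mul_rpow (by positivity) (by positivity), ← Real.rpow_mul hQ, ← Real.rpow_mul hP,
            inv_mul_cancel₀ hθ0.ne', Real.rpow_one]
          congr 2; field_simp
      _ ≤ _ := mul_le_mul_of_nonneg_right (Real.rpow_le_rpow hQ (h1 i hi) (by linarith)) hP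
  calc _ ≤ ∑ i ∈ s, M ^ (θ - 1) * ∑ j ∈ t, k i j * y j ^ θ := Finset.sum_le_sum step
    _ = M ^ (θ - 1) * ∑ j ∈ t, (∑ i ∈ s, k i j) * y j ^ θ := by
        rw [← Finset.mul_sum, Finset.sum_comm]; simp only [Finset.sum_mul]
    _ ≤ M ^ (θ - 1) * ∑ j ∈ t, M * y j ^ θ := by
        refine mul_le_mul_of_nonneg_left (Finset.sum_le_sum fun j hj => ?_) (Real.rpow_nonneg hM _)
        exact mul_le_mul_of_nonneg_right (h2 j hj) (Real.rpow_nonneg (hy j) _)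
    _ = _ := by
        rw [← Finset.mul_sum, ← mul_assoc]
        congr 1
        rcases hM.eq_or_lt with rfl | hM
        · rw [mul_zero, Real.zero_rpow hθ0.ne']
        · rw [← Real.rpow_add_one hM.ne']; congr 1; ring

/-- The dyadic frequency blocks starting at level `n`. -/
def fb (n i : ℕ) : Finset ℤ := blk (if i = 0 then 1 else 2 ^ (n + i - 1)) (2 ^ (n + i))

theorem fb_lo_pos (n i : ℕ) : 1 ≤ (if i = 0 then 1 else 2 ^ (n + i - 1) : ℕ) := by
  split_ifs
  · exact le_rfl
  · exact Nat.one_le_two_pow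

theorem fb_zero (n : ℕ) : fb n 0 = blk 1 (2 ^ n) := by simp [fb]

theorem fb_succ (n i : ℕ) : fb n (i + 1) = blk (2 ^ (n + i)) (2 ^ (n + i + 1)) := by
  simp [fb, ← add_assoc]

theorem fb_disjoint (n : ℕ) {i j : ℕ} (hij : i ≠ j) : Disjoint (fb n i) (fb n j) := by
  have key : ∀ i j : ℕ, i < j → ∀ m ∈ fb n i, m ∉ fb n j := by
    intro i j h m hm hm'
    obtain ⟨j, rfl⟩ : ∃ k, j = k + 1 := ⟨j - 1, by omega⟩
    rw [fb_succ, mem_blk] at hm'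
    rw [fb, mem_blk] at hm
    have : (2 : ℕ) ^ (n + i) ≤ 2 ^ (n + j) := Nat.pow_le_pow_right (by norm_num) (by omega)
    omega
  rw [Finset.disjoint_left]
  rcases hij.lt_or_gt with h | h
  · exact key i j h
  · exact fun m hm hm' => key j i h m hm' hm

namespace IsoFlow

variable {X : Type*} [NormedAddCommGroup X] [NormedSpace ℂ X] (F : IsoFlow X)

/-- Projection onto the frequencies in `s`. -/
def P (s : Finset ℤ) : X →L[ℂ] X := F.mul s fun _ => 1

variable [CompleteSpace X]

theorem sub_T_mul (h : ℝ) (s : Finset ℤ) (μ : ℤ → ℂ) (x : X) :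
    F.mul s μ x - F.T h (F.mul s μ x) = F.mul s (fun m => (1 - chr m h) * μ m) x := by
  rw [T_mul]
  simp only [mul_apply, ← Finset.sum_sub_distrib, ← sub_smul, sub_mul, one_mul]

theorem mul_P (s t : Finset ℤ) (μ : ℤ → ℂ) (x : X) : F.mul s μ (F.P t x) = F.mul (s ∩ t) μ x := by
  rw [P, mul_mul]; simp only [mul_one]

theorem P_mul (s t : Finset ℤ) (μ : ℤ → ℂ) (x : X) : F.P s (F.mul t μ x) = F.mul (s ∩ t) μ x := by
  rw [P, mul_mul]; simp only [one_mul]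

variable {F}

omit [CompleteSpace X] in
theorem norm_T_neg_sub (h : ℝ) (x : X) : ‖F.T (-h) x - x‖ = ‖x - F.T h x‖ := by
  rw [← F.norm' h (F.T (-h) x - x), map_sub, ← F.add', add_neg_cancel, F.zero']

theorem two_sin_bounds {ξ h : ℝ} (h0 : 0 ≤ ξ * h) (h1 : ξ * h ≤ π) :
    2 * (ξ * h) / π ≤ 2 * Real.sin (ξ * h / 2) ∧ 2 * Real.sin (ξ * h / 2) ≤ ξ * h := by
  constructor
  · have := Real.mul_le_sin (x := ξ * h / 2) (by linarith) (by linarith)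
    have e : 2 * (ξ * h) / π = 2 * (2 / π * (ξ * h / 2)) := by ring
    linarith
  · have := Real.sin_le (x := ξ * h / 2) (by linarith)
    linarith

theorem two_sin_mono {ξ ξ' h : ℝ} (hh : 0 ≤ h) (h0 : 0 ≤ ξ) (h1 : ξ' * h ≤ π) (hξ : ξ ≤ ξ') :
    2 * Real.sin (ξ * h / 2) ≤ 2 * Real.sin (ξ' * h / 2) := by
  have h2 : ξ * h ≤ ξ' * h := mul_le_mul_of_nonneg_right hξ hh
  have h3 : 0 ≤ ξ * h := mul_nonneg h0 hh
  have := Real.sin_le_sin_of_le_of_le_pi_div_two (x := ξ * h / 2) (y := ξ' * h / 2)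
    (by linarith [Real.pi_pos]) (by linarith) (by linarith)
  linarith

theorem RieszBound.norm_sub_T_le {R : ℝ} (hR : F.RieszBound R) {A B : ℕ} (hA : 1 ≤ A) {h : ℝ}
    (hh : 0 ≤ h) (hB : B * h ≤ π) (x : X) :
    ‖F.P (blk A B) x - F.T h (F.P (blk A B) x)‖ ≤ 4 * R * (B * h) * ‖x‖ := by
  obtain ⟨φ, hφ, H⟩ := exists_phase_one_sub_chr h
  have hle : ∀ ξ ∈ Set.Ico (A : ℝ) B, 0 ≤ ξ * h ∧ ξ * h ≤ B * h := fun ξ hξ =>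
    ⟨mul_nonneg (le_trans (by positivity) hξ.1) hh, mul_le_mul_of_nonneg_right hξ.2.le hh⟩
  rw [P, sub_T_mul]
  have := hR.norm_mul_le hA (μ := fun m => (1 - chr m h) * 1) hφ (ρ₁ := fun _ => 1)
    (ρ₂ := fun ξ => 2 * Real.sin (ξ * h / 2)) (M₁ := 1) (M₂ := B * h) zero_le_one (by positivity)
    (fun _ _ _ _ _ => le_rfl) (fun _ _ => ⟨zero_le_one, le_rfl⟩)
    (fun ξ hξ ξ' hξ' h' => two_sin_mono hh (le_trans (by positivity) hξ.1) ((hle ξ' hξ').2.trans hB) h')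
    (fun ξ hξ => by
      have h1 := hle ξ hξ
      have h2 := two_sin_bounds h1.1 (h1.2.trans hB)
      refine ⟨le_trans ?_ h2.1, h2.2.trans h1.2⟩
      have := h1.1
      positivity)
    (fun m _ => by rw [mul_one, H, one_mul]) x
  rwa [one_mul] at this

theorem RieszBound.exists_sub_T {R : ℝ} (hR : F.RieszBound R) {A B : ℕ} (hA : 1 ≤ A) {h : ℝ}
    (hh : 0 < h) (hB : B * h ≤ π) (x : X) :
    ∃ b : X, b - F.T h b = F.P (blk A B) x ∧ ‖b‖ ≤ 4 * R * (π / (2 * (A * h))) * ‖x‖ := by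
  obtain ⟨φ, hφ, H⟩ := exists_phase_one_sub_chr h
  have hA0 : (0 : ℝ) < A := by exact_mod_cast hA
  have hle : ∀ ξ ∈ Set.Ico (A : ℝ) B, A * h ≤ ξ * h ∧ ξ * h ≤ π := fun ξ hξ =>
    ⟨mul_le_mul_of_nonneg_right hξ.1 hh.le, (mul_le_mul_of_nonneg_right hξ.2.le hh.le).trans hB⟩
  have hAh : 0 < A * h := by positivity
  have hlow : ∀ ξ ∈ Set.Ico (A : ℝ) B, 2 * (A * h) / π ≤ 2 * Real.sin (ξ * h / 2) := fun ξ hξ => by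
    have h1 := hle ξ hξ
    refine le_trans ?_ (two_sin_bounds (by linarith) h1.2).1
    exact div_le_div_of_nonneg_right (by linarith) Real.pi_pos.le
  have hpos : ∀ ξ ∈ Set.Ico (A : ℝ) B, 0 < 2 * Real.sin (ξ * h / 2) := fun ξ hξ =>
    lt_of_lt_of_le (by positivity) (hlow ξ hξ)
  refine ⟨F.mul (blk A B) (fun m => (1 - chr m h)⁻¹) x, ?_, ?_⟩
  · rw [sub_T_mul, P]
    refine F.mul_congr (fun m hm => mul_inv_cancel₀ ?_) x
    rw [H]
    refine mul_ne_zero (hφ.ne_zero m) ?_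
    have := hpos |(m : ℝ)| (by
      rw [mem_blk] at hm
      rw [← Int.cast_abs, Int.abs_eq_natAbs]
      exact ⟨by exact_mod_cast hm.1, by exact_mod_cast hm.2⟩)
    exact_mod_cast this.ne'
  · have := hR.norm_mul_le hA (μ := fun m => (1 - chr m h)⁻¹) hφ.inv
      (ρ₁ := fun ξ => (2 * Real.sin (ξ * h / 2))⁻¹)
      (ρ₂ := fun _ => 1) (M₁ := π / (2 * (A * h))) (M₂ := 1) (by positivity) zero_le_one
      (fun ξ hξ ξ' hξ' h' => inv_anti₀ (hpos ξ hξ)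
        (two_sin_mono hh.le (hA0.le.trans hξ.1) (hle ξ' hξ').2 h'))
      (fun ξ hξ => ⟨(inv_pos.2 (hpos ξ hξ)).le, by
        simpa [inv_div] using inv_anti₀ (by positivity) (hlow ξ hξ)⟩)
      (fun _ _ _ _ _ => le_rfl) (fun _ _ => ⟨zero_le_one, le_rfl⟩)
      (fun m _ => by rw [H, mul_one, mul_inv]; push_cast; rfl) x
    rwa [mul_one] at this

theorem core {R θ K : ℝ} (hR : F.RieszBound R) (hX : SmoothNorm X θ K) :
    ∃ C : ℝ, 0 < C ∧ ∀ (n N : ℕ) (x : ℕ → X), (∀ i, F.P (fb n i) (x i) = x i) →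
      ‖∑ i ∈ Finset.range N, x i‖ ^ θ ≤ C * ∑ i ∈ Finset.range N, ‖x i‖ ^ θ := by
  have hR0 := hR.1
  have hθ0 : 0 < θ := by linarith [hX.one_le]
  have hK := hX.nonneg
  refine ⟨1 + 3 * K * (4 * R * π) ^ θ + K * (8 * R) ^ θ, by positivity, fun n N x hx => ?_⟩
  set e : ℕ → ℝ := fun k => ∑ j ∈ Finset.range N, (if j < k then (4 * R) * (2 : ℝ)⁻¹ ^ (k - j) else 0) * ‖x j‖
  have pi3 := Real.pi_gt_three
  have he : ∀ k ≤ N, ‖F.T (-(2:ℝ)⁻¹ ^ (n + k)) (∑ i ∈ Finset.range k, x i) -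
      ∑ i ∈ Finset.range k, x i‖ ≤ e k := by
    intro k hk
    rw [norm_T_neg_sub, map_sum, ← Finset.sum_sub_distrib]
    simp only [e, ite_mul, zero_mul]
    rw [← Finset.sum_filter]
    have : (Finset.range N).filter (· < k) = Finset.range k := by
      ext j; simp only [Finset.mem_filter, Finset.mem_range]; omega
    rw [this]
    refine norm_sum_le_of_le _ fun j hj => ?_
    have hj := Finset.mem_range.1 hj
    have e1 : ((2 ^ (n + j) : ℕ) : ℝ) * (2:ℝ)⁻¹ ^ (n + k) = (2:ℝ)⁻¹ ^ (k - j) := by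
      rw [show n + k = (n + j) + (k - j) by omega, pow_add (2:ℝ)⁻¹, ← mul_assoc]
      push_cast
      rw [← mul_pow]; norm_num
    have := hR.norm_sub_T_le (fb_lo_pos n j) (B := 2 ^ (n + j)) (h := (2:ℝ)⁻¹ ^ (n + k)) (by positivity)
      (by rw [e1]; exact (pow_le_one₀ (by norm_num) (by norm_num)).trans (by linarith)) (x j)
    rw [e1] at this
    rw [show blk _ _ = fb n j from rfl, hx j] at this
    exact this
  have step : ∀ k, k + 1 ≤ N → ‖∑ i ∈ Finset.range (k + 1), x i‖ ^ θ ≤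
      ‖∑ i ∈ Finset.range k, x i‖ ^ θ + (1 + 3 * K * (4 * R * π) ^ θ) * ‖x k‖ ^ θ + K * e k ^ θ := by
    intro k hk
    have hek : 0 ≤ e k := (norm_nonneg _).trans (he k (by omega))
    rw [Finset.sum_range_succ]
    rcases Nat.eq_zero_or_pos k with rfl | hk0
    · simp only [Finset.range_zero, Finset.sum_empty, zero_add, norm_zero]
      rw [Real.zero_rpow hθ0.ne']
      have : 0 ≤ 3 * K * (4 * R * π) ^ θ * ‖x 0‖ ^ θ := by positivity
      have : 0 ≤ K * e 0 ^ θ := by positivity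
      linarith
    · obtain ⟨l, rfl⟩ : ∃ l, k = l + 1 := ⟨k - 1, by omega⟩
      have e2 : ((2 ^ (n + l) : ℕ) : ℝ) * (2:ℝ)⁻¹ ^ (n + (l + 1)) = 1 / 2 := by
        rw [← add_assoc, pow_succ, ← mul_assoc]; push_cast; rw [← mul_pow]; norm_num
      have e3 : ((2 ^ (n + l + 1) : ℕ) : ℝ) * (2:ℝ)⁻¹ ^ (n + (l + 1)) = 1 := by
        rw [← add_assoc]; push_cast; rw [← mul_pow]; norm_num
      obtain ⟨b, hb, hb'⟩ := hR.exists_sub_T (A := 2 ^ (n + l)) (B := 2 ^ (n + l + 1))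
        Nat.one_le_two_pow (h := (2:ℝ)⁻¹ ^ (n + (l + 1))) (by positivity) (by rw [e3]; linarith) (x (l + 1))
      rw [← fb_succ, hx] at hb
      rw [e2, show π / (2 * (1 / 2)) = π by ring] at hb'
      have s := hX.step (F.T ((2:ℝ)⁻¹ ^ (n + (l + 1)))) (F.T (-(2:ℝ)⁻¹ ^ (n + (l + 1))))
        (F.norm' _) (F.norm' _) (fun x => by rw [← F.add', neg_add_cancel, F.zero'])
        (∑ i ∈ Finset.range (l + 1), x i) b
      rw [hb] at s
      refine s.trans ?_
      have t1 : ‖b‖ ^ θ ≤ (4 * R * π) ^ θ * ‖x (l + 1)‖ ^ θ := by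
        rw [← Real.mul_rpow (by positivity) (norm_nonneg _)]
        exact Real.rpow_le_rpow (norm_nonneg _) hb' hθ0.le
      have t2 := Real.rpow_le_rpow (norm_nonneg _) (he (l + 1) (by omega)) hθ0.le
      have t3 := mul_le_mul_of_nonneg_left t1 (by positivity : 0 ≤ 3 * K)
      have t4 := mul_le_mul_of_nonneg_left t2 hK
      have t5 : 0 ≤ ‖x (l + 1)‖ ^ θ := by positivity
      linarith
  have tel : ∀ k ≤ N, ‖∑ i ∈ Finset.range k, x i‖ ^ θ ≤
      ∑ i ∈ Finset.range k, ((1 + 3 * K * (4 * R * π) ^ θ) * ‖x i‖ ^ θ + K * e i ^ θ) := by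
    intro k
    induction k with
    | zero => intro _; simp [Real.zero_rpow hθ0.ne']
    | succ k ih =>
      intro hk
      have := step k hk
      rw [Finset.sum_range_succ (fun i => _ + _)]
      linarith [ih (by omega)]
  have geom : ∀ s : Finset ℕ, ∀ g : ℕ → ℕ, Set.InjOn g s → (∀ i ∈ s, 1 ≤ g i) →
      ∑ i ∈ s, (4 * R) * (2:ℝ)⁻¹ ^ g i ≤ 8 * R := by
    intro s g hg h1
    rw [← Finset.mul_sum, ← Finset.sum_image (f := fun i => (2:ℝ)⁻¹ ^ i) hg]
    have := (summable_geometric_two).sum_le_tsum (s.image g) (fun _ _ => by positivity)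
    rw [tsum_geometric_two] at this
    simp only [one_div] at this
    nlinarith
  have schur : ∑ k ∈ Finset.range N, e k ^ θ ≤ (8 * R) ^ θ * ∑ j ∈ Finset.range N, ‖x j‖ ^ θ := by
    refine sum_rpow_sum_mul_le _ _ hX.one_le (fun i j => by split_ifs <;> positivity)
      (fun j => norm_nonneg _) (by positivity) (fun k _ => ?_) (fun j _ => ?_)
    · rw [← Finset.sum_filter]
      refine geom _ _ (fun i hi j hj h => ?_) (fun i hi => ?_)
      · simp only [Finset.coe_filter, Set.mem_ofPred_eq] at hi hj; omega
      · simp only [Finset.mem_filter] at hi; omega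
    · rw [← Finset.sum_filter]
      refine geom _ _ (fun i hi j hj h => ?_) (fun i hi => ?_)
      · simp only [Finset.coe_filter, Set.mem_ofPred_eq] at hi hj; omega
      · simp only [Finset.mem_filter] at hi; omega
  have := tel N le_rfl
  rw [Finset.sum_add_distrib, ← Finset.mul_sum, ← Finset.mul_sum] at this
  have := mul_le_mul_of_nonneg_left schur hK
  linarith

end IsoFlow

theorem sinc_antitoneOn : AntitoneOn Real.sinc (Set.Icc 0 π) := by
  intro x hx y hy hxy
  rcases hx.1.eq_or_lt with rfl | hx0
  · rw [Real.sinc_zero]; exact Real.sinc_le_one y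
  have hy0 : 0 < y := hx0.trans_le hxy
  rw [Real.sinc_of_ne_zero hx0.ne', Real.sinc_of_ne_zero hy0.ne', div_le_div_iff₀ hy0 hx0]
  have h := strictConcaveOn_sin_Icc.concaveOn.2 hy ⟨le_rfl, Real.pi_pos.le⟩
    (by positivity : 0 ≤ x / y) (sub_nonneg.2 ((div_le_one hy0).2 hxy)) (by ring)
  simp only [smul_eq_mul, Real.sin_zero, mul_zero, add_zero, div_mul_cancel₀ x hy0.ne'] at h
  rw [div_mul_eq_mul_div, div_le_iff₀ hy0] at h
  linarith

theorem two_div_pi_le_sinc {x : ℝ} (h0 : 0 ≤ x) (h1 : x ≤ π / 2) : 2 / π ≤ Real.sinc x := by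
  rcases h0.eq_or_lt with rfl | hx0
  · rw [Real.sinc_zero, div_le_one Real.pi_pos]; linarith [Real.pi_gt_three]
  · rw [Real.sinc_of_ne_zero hx0.ne', le_div_iff₀ hx0]
    exact Real.mul_le_sin h0 h1

theorem two_mul_sin_half (x : ℝ) : 2 * Real.sin (x / 2) = x * Real.sinc (x / 2) := by
  by_cases hx : x = 0
  · simp [hx]
  · rw [Real.sinc_of_ne_zero (by positivity)]; field_simp

theorem two_pow_rpow (k : ℕ) (r : ℝ) : ((2 : ℝ) ^ k) ^ r = ((2 : ℝ) ^ r) ^ k := by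
  rw [← Real.rpow_natCast, ← Real.rpow_mul (by norm_num), mul_comm, Real.rpow_mul (by norm_num),
    Real.rpow_natCast]

theorem cast_mem_of_mem_blk {A B : ℕ} {m : ℤ} (hm : m ∈ blk A B) : |(m : ℝ)| ∈ Set.Ico (A : ℝ) B := by
  rw [mem_blk] at hm
  rw [← Int.cast_abs, Int.abs_eq_natAbs]
  exact ⟨by exact_mod_cast hm.1, by exact_mod_cast hm.2⟩

theorem ne_zero_of_mem_blk {A B : ℕ} (hA : 1 ≤ A) {m : ℤ} (hm : m ∈ blk A B) : m ≠ 0 := by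
  rw [mem_blk] at hm
  rintro rfl
  simp at hm
  omega

namespace IsoFlow

variable {X : Type*} [NormedAddCommGroup X] [NormedSpace ℂ X] {F : IsoFlow X} [CompleteSpace X]

theorem RieszBound.norm_mul_le_diff {R : ℝ} (hR : F.RieszBound R) {A B : ℕ} (hA : 1 ≤ A)
    {a b h η : ℝ} (ha : 0 ≤ a) (hb : 0 < b) (hh : B * |h| ≤ π) (hη : 0 < η) (hBη : B * η ≤ π)
    {μ φ : ℤ → ℂ} (hφ : IsPhase φ) (hμ : ∀ m ∈ blk A B, μ m =
      φ m * ((|(m : ℝ)| ^ (b - a) * (2 * Real.sin (|(m : ℝ)| * |h| / 2)) ^ a : ℝ) : ℂ)) (x : X) :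
    ‖F.mul (blk A B) μ x‖ ≤ 4 * R * (|h| ^ a * η ^ (-b) * (2 / π) ^ (-b)) * ‖F.diff b η x‖ := by
  have pi3 := Real.pi_gt_three
  obtain ⟨ψ, hψ, H⟩ := exists_phase_diffSymbol hb η
  have h1 : ∀ k : ℝ, 0 ≤ k → B * k ≤ π → ∀ ξ ∈ Set.Ico (A : ℝ) B, ξ * k / 2 ∈ Set.Icc 0 (π / 2) := by
    intro k hk hB ξ hξ
    have := mul_le_mul_of_nonneg_right hξ.2.le hk
    have h0 : 0 ≤ ξ := le_trans (by positivity) hξ.1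
    exact ⟨by positivity, by linarith⟩
  have h2 : ∀ k : ℝ, 0 ≤ k → B * k ≤ π → ∀ ξ ∈ Set.Ico (A : ℝ) B, 2 / π ≤ Real.sinc (ξ * k / 2) :=
    fun k hk hB ξ hξ => two_div_pi_le_sinc (h1 k hk hB ξ hξ).1 (h1 k hk hB ξ hξ).2
  have h3 : ∀ k : ℝ, 0 ≤ k → B * k ≤ π → ∀ ξ ∈ Set.Ico (A : ℝ) B, ∀ ξ' ∈ Set.Ico (A : ℝ) B, ξ ≤ ξ' →
      Real.sinc (ξ' * k / 2) ≤ Real.sinc (ξ * k / 2) := by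
    intro k hk hB ξ hξ ξ' hξ' h
    have hs : Set.Icc 0 (π / 2) ⊆ Set.Icc 0 π := Set.Icc_subset_Icc_right (by linarith)
    refine sinc_antitoneOn (hs (h1 k hk hB ξ hξ)) (hs (h1 k hk hB ξ' hξ')) ?_
    have := mul_le_mul_of_nonneg_right h hk
    linarith
  have pp : 0 < 2 / π := by positivity
  have habs : 0 ≤ |h| := abs_nonneg h
  have key : ∀ m ∈ blk A B, diffSymbol b (m * η) ≠ 0 ∧ μ m * (diffSymbol b (m * η))⁻¹ =
      (φ m * (ψ m)⁻¹) * (((|h| ^ a * η ^ (-b) * Real.sinc (|(m:ℝ)| * |h| / 2) ^ a) *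
        Real.sinc (|(m:ℝ)| * η / 2) ^ (-b) : ℝ) : ℂ) := by
    intro m hm
    have hm' := cast_mem_of_mem_blk hm
    have hm0 : 0 < |(m : ℝ)| := abs_pos.2 (by exact_mod_cast ne_zero_of_mem_blk hA hm)
    have s1 := h2 η hη.le hBη _ hm'
    have s2 := h2 |h| habs hh _ hm'
    have hs := H m (by
      rw [abs_of_pos hη]
      have := mul_le_mul_of_nonneg_right hm'.2.le hη.le
      linarith)
    rw [abs_of_pos hη, two_mul_sin_half] at hs
    have s3 : 0 < |(m:ℝ)| * η * Real.sinc (|(m:ℝ)| * η / 2) := by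
      have := pp.trans_le s1
      positivity
    have s4 : (0:ℝ) ≤ Real.sinc (|(m:ℝ)| * |h| / 2) := pp.le.trans s2
    have s5 : (0:ℝ) < Real.sinc (|(m:ℝ)| * η / 2) := pp.trans_le s1
    refine ⟨?_, ?_⟩
    · rw [hs]
      refine mul_ne_zero (hψ.ne_zero m) ?_
      exact_mod_cast (Real.rpow_pos_of_pos s3 b).ne'
    · rw [hs, hμ m hm, two_mul_sin_half, mul_inv, ← Complex.ofReal_inv, ← Real.rpow_neg s3.le]
      have : |(m:ℝ)| ^ (b - a) * (|(m:ℝ)| * |h| * Real.sinc (|(m:ℝ)| * |h| / 2)) ^ a *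
          (|(m:ℝ)| * η * Real.sinc (|(m:ℝ)| * η / 2)) ^ (-b) =
          (|h| ^ a * η ^ (-b) * Real.sinc (|(m:ℝ)| * |h| / 2) ^ a) *
            Real.sinc (|(m:ℝ)| * η / 2) ^ (-b) := by
        rw [Real.mul_rpow (by positivity) s4, Real.mul_rpow hm0.le habs,
          Real.mul_rpow (by positivity) s5.le, Real.mul_rpow hm0.le hη.le]
        have : |(m:ℝ)| ^ (b - a) * |(m:ℝ)| ^ a * |(m:ℝ)| ^ (-b) = 1 := by
          rw [← Real.rpow_add hm0, ← Real.rpow_add hm0, sub_add_cancel, add_neg_cancel, Real.rpow_zero]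
        linear_combination (|h| ^ a * η ^ (-b) * Real.sinc (|(m:ℝ)| * |h| / 2) ^ a *
            Real.sinc (|(m:ℝ)| * η / 2) ^ (-b)) * this
      rw [← this]
      push_cast
      ring
  have e : F.mul (blk A B) μ x = F.mul (blk A B) (fun m => μ m * (diffSymbol b (m * η))⁻¹) (F.diff b η x) := by
    rw [mul_diff]
    · refine F.mul_congr (fun m hm => ?_) x
      rw [mul_assoc, inv_mul_cancel₀ (key m hm).1, mul_one]
    all_goals exact hb
  rw [e]
  have := hR.norm_mul_le hA (μ := fun m => μ m * (diffSymbol b (m * η))⁻¹) (hφ.mul hψ.inv)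
    (ρ₁ := fun ξ => |h| ^ a * η ^ (-b) * Real.sinc (ξ * |h| / 2) ^ a)
    (ρ₂ := fun ξ => Real.sinc (ξ * η / 2) ^ (-b)) (M₁ := |h| ^ a * η ^ (-b))
    (M₂ := (2 / π) ^ (-b)) (by positivity) (by positivity)
    (fun ξ hξ ξ' hξ' hle => mul_le_mul_of_nonneg_left (Real.rpow_le_rpow
      (pp.le.trans (h2 _ habs hh _ hξ')) (h3 _ habs hh _ hξ _ hξ' hle) ha) (by positivity))
    (fun ξ hξ => by
      have s := pp.le.trans (h2 _ habs hh _ hξ)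
      exact ⟨by positivity, mul_le_of_le_one_right (by positivity)
        (Real.rpow_le_one s (Real.sinc_le_one _) ha)⟩)
    (fun ξ hξ ξ' hξ' hle => Real.rpow_le_rpow_of_nonpos
      (pp.trans_le (h2 _ hη.le hBη _ hξ')) (h3 _ hη.le hBη _ hξ _ hξ' hle) (by linarith))
    (fun ξ hξ => ⟨Real.rpow_nonneg (pp.le.trans (h2 _ hη.le hBη _ hξ)) _, Real.rpow_le_rpow_of_nonpos
      pp (h2 _ hη.le hBη _ hξ) (by linarith)⟩)
    (fun m hm => (key m hm).2) (F.diff b η x)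
  exact this

omit [CompleteSpace X] in
theorem RieszBound.norm_mul_le_rpow {R : ℝ} (hR : F.RieszBound R) {A B : ℕ} (hA : 1 ≤ A)
    {r : ℝ} (hr : 0 ≤ r) {μ φ : ℤ → ℂ} (hφ : IsPhase φ)
    (hμ : ∀ m ∈ blk A B, μ m = φ m * ((|(m : ℝ)| ^ (-r) : ℝ) : ℂ)) (x : X) :
    ‖F.mul (blk A B) μ x‖ ≤ 4 * R * (A : ℝ) ^ (-r) * ‖x‖ := by
  have hA0 : (0 : ℝ) < A := by exact_mod_cast hA
  have := hR.norm_mul_le hA (μ := μ) hφ (ρ₁ := fun ξ => ξ ^ (-r)) (ρ₂ := fun _ => 1)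
    (M₁ := (A : ℝ) ^ (-r)) (M₂ := 1) (by positivity) zero_le_one
    (fun ξ hξ ξ' hξ' hle => Real.rpow_le_rpow_of_nonpos (hA0.trans_le hξ.1) hle (by linarith))
    (fun ξ hξ => ⟨Real.rpow_nonneg (hA0.le.trans hξ.1) _,
      Real.rpow_le_rpow_of_nonpos hA0 hξ.1 (by linarith)⟩)
    (fun _ _ _ _ _ => le_rfl) (fun _ _ => ⟨zero_le_one, le_rfl⟩)
    (fun m hm => by rw [hμ m hm, mul_one]) x
  rwa [mul_one] at this

omit [CompleteSpace X] in
theorem RieszBound.norm_P_le {R : ℝ} (hR : F.RieszBound R) {A B : ℕ} (hA : 1 ≤ A) (x : X) :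
    ‖F.P (blk A B) x‖ ≤ 4 * R * ‖x‖ := by
  have := hR.norm_mul_le_rpow hA (B := B) le_rfl (μ := fun _ => 1) IsPhase.one (fun m _ => by simp) x
  simpa [P] using this

end IsoFlow

theorem half_pow_rpow_neg (k : ℕ) (r : ℝ) : ((2 : ℝ)⁻¹ ^ k) ^ (-r) = ((2 : ℝ) ^ r) ^ k := by
  rw [inv_pow, Real.inv_rpow (by positivity), Real.rpow_neg (by positivity), inv_inv, two_pow_rpow]

/-- Decay kernel between difference scale `a` and frequency level `i`. -/
def scaleKernel (r β : ℝ) (a i : ℕ) : ℝ :=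
  if a < i then ((2 : ℝ) ^ (-r)) ^ (i - a) else ((2 : ℝ) ^ (-β)) ^ (a - i)

theorem scaleKernel_nonneg (r β : ℝ) (a i : ℕ) : 0 ≤ scaleKernel r β a i := by
  unfold scaleKernel; split_ifs <;> positivity

namespace IsoFlow

variable {X : Type*} [NormedAddCommGroup X] [NormedSpace ℂ X] {F : IsoFlow X} [CompleteSpace X]

variable (F) in
/-- Frequency pieces, where the lowest one is measured by a difference. -/
def Z (β : ℝ) (n i : ℕ) : X →L[ℂ] X :=
  if i = 0 then (F.diff β ((2 : ℝ)⁻¹ ^ n)).comp (F.P (fb n 0)) else F.P (fb n i)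

theorem pow_mul_half_pow (a b : ℕ) : (2 : ℝ) ^ a * (2 : ℝ)⁻¹ ^ (a + b) = (2 : ℝ)⁻¹ ^ b := by
  rw [pow_add, ← mul_assoc, ← mul_pow]; norm_num

theorem RieszBound.exists_norm_deriv_le {R : ℝ} (hR : F.RieszBound R) {r β : ℝ} (hr : 0 < r)
    (hβ : 0 < β) : ∃ C : ℝ, 0 < C ∧ ∀ (n i : ℕ) (x : X), 1 ≤ i →
      ‖F.mul (fb n i) (fun m => (Complex.I * m) ^ (r : ℂ)) x‖ ≤
        C * ((2 : ℝ) ^ r) ^ (n + i) * ‖F.diff (r + β) ((2 : ℝ)⁻¹ ^ (n + i + 1)) x‖ := by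
  have hR0 := hR.1
  have pi3 := Real.pi_gt_three
  refine ⟨4 * R * (4 * R * (2 / π) ^ (-(r + β))) * 4 ^ β * 2 ^ r, by positivity, fun n i x hi => ?_⟩
  obtain ⟨j, rfl⟩ : ∃ j, i = j + 1 := ⟨i - 1, by omega⟩
  obtain ⟨φ, hφ, Hφ⟩ := exists_phase_I_mul_cpow (r + β)
  obtain ⟨ψ, hψ, Hψ⟩ := exists_phase_I_mul_cpow (-β)
  set η : ℝ := (2 : ℝ)⁻¹ ^ (n + (j + 1) + 1) with hη
  have hη0 : 0 < η := by positivity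
  have e1 : ((2 ^ (n + j + 1) : ℕ) : ℝ) * η = 1 / 2 := by
    rw [hη, ← add_assoc]; push_cast
    rw [pow_mul_half_pow]; norm_num
  have e2 : ((2 ^ (n + j) : ℕ) : ℝ) * η = 1 / 4 := by
    rw [hη, show n + (j + 1) + 1 = n + j + 2 by omega]; push_cast
    rw [pow_mul_half_pow]; norm_num
  have e3 : ((2 ^ (n + j) : ℕ) : ℝ) = 1 / (4 * η) := by field_simp; linarith
  rw [fb_succ]
  have h1 := hR.norm_mul_le_diff (A := 2 ^ (n + j)) (B := 2 ^ (n + j + 1)) Nat.one_le_two_pow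
    (a := 0) (b := r + β) (h := 0) (η := η) le_rfl (by linarith)
    (by simpa using Real.pi_pos.le) hη0 (by rw [e1]; linarith)
    (μ := fun m => (Complex.I * m) ^ ((r + β : ℝ) : ℂ)) hφ (fun m hm => by
      rw [Hφ m (ne_zero_of_mem_blk Nat.one_le_two_pow hm), Real.rpow_zero, sub_zero, mul_one]) x
  have h2 := hR.norm_mul_le_rpow (A := 2 ^ (n + j)) (B := 2 ^ (n + j + 1)) Nat.one_le_two_pow hβ.le
    (μ := fun m => (Complex.I * m) ^ ((-β : ℝ) : ℂ)) hψ (fun m hm => by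
      rw [Hψ m (ne_zero_of_mem_blk Nat.one_le_two_pow hm)])
    (F.mul (blk (2 ^ (n + j)) (2 ^ (n + j + 1))) (fun m => (Complex.I * m) ^ ((r + β : ℝ) : ℂ)) x)
  rw [mul_mul, Finset.inter_self] at h2
  have e4 : F.mul (blk (2 ^ (n + j)) (2 ^ (n + j + 1))) (fun m => (Complex.I * m) ^ (r : ℂ)) x =
      F.mul (blk (2 ^ (n + j)) (2 ^ (n + j + 1))) (fun m => (Complex.I * m) ^ ((-β : ℝ) : ℂ) *
        (Complex.I * m) ^ ((r + β : ℝ) : ℂ)) x := by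
    refine F.mul_congr (fun m hm => ?_) x
    have : (Complex.I * m : ℂ) ≠ 0 := mul_ne_zero Complex.I_ne_zero
      (by exact_mod_cast ne_zero_of_mem_blk Nat.one_le_two_pow hm)
    rw [← Complex.cpow_add _ _ this]
    push_cast; congr 1; ring
  rw [e4]
  have e5 : ((2 ^ (n + j) : ℕ) : ℝ) ^ (-β) = 4 ^ β * η ^ β := by
    rw [e3, one_div, Real.inv_rpow (by positivity), Real.rpow_neg (by positivity), inv_inv,
      Real.mul_rpow (by norm_num) hη0.le]
  have e6 : η ^ β * η ^ (-(r + β)) = 2 ^ r * ((2 : ℝ) ^ r) ^ (n + (j + 1)) := by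
    rw [← Real.rpow_add hη0, show β + -(r + β) = -r by ring, hη, half_pow_rpow_neg, pow_succ, mul_comm]
  rw [abs_zero, Real.rpow_zero, one_mul] at h1
  refine h2.trans ?_
  rw [e5]
  calc 4 * R * (4 ^ β * η ^ β) * ‖_‖ ≤ 4 * R * (4 ^ β * η ^ β) *
        (4 * R * (η ^ (-(r + β)) * (2 / π) ^ (-(r + β))) * ‖F.diff (r + β) η x‖) :=
        mul_le_mul_of_nonneg_left h1 (by positivity)
    _ = 4 * R * (4 * R * (2 / π) ^ (-(r + β))) * 4 ^ β * (η ^ β * η ^ (-(r + β))) *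
        ‖F.diff (r + β) η x‖ := by ring
    _ = _ := by rw [e6]; ring

theorem RieszBound.exists_norm_diff_deriv_le {R : ℝ} (hR : F.RieszBound R) {r β : ℝ} (hr : 0 < r)
    (hβ : 0 < β) : ∃ C : ℝ, 0 < C ∧ ∀ (n i : ℕ) (h : ℝ) (x : X), |h| ≤ 2 * (2 : ℝ)⁻¹ ^ n →
      ‖F.mul (fb n i) (fun m => diffSymbol β (m * h) * (Complex.I * m) ^ (r : ℂ)) x‖ ≤
        C * ((2 : ℝ) ^ r) ^ (n + i) * ‖F.diff (r + β) ((2 : ℝ)⁻¹ ^ (n + i + 1)) x‖ := by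
  have hR0 := hR.1
  have pi3 := Real.pi_gt_three
  obtain ⟨C₁, hC₁, H₁⟩ := hR.exists_norm_deriv_le hr hβ
  have hd := one_le_diffNorm hβ
  refine ⟨diffNorm β * C₁ + 4 * R * (4 ^ β * 2 ^ r * (2 / π) ^ (-(r + β))), by positivity,
    fun n i h x hh => ?_⟩
  rcases Nat.eq_zero_or_pos i with rfl | hi
  · obtain ⟨φ, hφ, Hφ⟩ := exists_phase_I_mul_cpow r
    obtain ⟨ψ, hψ, Hψ⟩ := exists_phase_diffSymbol hβ h
    rw [fb_zero]
    set η : ℝ := (2 : ℝ)⁻¹ ^ (n + 0 + 1) with hη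
    have hη0 : 0 < η := by positivity
    have e0 : ((2 ^ n : ℕ) : ℝ) * (2 : ℝ)⁻¹ ^ n = 1 := by push_cast; rw [← mul_pow]; norm_num
    have e1 : ((2 ^ n : ℕ) : ℝ) * η = 1 / 2 := by
      rw [hη, add_zero]; push_cast
      rw [pow_mul_half_pow]; norm_num
    have hh' : ((2 ^ n : ℕ) : ℝ) * |h| ≤ 2 := by
      have := mul_le_mul_of_nonneg_left hh (Nat.cast_nonneg (2 ^ n) : (0:ℝ) ≤ _)
      linarith
    have h4 : |h| ≤ 4 * η := by
      refine hh.trans (le_of_eq ?_); rw [hη, add_zero, pow_succ]; ring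
    have h1 := hR.norm_mul_le_diff (A := 1) (B := 2 ^ n) le_rfl
      (a := β) (b := r + β) (h := h) (η := η) hβ.le (by linarith) (by linarith) hη0
      (by rw [e1]; linarith)
      (μ := fun m => diffSymbol β (m * h) * (Complex.I * m) ^ (r : ℂ)) (hφ.mul hψ) (fun m hm => by
        have := cast_mem_of_mem_blk hm
        rw [Hφ m (ne_zero_of_mem_blk le_rfl hm), Hψ m, add_sub_cancel_right]
        · push_cast; ring
        · have := mul_le_mul_of_nonneg_right this.2.le (abs_nonneg h)
          linarith) x
    refine h1.trans ?_
    have e6 : (4 * η) ^ β * η ^ (-(r + β)) = 4 ^ β * (2 ^ r * ((2 : ℝ) ^ r) ^ (n + 0)) := by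
      rw [Real.mul_rpow (by norm_num) hη0.le, mul_assoc, ← Real.rpow_add hη0,
        show β + -(r + β) = -r by ring, hη, half_pow_rpow_neg, pow_succ]
      ring
    have e7 : |h| ^ β ≤ (4 * η) ^ β := Real.rpow_le_rpow (abs_nonneg h) h4 hβ.le
    have e8 : 0 ≤ diffNorm β * C₁ * ((2 : ℝ) ^ r) ^ (n + 0) * ‖F.diff (r + β) η x‖ := by positivity
    calc 4 * R * (|h| ^ β * η ^ (-(r + β)) * (2 / π) ^ (-(r + β))) * ‖F.diff (r + β) η x‖
        ≤ 4 * R * ((4 * η) ^ β * η ^ (-(r + β)) * (2 / π) ^ (-(r + β))) * ‖F.diff (r + β) η x‖ := by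
          gcongr
      _ ≤ _ := by rw [e6]; linarith
  · have e : F.mul (fb n i) (fun m => diffSymbol β (m * h) * (Complex.I * m) ^ (r : ℂ)) x =
        F.diff β h (F.mul (fb n i) (fun m => (Complex.I * m) ^ (r : ℂ)) x) := by
      rw [diff_mul _ hβ]; simp only [mul_comm]
    rw [e]
    refine (F.norm_diff_le hβ h _).trans ?_
    have := mul_le_mul_of_nonneg_left (H₁ n i x hi) (by linarith : 0 ≤ diffNorm β)
    have e8 : 0 ≤ 4 * R * (4 ^ β * 2 ^ r * (2 / π) ^ (-(r + β))) * ((2 : ℝ) ^ r) ^ (n + i) *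
      ‖F.diff (r + β) ((2 : ℝ)⁻¹ ^ (n + i + 1)) x‖ := by positivity
    linarith

theorem RieszBound.exists_norm_diff_integral_le {R : ℝ} (hR : F.RieszBound R) {r β : ℝ} (hr : 0 < r)
    (hβ : 0 < β) : ∃ C : ℝ, 0 < C ∧ ∀ (n a i : ℕ) (h : ℝ) (x : X), |h| ≤ 2 * (2 : ℝ)⁻¹ ^ (n + a) →
      ‖F.mul (fb n i) (fun m => diffSymbol (r + β) (m * h) * (Complex.I * m) ^ ((-r : ℝ) : ℂ)) x‖ ≤
        C * ((2 : ℝ) ^ (-r)) ^ (n + a) * scaleKernel r β a i * ‖F.Z β n i x‖ := by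
  have hR0 := hR.1
  have pi3 := Real.pi_gt_three
  have hd := one_le_diffNorm (add_pos hr hβ)
  refine ⟨4 * R * ((2 : ℝ) ^ (r + β) * (2 / π) ^ (-β)) + 4 * R * (2 ^ (r + β) * 2 ^ r) +
    4 * R * diffNorm (r + β) * 2 ^ r, by positivity, fun n a i h x hh => ?_⟩
  obtain ⟨φ, hφ, Hφ⟩ := exists_phase_I_mul_cpow (-r)
  obtain ⟨ψ, hψ, Hψ⟩ := exists_phase_diffSymbol (add_pos hr hβ) h
  have hxP : ∀ (s : Finset ℤ) (μ : ℤ → ℂ), F.mul s μ (F.P s x) = F.mul s μ x := fun s μ => by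
    rw [mul_P, Finset.inter_self]
  have hK := scaleKernel_nonneg r β a i
  rw [← hxP]
  rcases Nat.eq_zero_or_pos i with rfl | hi
  · rw [Z, if_pos rfl, ContinuousLinearMap.comp_apply]
    set y := F.P (fb n 0) x
    rw [fb_zero]
    set η : ℝ := (2 : ℝ)⁻¹ ^ n with hη
    have hη0 : 0 < η := by positivity
    have e1 : ((2 ^ n : ℕ) : ℝ) * η = 1 := by rw [hη]; push_cast; rw [← mul_pow]; norm_num
    have h2 : |h| ≤ 2 * (η * (2 : ℝ)⁻¹ ^ a) := by rwa [hη, ← pow_add]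
    have h3 : (2 : ℝ)⁻¹ ^ a ≤ 1 := pow_le_one₀ (by norm_num) (by norm_num)
    have hh' : ((2 ^ n : ℕ) : ℝ) * |h| ≤ 2 := by
      have := mul_le_mul_of_nonneg_left h2 (Nat.cast_nonneg (2 ^ n) : (0:ℝ) ≤ _)
      nlinarith
    have h1 := hR.norm_mul_le_diff (A := 1) (B := 2 ^ n) le_rfl
      (a := r + β) (b := β) (h := h) (η := η) (by linarith) hβ (by linarith) hη0
      (by rw [e1]; linarith)
      (μ := fun m => diffSymbol (r + β) (m * h) * (Complex.I * m) ^ ((-r : ℝ) : ℂ)) (hφ.mul hψ)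
      (fun m hm => by
        have := cast_mem_of_mem_blk hm
        rw [Hφ m (ne_zero_of_mem_blk le_rfl hm), Hψ m, show β - (r + β) = -r by ring]
        · push_cast; ring
        · have := mul_le_mul_of_nonneg_right this.2.le (abs_nonneg h)
          linarith) y
    refine h1.trans ?_
    have e6 : (2 * (η * (2 : ℝ)⁻¹ ^ a)) ^ (r + β) * η ^ (-β) =
        2 ^ (r + β) * (((2 : ℝ) ^ (-r)) ^ (n + a) * scaleKernel r β a 0) := by
      rw [Real.mul_rpow (by norm_num) (by positivity), Real.mul_rpow (by positivity) (by positivity)]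
      have hs : ∀ k : ℕ, ((2 : ℝ)⁻¹ ^ k) ^ (r + β) = ((2 : ℝ) ^ (-r)) ^ k * ((2 : ℝ) ^ (-β)) ^ k := by
        intro k
        rw [show r + β = -(-r) + -(-β) by ring, Real.rpow_add (by positivity), half_pow_rpow_neg,
          half_pow_rpow_neg]
      rw [hη, hs, hs, half_pow_rpow_neg, scaleKernel, if_neg (by omega), Nat.sub_zero, pow_add]
      have : ((2:ℝ) ^ (-β)) ^ n * ((2:ℝ) ^ β) ^ n = 1 := by
        rw [← mul_pow, ← Real.rpow_add (by norm_num)]; simp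
      linear_combination (2 ^ (r + β) * ((2:ℝ) ^ (-r)) ^ n * ((2:ℝ) ^ (-r)) ^ a * ((2:ℝ) ^ (-β)) ^ a) * this
    have e7 : |h| ^ (r + β) ≤ (2 * (η * (2 : ℝ)⁻¹ ^ a)) ^ (r + β) :=
      Real.rpow_le_rpow (abs_nonneg h) h2 (by linarith)
    have e8 : 0 ≤ (4 * R * (2 ^ (r + β) * 2 ^ r) + 4 * R * diffNorm (r + β) * 2 ^ r) *
      ((2 : ℝ) ^ (-r)) ^ (n + a) * scaleKernel r β a 0 * ‖F.diff β η y‖ := by positivity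
    calc 4 * R * (|h| ^ (r + β) * η ^ (-β) * (2 / π) ^ (-β)) * ‖F.diff β η y‖
        ≤ 4 * R * ((2 * (η * (2 : ℝ)⁻¹ ^ a)) ^ (r + β) * η ^ (-β) * (2 / π) ^ (-β)) *
          ‖F.diff β η y‖ := by gcongr
      _ ≤ _ := by rw [e6]; linarith
  · rw [Z, if_neg (by omega)]
    set y := F.P (fb n i) x
    obtain ⟨j, rfl⟩ : ∃ j, i = j + 1 := ⟨i - 1, by omega⟩
    rw [fb_succ]
    have eA : ((2 ^ (n + j) : ℕ) : ℝ) ^ (-r) = ((2 : ℝ) ^ (-r)) ^ (n + j) := by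
      push_cast; rw [two_pow_rpow]
    have e2r : (2 : ℝ) ^ r * (2 : ℝ) ^ (-r) = 1 := by rw [← Real.rpow_add (by norm_num)]; simp
    have nn : ∀ c : ℝ, 0 ≤ c → 0 ≤ c * ((2 : ℝ) ^ (-r)) ^ (n + a) * scaleKernel r β a (j + 1) * ‖y‖ :=
      fun c hc => by positivity
    by_cases haj : a < j + 1
    · have e : F.mul (blk (2 ^ (n + j)) (2 ^ (n + j + 1))) (fun m => diffSymbol (r + β) (m * h) *
          (Complex.I * m) ^ ((-r : ℝ) : ℂ)) y = F.diff (r + β) h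
          (F.mul (blk (2 ^ (n + j)) (2 ^ (n + j + 1))) (fun m => (Complex.I * m) ^ ((-r : ℝ) : ℂ)) y) := by
        rw [diff_mul _ (add_pos hr hβ)]; simp only [mul_comm]
      rw [e]
      refine (F.norm_diff_le (add_pos hr hβ) h _).trans ?_
      have h2 := hR.norm_mul_le_rpow (A := 2 ^ (n + j)) (B := 2 ^ (n + j + 1)) Nat.one_le_two_pow hr.le
        (μ := fun m => (Complex.I * m) ^ ((-r : ℝ) : ℂ)) hφ (fun m hm => by
          rw [Hφ m (ne_zero_of_mem_blk Nat.one_le_two_pow hm)]) y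
      rw [eA] at h2
      have := mul_le_mul_of_nonneg_left h2 (by linarith : 0 ≤ diffNorm (r + β))
      refine this.trans ?_
      have e3 : ((2 : ℝ) ^ (-r)) ^ (n + j) = 2 ^ r * (((2 : ℝ) ^ (-r)) ^ (n + a) *
          scaleKernel r β a (j + 1)) := by
        rw [scaleKernel, if_pos haj, ← pow_add, show n + a + (j + 1 - a) = n + j + 1 by omega, pow_succ]
        linear_combination -((2 : ℝ) ^ (-r)) ^ (n + j) * e2r
      rw [e3]
      have := nn (4 * R * ((2 : ℝ) ^ (r + β) * (2 / π) ^ (-β)) + 4 * R * (2 ^ (r + β) * 2 ^ r)) (by positivity)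
      linarith
    · have ha : j + 1 ≤ a := not_lt.1 haj
      set q : ℝ := 2 * (2 : ℝ)⁻¹ ^ (a - (j + 1)) with hq
      have hq0 : 0 < q := by positivity
      have hBh : ((2 ^ (n + j + 1) : ℕ) : ℝ) * |h| ≤ q := by
        have := mul_le_mul_of_nonneg_left hh (Nat.cast_nonneg (2 ^ (n + j + 1)) : (0:ℝ) ≤ _)
        refine this.trans (le_of_eq ?_)
        rw [show n + a = n + j + 1 + (a - (j + 1)) by omega]; push_cast
        rw [mul_left_comm, pow_mul_half_pow]
      have hq2 : q ≤ 2 := by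
        have : (2 : ℝ)⁻¹ ^ (a - (j + 1)) ≤ 1 := pow_le_one₀ (by norm_num) (by norm_num)
        linarith
      have hle : ∀ ξ ∈ Set.Ico ((2 ^ (n + j) : ℕ) : ℝ) ((2 ^ (n + j + 1) : ℕ) : ℝ),
          0 ≤ ξ ∧ 0 ≤ ξ * |h| ∧ ξ * |h| ≤ q := fun ξ hξ => by
        have h0 : 0 ≤ ξ := le_trans (by positivity) hξ.1
        exact ⟨h0, by positivity, (mul_le_mul_of_nonneg_right hξ.2.le (abs_nonneg h)).trans hBh⟩
      have hs : ∀ ξ ∈ Set.Ico ((2 ^ (n + j) : ℕ) : ℝ) ((2 ^ (n + j + 1) : ℕ) : ℝ),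
          0 ≤ 2 * Real.sin (ξ * |h| / 2) ∧ 2 * Real.sin (ξ * |h| / 2) ≤ q := fun ξ hξ => by
        have h1 := hle ξ hξ
        have h2 := two_sin_bounds h1.2.1 (h1.2.2.trans (by linarith))
        have := h1.2.1
        exact ⟨le_trans (by positivity) h2.1, h2.2.trans h1.2.2⟩
      have hA0 : (0:ℝ) < (2 ^ (n + j) : ℕ) := by positivity
      have h1 := hR.norm_mul_le (A := 2 ^ (n + j)) (B := 2 ^ (n + j + 1)) Nat.one_le_two_pow
        (μ := fun m => diffSymbol (r + β) (m * h) * (Complex.I * m) ^ ((-r : ℝ) : ℂ)) (hφ.mul hψ)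
        (ρ₁ := fun ξ => ξ ^ (-r)) (ρ₂ := fun ξ => (2 * Real.sin (ξ * |h| / 2)) ^ (r + β))
        (M₁ := ((2 : ℝ) ^ (-r)) ^ (n + j)) (M₂ := q ^ (r + β)) (by positivity) (by positivity)
        (fun ξ hξ ξ' hξ' hle => Real.rpow_le_rpow_of_nonpos (hA0.trans_le hξ.1) hle (by linarith))
        (fun ξ hξ => ⟨Real.rpow_nonneg (hA0.le.trans hξ.1) _, by
          rw [← eA]; exact Real.rpow_le_rpow_of_nonpos hA0 hξ.1 (by linarith)⟩)
        (fun ξ hξ ξ' hξ' h' => Real.rpow_le_rpow (hs ξ hξ).1 (two_sin_mono (abs_nonneg h) (hle ξ hξ).1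
          ((hle ξ' hξ').2.2.trans (by linarith)) h') (by linarith))
        (fun ξ hξ => ⟨Real.rpow_nonneg (hs ξ hξ).1 _, Real.rpow_le_rpow (hs ξ hξ).1 (hs ξ hξ).2
          (by linarith)⟩)
        (fun m hm => by
          have := cast_mem_of_mem_blk hm
          rw [Hφ m (ne_zero_of_mem_blk Nat.one_le_two_pow hm), Hψ m]
          · push_cast; ring
          · have := (hle _ this).2.2
            linarith) y
      refine h1.trans ?_
      have e3 : ((2 : ℝ) ^ (-r)) ^ (n + j) * q ^ (r + β) = 2 ^ (r + β) * 2 ^ r *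
          (((2 : ℝ) ^ (-r)) ^ (n + a) * scaleKernel r β a (j + 1)) := by
        rw [scaleKernel, if_neg haj, hq, Real.mul_rpow (by norm_num) (by positivity)]
        rw [show r + β = -(-r) + -(-β) by ring,
          Real.rpow_add (by positivity : 0 < (2 : ℝ)⁻¹ ^ (a - (j + 1))), half_pow_rpow_neg,
          half_pow_rpow_neg, show n + a = n + j + 1 + (a - (j + 1)) by omega,
          pow_add _ (n + j + 1), pow_succ _ (n + j)]
        linear_combination -((2 : ℝ) ^ (-r)) ^ (n + j) * (2 ^ (- -r + - -β) *
          (((2 : ℝ) ^ (-r)) ^ (a - (j + 1)) * ((2 : ℝ) ^ (-β)) ^ (a - (j + 1)))) * e2r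
      rw [e3]
      have := nn (4 * R * ((2 : ℝ) ^ (r + β) * (2 / π) ^ (-β)) + 4 * R * diffNorm (r + β) * 2 ^ r)
        (by positivity)
      linarith

end IsoFlow

theorem exists_mem_fb (n : ℕ) {m : ℤ} (hm : m ≠ 0) : ∃ i, m ∈ fb n i := by
  have h0 : 1 ≤ m.natAbs := Int.natAbs_pos.2 hm
  by_cases h : m.natAbs < 2 ^ n
  · exact ⟨0, by rw [fb_zero, mem_blk]; exact ⟨h0, h⟩⟩
  · have h1 : ∃ i, m.natAbs < 2 ^ (n + i) :=
      ⟨m.natAbs, Nat.lt_two_pow_self.trans_le (Nat.pow_le_pow_right (by norm_num) (by omega))⟩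
    obtain ⟨j, hj⟩ : ∃ j, Nat.find h1 = j + 1 := by
      refine ⟨Nat.find h1 - 1, ?_⟩
      have : Nat.find h1 ≠ 0 := fun hcon => h (by simpa [hcon] using Nat.find_spec h1)
      omega
    refine ⟨j + 1, ?_⟩
    rw [fb_succ, mem_blk]
    refine ⟨not_lt.1 (Nat.find_min h1 (m := j) (by omega)), ?_⟩
    have := Nat.find_spec h1
    rwa [hj] at this

theorem zero_notMem_fb (n i : ℕ) : (0 : ℤ) ∉ fb n i := fun h => by
  have := ne_zero_of_mem_blk (fb_lo_pos n i) h
  exact this rfl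

namespace IsoFlow

variable {X : Type*} [NormedAddCommGroup X] [NormedSpace ℂ X] {F : IsoFlow X} [CompleteSpace X]

theorem S_eq_zero_of_P {s : Finset ℤ} {x : X} (hx : F.P s x = x) {m : ℤ} (hm : m ∉ s) :
    F.S m x = 0 := by
  rw [← hx, P, S_mul, if_neg hm]

theorem S_P {s : Finset ℤ} {m : ℤ} (hm : m ∈ s) (x : X) : F.S m (F.P s x) = F.S m x := by
  rw [P, S_mul, if_pos hm, one_smul]

theorem P_P_self (s : Finset ℤ) (x : X) : F.P s (F.P s x) = F.P s x := by
  have := F.P_mul s s (fun _ => 1) x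
  rwa [Finset.inter_self] at this

theorem S_tsum {n : ℕ} {x : ℕ → X} (hx : ∀ i, F.P (fb n i) (x i) = x i) (hs : Summable x)
    {m : ℤ} {i : ℕ} (hm : m ∈ fb n i) : F.S m (∑' j, x j) = F.S m (x i) := by
  rw [(F.S m).map_tsum hs]
  refine tsum_eq_single i fun j hj => S_eq_zero_of_P (hx j) fun hm' => ?_
  exact Finset.disjoint_left.1 (fb_disjoint n hj) hm' hm

theorem S_zero_tsum {n : ℕ} {x : ℕ → X} (hx : ∀ i, F.P (fb n i) (x i) = x i) (hs : Summable x) :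
    F.S 0 (∑' j, x j) = 0 := by
  rw [(F.S 0).map_tsum hs]
  exact (tsum_congr fun i => S_eq_zero_of_P (hx i) (zero_notMem_fb n i)).trans tsum_zero

theorem tsum_P {n : ℕ} {u : X} (hu : F.S 0 u = 0) (hs : Summable fun i => F.P (fb n i) u) :
    ∑' i, F.P (fb n i) u = u := by
  refine F.ext_S fun m => ?_
  by_cases hm : m = 0
  · rw [hm, S_zero_tsum (fun i => P_P_self _ u) hs, hu]
  · obtain ⟨i, hi⟩ := exists_mem_fb n hm
    rw [S_tsum (fun i => P_P_self _ u) hs hi, S_P hi]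

theorem enorm_le_tsum_P (n : ℕ) {u : X} (hu : F.S 0 u = 0) : ‖u‖ₑ ≤ ∑' i, ‖F.P (fb n i) u‖ₑ := by
  by_cases h : ∑' i, ‖F.P (fb n i) u‖ₑ = ⊤
  · rw [h]; exact le_top
  · have hs : Summable fun i => F.P (fb n i) u := by
      refine Summable.of_norm ?_
      have := ENNReal.summable_toReal h
      simpa using this
    conv_lhs => rw [← tsum_P hu hs]
    exact enorm_tsum_le_tsum_enorm

theorem RieszBound.exists_summable {R θ K : ℝ} (hR : F.RieszBound R) (hX : SmoothNorm X θ K) :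
    ∃ C : ℝ, 0 < C ∧ ∀ (n : ℕ) (x : ℕ → X), (∀ i, F.P (fb n i) (x i) = x i) →
      ∑' i, ‖x i‖ₑ ^ θ ≠ ⊤ → Summable x ∧ ‖∑' i, x i‖ₑ ^ θ ≤ ENNReal.ofReal C * ∑' i, ‖x i‖ₑ ^ θ := by
  obtain ⟨C, hC, H⟩ := core hR hX
  have hθ0 : 0 < θ := by linarith [hX.one_le]
  refine ⟨C, hC, fun n x hx hsum => ?_⟩
  have fin : ∀ s : Finset ℕ, ‖∑ i ∈ s, x i‖ ^ θ ≤ C * ∑ i ∈ s, ‖x i‖ ^ θ := by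
    intro s
    obtain ⟨N, hN⟩ := s.exists_nat_subset_range
    have h := H n N (fun i => if i ∈ s then x i else 0) (fun i => by
      split_ifs
      · exact hx i
      · exact map_zero _)
    rw [Finset.sum_ite_mem, Finset.inter_eq_right.2 hN] at h
    refine h.trans (le_of_eq ?_)
    congr 1
    rw [← Finset.sum_subset hN]
    · exact Finset.sum_congr rfl fun i hi => by rw [if_pos hi]
    · intro i _ hi
      rw [if_neg hi, norm_zero, Real.zero_rpow hθ0.ne']
  have hr : Summable fun i => ‖x i‖ ^ θ := by
    have := ENNReal.summable_toReal hsum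
    simpa [← ENNReal.toReal_rpow] using this
  have hs : Summable x := by
    rw [summable_iff_vanishing_norm]
    intro ε hε
    obtain ⟨s, hs⟩ := summable_iff_vanishing_norm.1 hr (ε ^ θ / C) (by positivity)
    refine ⟨s, fun t ht => ?_⟩
    have h1 := hs t ht
    rw [Real.norm_of_nonneg (Finset.sum_nonneg fun i _ => by positivity), lt_div_iff₀ hC] at h1
    have h2 := fin t
    exact (Real.rpow_lt_rpow_iff (norm_nonneg _) hε.le hθ0).1 (by linarith)
  refine ⟨hs, ?_⟩
  have hc : Continuous fun u : X => ‖u‖ₑ ^ θ := (ENNReal.continuous_rpow_const).comp continuous_enorm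
  refine le_of_tendsto ((hc.tendsto _).comp hs.hasSum) (Filter.Eventually.of_forall fun s => ?_)
  have h1 := ENNReal.ofReal_le_ofReal (fin s)
  rw [ENNReal.ofReal_mul hC.le, ENNReal.ofReal_sum_of_nonneg (fun i _ => by positivity),
    ← ENNReal.ofReal_rpow_of_nonneg (norm_nonneg _) hθ0.le, ofReal_norm] at h1
  refine h1.trans (mul_le_mul_right ?_ _)
  refine le_trans (le_of_eq ?_) (ENNReal.sum_le_tsum s)
  exact Finset.sum_congr rfl fun i _ => by
    rw [← ENNReal.ofReal_rpow_of_nonneg (norm_nonneg _) hθ0.le, ofReal_norm]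

theorem RieszBound.exists_enorm_rpow_le {R θ K : ℝ} (hR : F.RieszBound R) (hX : SmoothNorm X θ K) :
    ∃ C : ℝ, 0 < C ∧ ∀ (n : ℕ) (u : X), F.S 0 u = 0 →
      ‖u‖ₑ ^ θ ≤ ENNReal.ofReal C * ∑' i, ‖F.P (fb n i) u‖ₑ ^ θ := by
  obtain ⟨C, hC, H⟩ := hR.exists_summable hX
  refine ⟨C, hC, fun n u hu => ?_⟩
  by_cases h : ∑' i, ‖F.P (fb n i) u‖ₑ ^ θ = ⊤
  · rw [h, ENNReal.mul_top (by simpa using hC)]; exact le_top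
  · obtain ⟨h1, h2⟩ := H n _ (fun i => P_P_self (fb n i) u) h
    rwa [tsum_P hu h1] at h2

end IsoFlow

/-- **Schur's test** in `ℝ≥0∞`. -/
theorem ENNReal.tsum_rpow_tsum_mul_le {ι κ : Type*} {k : ι → κ → ℝ≥0∞} {y : κ → ℝ≥0∞} {M : ℝ≥0∞}
    {θ : ℝ} (hθ : 1 ≤ θ) (h1 : ∀ i, ∑' j, k i j ≤ M) (h2 : ∀ j, ∑' i, k i j ≤ M) :
    ∑' i, (∑' j, k i j * y j) ^ θ ≤ M ^ θ * ∑' j, y j ^ θ := by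
  have hθ0 : 0 < θ := by linarith
  have step : ∀ i, (∑' j, k i j * y j) ^ θ ≤ M ^ (θ - 1) * ∑' j, k i j * y j ^ θ := by
    intro i
    have h : ∑' j, k i j * y j ≤ M ^ (1 - θ⁻¹) * (∑' j, k i j * y j ^ θ) ^ θ⁻¹ := by
      rw [ENNReal.tsum_eq_iSup_sum]
      refine iSup_le fun t => ?_
      refine (ENNReal.inner_le_weight_mul_Lp_of_nonneg t hθ (k i) y).trans ?_
      have : 0 ≤ 1 - θ⁻¹ := sub_nonneg.2 (inv_le_one_of_one_le₀ hθ)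
      gcongr
      · exact (ENNReal.sum_le_tsum t).trans (h1 i)
      · exact ENNReal.sum_le_tsum t
    refine (ENNReal.rpow_le_rpow h hθ0.le).trans (le_of_eq ?_)
    rw [ENNReal.mul_rpow_of_nonneg _ _ hθ0.le, ← ENNReal.rpow_mul, ← ENNReal.rpow_mul,
      inv_mul_cancel₀ hθ0.ne', ENNReal.rpow_one]
    congr 2; field_simp
  calc _ ≤ ∑' i, M ^ (θ - 1) * ∑' j, k i j * y j ^ θ := ENNReal.tsum_le_tsum step
    _ = M ^ (θ - 1) * ∑' j, (∑' i, k i j) * y j ^ θ := by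
        rw [ENNReal.tsum_mul_left, ENNReal.tsum_comm]; simp only [ENNReal.tsum_mul_right]
    _ ≤ M ^ (θ - 1) * ∑' j, M * y j ^ θ := by
        gcongr with j
        exact h2 j
    _ = _ := by
        rw [ENNReal.tsum_mul_left, ← mul_assoc]
        congr 1
        nth_rw 2 [← ENNReal.rpow_one M]
        rw [← ENNReal.rpow_add_of_nonneg _ _ (by linarith) zero_le_one, sub_add_cancel]

theorem diffSymbol_mul_diffSymbol {β : ℝ} {k : ℕ} (hβ : 0 < β) (hk : β < k) (θ : ℝ) :
    diffSymbol (k - β) θ * diffSymbol β θ =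
      Complex.exp (((k * θ : ℝ) : ℂ) * Complex.I) * (1 - Complex.exp (-(θ * Complex.I))) ^ k := by
  have hkβ : 0 < (k : ℝ) - β := by linarith
  rw [diffSymbol_eq hβ, diffSymbol_eq hkβ, mul_mul_mul_comm, ← Complex.exp_add]
  congr 1
  · congr 1; push_cast; ring
  · by_cases h : (1 - Complex.exp (-(θ * Complex.I)) : ℂ) = 0
    · have hk0 : k ≠ 0 := fun h0 => by rw [h0] at hk; norm_num at hk; linarith
      rw [h, Complex.zero_cpow (by exact_mod_cast hkβ.ne'), zero_mul, zero_pow hk0]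
    · rw [← Complex.cpow_add _ _ h, ← Complex.cpow_natCast]
      congr 1; push_cast; ring

namespace IsoFlow

variable {X : Type*} [NormedAddCommGroup X] [NormedSpace ℂ X] {F : IsoFlow X}

theorem T_pow (h : ℝ) (k : ℕ) (x : X) : (F.T h ^ k) x = F.T (k * h) x := by
  induction k with
  | zero => simp [F.zero']
  | succ k ih =>
    rw [pow_succ', mul_apply_eq_comp, ih, ← F.add']
    congr 2; push_cast; ring

variable [CompleteSpace X]

omit [CompleteSpace X] in
theorem S_one_sub_T_pow (h : ℝ) (k : ℕ) (m : ℤ) (x : X) :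
    F.S m (((1 - F.T h) ^ k) x) = (1 - chr m h) ^ k • F.S m x := by
  induction k with
  | zero => simp
  | succ k ih =>
    rw [pow_succ', mul_apply_eq_comp, sub_apply,
      one_apply_eq_self, map_sub, S_T, ih, pow_succ', mul_smul, sub_smul, one_smul]

theorem one_sub_T_pow_eq {β : ℝ} {k : ℕ} (hβ : 0 < β) (hk : β < k) (h : ℝ) (x : X) :
    ((1 - F.T h) ^ k) x = F.T (k * h) (F.diff (k - β) (-h) (F.diff β (-h) x)) := by
  refine F.ext_S fun m => ?_
  rw [S_one_sub_T_pow, S_T, S_diff _ (by linarith), S_diff _ hβ, smul_smul, smul_smul]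
  congr 1
  rw [mul_assoc, diffSymbol_mul_diffSymbol hβ hk, ← mul_assoc, chr, chr, ← Complex.exp_add]
  rw [show (((m * (k * h) : ℝ) : ℂ) * Complex.I + ((k * (m * -h) : ℝ) : ℂ) * Complex.I) = 0 by
    push_cast; ring, Complex.exp_zero, one_mul]
  congr 3
  push_cast; ring

theorem norm_one_sub_T_pow_le {β : ℝ} {k : ℕ} (hβ : 0 < β) (hk : β < k) (h : ℝ) (x : X) :
    ‖((1 - F.T h) ^ k) x‖ ≤ diffNorm (k - β) * ‖F.diff β (-h) x‖ := by
  rw [one_sub_T_pow_eq hβ hk, F.norm']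
  exact F.norm_diff_le (by linarith) _ _

omit [CompleteSpace X] in
theorem norm_one_sub_T_mul_pow_le (h : ℝ) (k R : ℕ) (x : X) :
    ‖((1 - F.T (R * h)) ^ k) x‖ ≤ (R : ℝ) ^ k * ‖((1 - F.T h) ^ k) x‖ := by
  have e : F.T (R * h) = F.T h ^ R := by ext x; rw [T_pow]
  have e2 : (1 - F.T (R * h)) ^ k = (∑ i ∈ Finset.range R, F.T h ^ i) ^ k * (1 - F.T h) ^ k := by
    rw [e, ← geom_sum_mul_neg]
    refine Commute.mul_pow ?_ _
    exact Commute.sum_left _ _ _ fun i _ => ((Commute.one_right _).sub_right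
      ((Commute.refl _).pow_left i))
  rw [e2, mul_apply_eq_comp]
  refine ContinuousLinearMap.le_of_opNorm_le _ ?_ _
  have h1 : ‖∑ i ∈ Finset.range R, F.T h ^ i‖ ≤ R := by
    refine (norm_sum_le _ _).trans ((Finset.sum_le_card_nsmul _ _ 1 fun i _ => ?_).trans (by simp))
    exact ContinuousLinearMap.opNorm_le_bound _ zero_le_one fun x => by rw [T_pow, F.norm', one_mul]
  have h2 : ∀ k : ℕ, ‖(∑ i ∈ Finset.range R, F.T h ^ i) ^ k‖ ≤ (R : ℝ) ^ k := by
    intro k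
    induction k with
    | zero =>
      rw [pow_zero, pow_zero]
      exact ContinuousLinearMap.opNorm_le_bound _ zero_le_one fun x => by simp
    | succ k ih =>
      rw [pow_succ, pow_succ]
      exact (norm_mul_le _ _).trans (mul_le_mul ih h1 (norm_nonneg _) (by positivity))
  exact h2 k

omit [CompleteSpace X] in
theorem one_sub_T_pow_expand (h : ℝ) (k : ℕ) (x : X) : ((1 - F.T h) ^ k) x =
    ∑ ν ∈ Finset.range (k + 1), ((-1 : ℂ) ^ ν * k.choose ν) • F.T (ν * h) x := by
  have h1 : (1 - F.T h) ^ k = ∑ ν ∈ Finset.range (k + 1), ((-1 : ℂ) ^ ν * k.choose ν) • F.T h ^ ν := by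
    rw [show 1 - F.T h = (-1 : ℂ) • F.T h + 1 by rw [neg_one_smul]; abel,
      (Commute.one_right _).add_pow]
    refine Finset.sum_congr rfl fun ν _ => ?_
    rw [one_pow, mul_one, smul_pow, mul_smul, smul_comm, smul_mul_assoc, ← nsmul_eq_mul']
    rw [← Nat.cast_smul_eq_nsmul ℂ, smul_comm]
  rw [h1, sum_apply]
  refine Finset.sum_congr rfl fun ν _ => ?_
  rw [smul_apply, T_pow]

theorem RieszBound.norm_sum_T_le {R : ℝ} (hR : F.RieszBound R) {A B : ℕ} (hA : 1 ≤ A) {h : ℝ}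
    (hh : 0 < h) (hB : B * h ≤ π) (M : ℕ) {x : X} (hx : F.P (blk A B) x = x) :
    ‖∑ l ∈ Finset.range M, F.T ((l + 1 : ℕ) * h) x‖ ≤ 4 * R * (π / (A * h)) * ‖x‖ := by
  obtain ⟨b, hb, hb'⟩ := hR.exists_sub_T hA hh hB x
  rw [hx] at hb
  have : ∀ l : ℕ, F.T ((l + 1 : ℕ) * h) x = F.T ((l + 1 : ℕ) * h) b - F.T ((l + 1 + 1 : ℕ) * h) b := by
    intro l
    rw [← hb, map_sub, ← F.add']
    congr 3; push_cast; ring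
  simp only [this]
  rw [Finset.sum_range_sub' (fun l : ℕ => F.T ((l + 1 : ℕ) * h) b)]
  refine (norm_sub_le _ _).trans ?_
  rw [F.norm', F.norm']
  refine le_trans (by linarith) (le_of_eq (?_ : 2 * (4 * R * (π / (2 * (A * h))) * ‖x‖) = _))
  have hA0 : (0 : ℝ) < A := by exact_mod_cast hA
  field_simp

/-- **Jackson-type inequality** for dyadic frequency cut-offs. -/
theorem RieszBound.exists_jackson {R : ℝ} (hR : F.RieszBound R) {β : ℝ} (hβ : 0 < β) :
    ∃ C : ℝ, 0 < C ∧ ∀ (n N : ℕ) (x : X) (w : ℝ), (∀ h, |h| ≤ (2 : ℝ)⁻¹ ^ n → ‖F.diff β h x‖ ≤ w) →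
      ‖F.P (blk (2 ^ n) (2 ^ N)) x‖ ≤ C * w := by
  have hR0 := hR.1
  obtain ⟨k, hk⟩ := exists_nat_gt β
  have hd := one_le_diffNorm (α := k - β) (by linarith)
  obtain ⟨L, hL⟩ := exists_nat_gt (2 ^ k * (4 * R * π) * 2)
  have hL0 : 0 < (L : ℝ) := lt_trans (by positivity) hL
  have hk0 : 0 < (k : ℝ) := hβ.trans hk
  refine ⟨2 * (L ^ k * (diffNorm (k - β) * (4 * R))), by positivity, fun n N x w hw => ?_⟩
  set u := F.P (blk (2 ^ n) (2 ^ N)) x with hu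
  have hPu : F.P (blk (2 ^ n) (2 ^ N)) u = u := P_P_self _ _
  have hdu : ∀ h, |h| ≤ (2 : ℝ)⁻¹ ^ n → ‖F.diff β h u‖ ≤ 4 * R * w := by
    intro h hh
    have e : F.diff β h u = F.P (blk (2 ^ n) (2 ^ N)) (F.diff β h x) := by
      rw [hu, P, diff_mul _ hβ, mul_diff _ hβ]
    rw [e]
    exact (hR.norm_P_le Nat.one_le_two_pow _).trans
      (mul_le_mul_of_nonneg_left (hw h hh) (by positivity))
  have hD : ∀ s, |s| ≤ L * (2 : ℝ)⁻¹ ^ n →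
      ‖((1 - F.T s) ^ k) u‖ ≤ L ^ k * (diffNorm (k - β) * (4 * R * w)) := by
    intro s hs
    have h1 := norm_one_sub_T_mul_pow_le (F := F) (s / L) k L u
    rw [mul_div_cancel₀ _ hL0.ne'] at h1
    refine h1.trans (mul_le_mul_of_nonneg_left ?_ (by positivity))
    refine (norm_one_sub_T_pow_le hβ hk _ u).trans (mul_le_mul_of_nonneg_left ?_ (by linarith))
    refine hdu _ ?_
    rw [abs_neg, abs_div, abs_of_pos hL0, div_le_iff₀ hL0, mul_comm]
    exact hs
  set M : ℕ := L * k * 2 ^ N with hM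
  set η : ℝ := (2 : ℝ)⁻¹ ^ n / (k * 2 ^ N) with hη
  have hη0 : 0 < η := by positivity
  have hMη : M * η = L * (2 : ℝ)⁻¹ ^ n := by rw [hM, hη]; push_cast; field_simp
  have hM0 : 0 < (M : ℝ) := by rw [hM]; push_cast; positivity
  have hB : ∀ ν : ℕ, ν ≤ k → ((2 ^ N : ℕ) : ℝ) * (ν * η) ≤ π := by
    intro ν hν
    have h1 : (ν : ℝ) ≤ k := by exact_mod_cast hν
    have h2 : (2 : ℝ)⁻¹ ^ n ≤ 1 := pow_le_one₀ (by norm_num) (by norm_num)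
    have h3 : ((2 ^ N : ℕ) : ℝ) * (k * η) = (2 : ℝ)⁻¹ ^ n := by rw [hη]; push_cast; field_simp
    have h4 : ((2 ^ N : ℕ) : ℝ) * (ν * η) ≤ ((2 ^ N : ℕ) : ℝ) * (k * η) := by gcongr
    linarith [Real.pi_gt_three]
  have e1 : (M : ℂ) • u = ∑ l ∈ Finset.range M, ((1 - F.T ((l + 1 : ℕ) * η)) ^ k) u -
      ∑ ν ∈ Finset.range k, ((-1 : ℂ) ^ (ν + 1) * k.choose (ν + 1)) •
        ∑ l ∈ Finset.range M, F.T ((l + 1 : ℕ) * ((ν + 1 : ℕ) * η)) u := by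
    simp only [one_sub_T_pow_expand, Finset.smul_sum]
    rw [Finset.sum_comm (s := Finset.range k), ← Finset.sum_sub_distrib]
    have : ∀ l ∈ Finset.range M, ∑ ν ∈ Finset.range (k + 1), ((-1 : ℂ) ^ ν * k.choose ν) •
        F.T (ν * ((l + 1 : ℕ) * η)) u - ∑ ν ∈ Finset.range k, ((-1 : ℂ) ^ (ν + 1) * k.choose (ν + 1)) •
        F.T ((l + 1 : ℕ) * ((ν + 1 : ℕ) * η)) u = u := by
      intro l _
      rw [Finset.sum_range_succ', add_sub_right_comm, ← Finset.sum_sub_distrib]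
      simp [F.zero', mul_left_comm]
    rw [Finset.sum_congr rfl this, Finset.sum_const, Finset.card_range, Nat.cast_smul_eq_nsmul]
  have n1 : ‖∑ l ∈ Finset.range M, ((1 - F.T ((l + 1 : ℕ) * η)) ^ k) u‖ ≤
      M * (L ^ k * (diffNorm (k - β) * (4 * R * w))) := by
    refine (norm_sum_le _ _).trans ((Finset.sum_le_card_nsmul _ _ _ fun l hl => hD _ ?_).trans
      (by rw [Finset.card_range, nsmul_eq_mul]))
    rw [← hMη, abs_of_pos (by positivity)]
    have : ((l + 1 : ℕ) : ℝ) ≤ M := by exact_mod_cast Finset.mem_range.1 hl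
    gcongr
  have n2 : ‖∑ ν ∈ Finset.range k, ((-1 : ℂ) ^ (ν + 1) * k.choose (ν + 1)) •
        ∑ l ∈ Finset.range M, F.T ((l + 1 : ℕ) * ((ν + 1 : ℕ) * η)) u‖ ≤ M / 2 * ‖u‖ := by
    have hterm : ∀ ν ∈ Finset.range k, ‖((-1 : ℂ) ^ (ν + 1) * k.choose (ν + 1)) •
        ∑ l ∈ Finset.range M, F.T ((l + 1 : ℕ) * ((ν + 1 : ℕ) * η)) u‖ ≤
        k.choose (ν + 1) * (4 * R * (π * M / L) * ‖u‖) := by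
      intro ν hν
      have hν := Finset.mem_range.1 hν
      rw [norm_smul, norm_mul, norm_pow, norm_neg, norm_one, one_pow, one_mul, Complex.norm_natCast]
      refine mul_le_mul_of_nonneg_left ?_ (by positivity)
      refine (hR.norm_sum_T_le Nat.one_le_two_pow (by positivity) (hB (ν + 1) hν) M hPu).trans ?_
      have : π / (((2 ^ n : ℕ) : ℝ) * ((ν + 1 : ℕ) * η)) ≤ π * M / L := by
        have h5 : (1 : ℝ) ≤ (ν + 1 : ℕ) := by push_cast; linarith [(Nat.cast_nonneg ν : (0:ℝ) ≤ ν)]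
        have h6 : ((2 ^ n : ℕ) : ℝ) * (M * η) = L := by
          rw [hMη, mul_left_comm]; push_cast; rw [← mul_pow]; norm_num
        rw [div_le_div_iff₀ (by positivity) hL0]
        calc π * L = π * M * (((2 ^ n : ℕ) : ℝ) * (1 * η)) := by rw [← h6]; ring
          _ ≤ _ := by gcongr
      gcongr
    refine (norm_sum_le_of_le _ hterm).trans ?_
    rw [← Finset.sum_mul]
    have hc : ∑ ν ∈ Finset.range k, (k.choose (ν + 1) : ℝ) ≤ 2 ^ k := by
      have := Nat.sum_range_choose k
      rw [Finset.sum_range_succ'] at this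
      have : ∑ ν ∈ Finset.range k, k.choose (ν + 1) ≤ 2 ^ k := by omega
      exact_mod_cast this
    have h7 : 2 ^ k * (4 * R * (π * M / L)) ≤ M / 2 := by
      rw [show 2 ^ k * (4 * R * (π * M / L)) = 2 ^ k * (4 * R * π) * 2 * (M / 2) / L by ring,
        div_le_iff₀ hL0, mul_comm (M / 2 : ℝ)]
      gcongr
    calc _ ≤ 2 ^ k * (4 * R * (π * M / L) * ‖u‖) := by gcongr
      _ = 2 ^ k * (4 * R * (π * M / L)) * ‖u‖ := by ring
      _ ≤ _ := by gcongr
  have n3 : M * ‖u‖ ≤ M * (L ^ k * (diffNorm (k - β) * (4 * R * w))) + M / 2 * ‖u‖ := by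
    have := norm_sub_le_of_le n1 n2
    rwa [← e1, norm_smul, Complex.norm_natCast] at this
  have n4 : (M : ℝ) * ‖u‖ ≤ M * (2 * (L ^ k * (diffNorm (k - β) * (4 * R))) * w) := by linarith
  exact le_of_mul_le_mul_left n4 hM0

end IsoFlow

namespace IsoFlow

section Rev

variable {X : Type*} [NormedAddCommGroup X] [NormedSpace ℂ X]

/-- The flow run backwards. -/
def rev (F : IsoFlow X) : IsoFlow X where
  T t := F.T (-t)
  zero' x := by simp [F.zero']
  add' s t x := by rw [neg_add, F.add']
  norm' s x := F.norm' _ x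
  cont' x := (F.cont' x).comp continuous_neg
  periodic' s x := by
    rw [neg_add, ← F.periodic' (-s + -(2 * π))]; simp

variable {F : IsoFlow X} [CompleteSpace X]

theorem rev_S (m : ℤ) (x : X) : F.rev.S m x = F.S (-m) x := by
  refine F.ext_S fun l => ?_
  have h1 : F.S l (F.rev.S m x) = F.rev.S m (F.S l x) :=
    F.rev.comm_S (F.S l) (fun s x => by
      change F.S l (F.T (-s) x) = F.T (-s) (F.S l x); rw [F.T_S_comm]) m x
  rw [h1, S_S, S_apply]
  have h2 : ∀ h, chr (-m) h • F.rev.T h (F.S l x) = (chr (-(m + l)) h * chr 0 h) • F.S l x := by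
    intro h
    change chr (-m) h • F.T (-h) (F.S l x) = _
    rw [T_S, smul_smul, chr_neg_right, ← chr_add_left, ← chr_add_left]
    congr 2; ring
  have h3 : ∀ h, chr (-(m + l)) h • F.T h (F.S 0 (F.S 0 x)) = chr (-(m + l)) h • F.S 0 x := by
    intro h; rw [S_S, if_pos rfl, T_S, chr_zero_left, one_smul]
  simp only [h2, chr_zero_left, mul_one]
  rw [intervalIntegral.integral_smul_const]
  have : (∫ h in (0:ℝ)..2 * π, chr (-(m + l)) h) = if m + l = 0 then (2 * π : ℂ) else 0 := by
    split_ifs with h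
    · simp [h, chr_zero_left]
    · have hne : ((-(m + l) : ℤ) : ℂ) ≠ 0 := by
        exact_mod_cast fun h' => h (by omega)
      have : ∀ x : ℝ, chr (-(m + l)) x =
          Complex.exp ((((-(m + l) : ℤ) : ℂ) * Complex.I) * x) := by
        intro x; rw [chr]; congr 1; push_cast; ring
      simp only [this]
      rw [integral_exp_mul_complex (mul_ne_zero hne Complex.I_ne_zero), ← this, chr_two_pi]
      simp
  rw [this]
  by_cases h : m + l = 0
  · have : l = -m := by omega
    rw [if_pos h, if_pos this, ← Complex.coe_smul, smul_smul, ← this]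
    have : ((2 * π : ℝ) : ℂ) ≠ 0 := by exact_mod_cast (by positivity : (2 * π : ℝ) ≠ 0)
    push_cast at this ⊢
    rw [inv_mul_cancel₀ this, one_smul]
  · rw [if_neg h, if_neg (by omega), zero_smul, smul_zero]

theorem RieszBound.rev {R : ℝ} (hR : F.RieszBound R) : F.rev.RieszBound R := by
  refine ⟨hR.1, fun a b x => ?_⟩
  simp only [rev_S]
  have : ∑ m ∈ Finset.Ico a b, F.S (-m) x = ∑ m ∈ Finset.Ico (1 - b) (1 - a), F.S m x := by
    refine Finset.sum_nbij' (fun m => -m) (fun m => -m) ?_ ?_ ?_ ?_ ?_ <;> simp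
    all_goals intros; omega
  rw [this]
  exact hR.2 _ _ x

end Rev

/-- A norming pairing between two Banach spaces for which two flows are adjoint. -/
structure Adjoint {X Y : Type*} [NormedAddCommGroup X] [NormedSpace ℂ X] [NormedAddCommGroup Y]
    [NormedSpace ℂ Y] (F : IsoFlow X) (G : IsoFlow Y) (B : X →L[ℂ] Y →L[ℂ] ℂ) : Prop where
  norm_le : ∀ x y, ‖B x y‖ ≤ ‖x‖ * ‖y‖
  norming : ∀ x, ∃ y, ‖y‖ ≤ 1 ∧ B x y = ‖x‖
  adj : ∀ t x y, B (F.T t x) y = B x (G.T t y)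

namespace Adjoint

variable {X Y : Type*} [NormedAddCommGroup X] [NormedSpace ℂ X] [NormedAddCommGroup Y]
  [NormedSpace ℂ Y] {F : IsoFlow X} {G : IsoFlow Y} {B : X →L[ℂ] Y →L[ℂ] ℂ}
  [CompleteSpace X] [CompleteSpace Y]

theorem S (h : Adjoint F G B) (m : ℤ) (x : X) (y : Y) : B (F.S m x) y = B x (G.S m y) := by
  have e1 : B (F.S m x) y = B.flip y (F.S m x) := rfl
  rw [e1, S_apply, S_apply, (B.flip y).map_smul_of_tower, (B x).map_smul_of_tower,
    ← (B.flip y).intervalIntegral_comp_comm ((F.continuous_chr_smul _ _).intervalIntegrable _ _),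
    ← (B x).intervalIntegral_comp_comm ((G.continuous_chr_smul _ _).intervalIntegrable _ _)]
  simp [h.adj]

theorem P (h : Adjoint F G B) (s : Finset ℤ) (x : X) (y : Y) : B (F.P s x) y = B x (G.P s y) := by
  simp [IsoFlow.P, mul_apply, h.S]

theorem rieszBound (h : Adjoint F G B) {R : ℝ} (hR : G.RieszBound R) : F.RieszBound R := by
  refine ⟨hR.1, fun a b x => ?_⟩
  obtain ⟨y, hy, hxy⟩ := h.norming (∑ m ∈ Finset.Ico a b, F.S m x)
  have e : B (∑ m ∈ Finset.Ico a b, F.S m x) y = B x (∑ m ∈ Finset.Ico a b, G.S m y) := by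
    simp [h.S]
  have h1 := h.norm_le x (∑ m ∈ Finset.Ico a b, G.S m y)
  rw [← e, hxy, Complex.norm_real, norm_norm] at h1
  have h2 := hR.2 a b y
  have := hR.1
  calc _ ≤ ‖x‖ * (R * ‖y‖) := h1.trans (by gcongr)
    _ ≤ ‖x‖ * (R * 1) := by gcongr
    _ = _ := by ring

/-- The lower square-function type estimate, obtained by duality. -/
theorem exists_sum_rpow_le (h : Adjoint F G B) {R σ τ K : ℝ} (hR : G.RieszBound R)
    (hY : SmoothNorm Y σ K) (hστ : σ.HolderConjugate τ) :
    ∃ C : ℝ, 0 < C ∧ ∀ (n N : ℕ) (x : X),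
      ∑ i ∈ Finset.range N, ‖F.P (fb n i) x‖ ^ τ ≤ C * ‖x‖ ^ τ := by
  obtain ⟨C, hC, H⟩ := core hR hY
  have hR0 := hR.1
  have hσ := hστ.lt
  have hτ := hστ.symm.lt
  have hσ0 : 0 < σ := by linarith
  have hτ0 : 0 < τ := by linarith
  have hmul : (τ - 1) * σ = τ := by have := hστ.mul_eq_add; linarith
  have hmul' : (σ - 1) * (τ / σ) = 1 := by
    have := hστ.mul_eq_add; field_simp; linarith
  set C₁ : ℝ := C * (4 * R) ^ σ with hC1
  have hC1p : 0 < C₁ := by positivity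
  refine ⟨C₁ ^ (τ / σ), by positivity, fun n N x => ?_⟩
  choose y hy hxy using fun i => h.norming (F.P (fb n i) x)
  set A := ∑ i ∈ Finset.range N, ‖F.P (fb n i) x‖ ^ τ with hA
  have hA0 : 0 ≤ A := Finset.sum_nonneg fun _ _ => by positivity
  rcases hA0.eq_or_lt with h0 | hpos
  · rw [← h0]; positivity
  let t : ℕ → ℝ := fun i => ‖F.P (fb n i) x‖ ^ (τ - 1)
  have ht : ∀ i, t i * ‖F.P (fb n i) x‖ = ‖F.P (fb n i) x‖ ^ τ := by
    intro i
    rcases (norm_nonneg (F.P (fb n i) x)).eq_or_lt with h0 | h0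
    · rw [← h0, Real.zero_rpow hτ0.ne', mul_zero]
    · change _ ^ (τ - 1) * _ = _
      nth_rewrite 2 [← Real.rpow_one ‖F.P (fb n i) x‖]
      rw [← Real.rpow_add h0]; congr 1; ring
  let z : ℕ → Y := fun i => (t i : ℂ) • G.P (fb n i) (y i)
  have hz : ∀ i, G.P (fb n i) (z i) = z i := fun i => by
    simp only [z, map_smul, P_P_self]
  have hBA : B x (∑ i ∈ Finset.range N, z i) = (A : ℂ) := by
    rw [map_sum, hA, Complex.ofReal_sum]
    refine Finset.sum_congr rfl fun i _ => ?_
    simp only [z, map_smul]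
    rw [← h.P, hxy, ← ht]; simp
  have h1 := h.norm_le x (∑ i ∈ Finset.range N, z i)
  rw [hBA, Complex.norm_real, Real.norm_of_nonneg hA0] at h1
  have h2 : ‖∑ i ∈ Finset.range N, z i‖ ^ σ ≤ C₁ * A := by
    refine (H n N z hz).trans ?_
    rw [hC1, mul_assoc]
    refine mul_le_mul_of_nonneg_left ?_ hC.le
    rw [hA, Finset.mul_sum]
    refine Finset.sum_le_sum fun i _ => ?_
    have hn : ‖z i‖ ≤ t i * (4 * R) := by
      have ht0 : 0 ≤ t i := by positivity
      rw [norm_smul, Complex.norm_real, Real.norm_of_nonneg ht0]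
      refine mul_le_mul_of_nonneg_left ?_ ht0
      refine (hR.norm_P_le (fb_lo_pos n i) (y i)).trans ?_
      have := hy i
      nlinarith
    refine (Real.rpow_le_rpow (norm_nonneg _) hn hσ0.le).trans (le_of_eq ?_)
    rw [Real.mul_rpow (by positivity) (by positivity), mul_comm, ← Real.rpow_mul (norm_nonneg _),
      hmul]
  have h3 : A ^ σ ≤ ‖x‖ ^ σ * (C₁ * A) := by
    refine (Real.rpow_le_rpow hA0 h1 hσ0.le).trans ?_
    rw [Real.mul_rpow (by positivity) (by positivity)]
    gcongr
  have h4 : A ^ (σ - 1) ≤ C₁ * ‖x‖ ^ σ := by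
    rw [Real.rpow_sub_one hpos.ne', div_le_iff₀ hpos]
    linarith
  have h5 := Real.rpow_le_rpow (by positivity) h4 (by positivity : 0 ≤ τ / σ)
  rw [← Real.rpow_mul hA0, hmul', Real.rpow_one, Real.mul_rpow hC1p.le (by positivity),
    ← Real.rpow_mul (norm_nonneg _), mul_div_cancel₀ _ hσ0.ne'] at h5
  exact h5

end Adjoint

/-- The conclusion of the duality estimate, with bands measured by `Z`. -/
theorem exists_sum_Z_rpow_le {X : Type*} [NormedAddCommGroup X] [NormedSpace ℂ X] [CompleteSpace X]
    {F : IsoFlow X} {τ C : ℝ} (hτ : 0 < τ)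
    (hC : 0 < C) (H : ∀ (n N : ℕ) (x : X),
      ∑ i ∈ Finset.range N, ‖F.P (fb n i) x‖ ^ τ ≤ C * ‖x‖ ^ τ) (β : ℝ) (n N : ℕ) (x : X) :
    ∑ i ∈ Finset.range (N + 1), ‖F.Z β n i x‖ₑ ^ τ ≤
      ‖F.Z β n 0 x‖ₑ ^ τ + ENNReal.ofReal C * ‖F.P (blk (2 ^ n) (2 ^ (n + N))) x‖ₑ ^ τ := by
  rw [Finset.sum_range_succ', add_comm]
  gcongr
  set u := F.P (blk (2 ^ n) (2 ^ (n + N))) x with hu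
  have e : ∀ i ∈ Finset.range N, F.Z β n (i + 1) x = F.P (fb n (i + 1)) u := by
    intro i hi
    rw [Z, if_neg (by omega), hu, P, mul_P, ← P]
    congr 2
    refine (Finset.inter_eq_left.2 fun m hm => ?_).symm
    rw [Finset.mem_range] at hi
    rw [fb_succ, mem_blk] at hm
    rw [mem_blk]
    have h1 : 2 ^ n ≤ 2 ^ (n + i) := Nat.pow_le_pow_right (by norm_num) (by omega)
    have h2 : 2 ^ (n + i + 1) ≤ 2 ^ (n + N) := Nat.pow_le_pow_right (by norm_num) (by omega)
    omega
  rw [Finset.sum_congr rfl fun i hi => by rw [e i hi]]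
  have h1 := H n (N + 1) u
  rw [Finset.sum_range_succ'] at h1
  have h2 : ∑ i ∈ Finset.range N, ‖F.P (fb n (i + 1)) u‖ ^ τ ≤ C * ‖u‖ ^ τ :=
    le_trans (le_add_of_nonneg_right (by positivity)) h1
  have h3 := ENNReal.ofReal_le_ofReal h2
  rw [ENNReal.ofReal_mul hC.le, ENNReal.ofReal_sum_of_nonneg (fun i _ => by positivity),
    ← ENNReal.ofReal_rpow_of_nonneg (norm_nonneg _) hτ.le, ofReal_norm] at h3
  refine le_trans (le_of_eq ?_) h3
  exact Finset.sum_congr rfl fun i _ => by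
    rw [← ENNReal.ofReal_rpow_of_nonneg (norm_nonneg _) hτ.le, ofReal_norm]

end IsoFlow

namespace IsoFlow

variable {X : Type*} [NormedAddCommGroup X] [NormedSpace ℂ X]

/-- Two flows commute. -/
def Comm (F G : IsoFlow X) : Prop := ∀ s t x, F.T s (G.T t x) = G.T t (F.T s x)

namespace Comm

variable {F G : IsoFlow X} [CompleteSpace X]

omit [CompleteSpace X] in
theorem symm (h : F.Comm G) : G.Comm F := fun s t x => (h t s x).symm

theorem S_T (h : F.Comm G) (m : ℤ) (t : ℝ) (x : X) : F.S m (G.T t x) = G.T t (F.S m x) :=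
  (F.comm_S (G.T t) (fun s x => h.symm t s x) m x).symm

theorem S_S (h : F.Comm G) (m n : ℤ) (x : X) : F.S m (G.S n x) = G.S n (F.S m x) :=
  G.comm_S (F.S m) (fun t x => h.S_T m t x) n x

theorem mul_T (h : F.Comm G) (s : Finset ℤ) (μ : ℤ → ℂ) (t : ℝ) (x : X) :
    F.mul s μ (G.T t x) = G.T t (F.mul s μ x) :=
  (F.comm_mul (G.T t) (fun s x => h.symm t s x) s μ x).symm

theorem mul_mul (h : F.Comm G) (s t : Finset ℤ) (μ ν : ℤ → ℂ) (x : X) :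
    F.mul s μ (G.mul t ν x) = G.mul t ν (F.mul s μ x) :=
  G.comm_mul (F.mul s μ) (fun _ x => h.mul_T s μ _ x) t ν x

theorem mul_S (h : F.Comm G) (s : Finset ℤ) (μ : ℤ → ℂ) (n : ℤ) (x : X) :
    F.mul s μ (G.S n x) = G.S n (F.mul s μ x) :=
  G.comm_S (F.mul s μ) (fun _ x => h.mul_T s μ _ x) n x

theorem diff_T (h : F.Comm G) {α : ℝ} (hα : 0 < α) (η t : ℝ) (x : X) :
    F.diff α η (G.T t x) = G.T t (F.diff α η x) :=
  (F.comm_diff (G.T t) (fun s x => h.symm t s x) hα η x).symm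

theorem diff_S (h : F.Comm G) {α : ℝ} (hα : 0 < α) (η : ℝ) (n : ℤ) (x : X) :
    F.diff α η (G.S n x) = G.S n (F.diff α η x) :=
  G.comm_S (F.diff α η) (fun _ x => h.diff_T hα η _ x) n x

theorem diff_mul (h : F.Comm G) {α : ℝ} (hα : 0 < α) (η : ℝ) (s : Finset ℤ) (μ : ℤ → ℂ) (x : X) :
    F.diff α η (G.mul s μ x) = G.mul s μ (F.diff α η x) :=
  G.comm_mul (F.diff α η) (fun _ x => h.diff_T hα η _ x) s μ x

theorem diff_diff (h : F.Comm G) {α α' : ℝ} (hα : 0 < α) (hα' : 0 < α') (η η' : ℝ) (x : X) :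
    F.diff α η (G.diff α' η' x) = G.diff α' η' (F.diff α η x) :=
  G.comm_diff (F.diff α η) (fun _ x => h.diff_T hα η _ x) hα' η' x

theorem Z_T (h : F.Comm G) {β : ℝ} (hβ : 0 < β) (n i : ℕ) (t : ℝ) (x : X) :
    F.Z β n i (G.T t x) = G.T t (F.Z β n i x) := by
  unfold Z P
  split_ifs
  · simp only [ContinuousLinearMap.comp_apply, h.mul_T, h.diff_T hβ]
  · rw [h.mul_T]

theorem Z_mul (h : F.Comm G) {β : ℝ} (hβ : 0 < β) (n i : ℕ) (s : Finset ℤ) (μ : ℤ → ℂ) (x : X) :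
    F.Z β n i (G.mul s μ x) = G.mul s μ (F.Z β n i x) :=
  G.comm_mul (F.Z β n i) (fun _ x => h.Z_T hβ n i _ x) s μ x

theorem Z_Z (h : F.Comm G) {β β' : ℝ} (hβ : 0 < β) (hβ' : 0 < β') (n i n' i' : ℕ) (x : X) :
    F.Z β n i (G.Z β' n' i' x) = G.Z β' n' i' (F.Z β n i x) := by
  have hT : ∀ t x, F.Z β n i (G.T t x) = G.T t (F.Z β n i x) := fun t x => h.Z_T hβ n i t x
  generalize F.Z β n i = A at hT ⊢
  unfold Z P
  split_ifs
  · simp only [ContinuousLinearMap.comp_apply, G.comm_diff A hT hβ', G.comm_mul A hT]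
  · rw [G.comm_mul A hT]

end Comm

/-- `g` is the mixed Weyl derivative of `f` of order `(r₁, r₂)` along the flows. -/
def IsDeriv (F G : IsoFlow X) (r₁ r₂ : ℝ) (f g : X) : Prop :=
  ∀ m n : ℤ, F.S m (G.S n g) =
    ((Complex.I * m) ^ (r₁ : ℂ) * (Complex.I * n) ^ (r₂ : ℂ)) • F.S m (G.S n f)

variable {F G : IsoFlow X} [CompleteSpace X]

theorem ext_S₂ (F G : IsoFlow X) {x y : X} (h : ∀ m n, F.S m (G.S n x) = F.S m (G.S n y)) : x = y :=
  G.ext_S fun n => F.ext_S fun m => h m n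

theorem exists_norm_deriv_le₂ {R₁ R₂ r₁ r₂ β₁ β₂ : ℝ} (hc : F.Comm G) (hF : F.RieszBound R₁)
    (hG : G.RieszBound R₂) (hr₁ : 0 < r₁) (hr₂ : 0 < r₂) (hβ₁ : 0 < β₁) (hβ₂ : 0 < β₂) :
    ∃ C : ℝ, 0 < C ∧ ∀ (i k : ℕ) (f : X),
      ‖F.mul (fb 0 i) (fun m => (Complex.I * m) ^ (r₁ : ℂ))
        (G.mul (fb 0 k) (fun m => (Complex.I * m) ^ (r₂ : ℂ)) f)‖ₑ ≤
      ENNReal.ofReal C * (ENNReal.ofReal (((2 : ℝ) ^ r₁) ^ (0 + i) * ((2 : ℝ) ^ r₂) ^ (0 + k)) *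
        ‖F.diff (r₁ + β₁) ((2 : ℝ)⁻¹ ^ (0 + i + 1)) (G.diff (r₂ + β₂) ((2 : ℝ)⁻¹ ^ (0 + k + 1)) f)‖ₑ) := by
  obtain ⟨C₁, hC₁, H₁⟩ := hF.exists_norm_deriv_le hr₁ hβ₁
  obtain ⟨C₂, hC₂, H₂⟩ := hG.exists_norm_deriv_le hr₂ hβ₂
  refine ⟨C₁ * C₂, by positivity, fun i k f => ?_⟩
  have hemp : fb 0 0 = ∅ := by
    ext m; rw [fb_zero, mem_blk]; simp; omega
  rcases Nat.eq_zero_or_pos i with rfl | hi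
  · rw [hemp]; simp [mul_apply]
  rcases Nat.eq_zero_or_pos k with rfl | hk
  · rw [hemp]; simp [mul_apply]
  have h1 := H₁ 0 i (G.mul (fb 0 k) (fun m => (Complex.I * m) ^ (r₂ : ℂ)) f) hi
  rw [hc.diff_mul (by positivity)] at h1
  have h2 := H₂ 0 k (F.diff (r₁ + β₁) ((2 : ℝ)⁻¹ ^ (0 + i + 1)) f) hk
  rw [← hc.diff_diff (by positivity) (by positivity)] at h2
  rw [← ofReal_norm, ← ofReal_norm, ← ENNReal.ofReal_mul (by positivity),
    ← ENNReal.ofReal_mul (by positivity)]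
  refine ENNReal.ofReal_le_ofReal (h1.trans ?_)
  calc _ ≤ C₁ * ((2 : ℝ) ^ r₁) ^ (0 + i) * (C₂ * ((2 : ℝ) ^ r₂) ^ (0 + k) *
        ‖F.diff (r₁ + β₁) ((2 : ℝ)⁻¹ ^ (0 + i + 1)) (G.diff (r₂ + β₂) ((2 : ℝ)⁻¹ ^ (0 + k + 1)) f)‖) := by
        gcongr
    _ = _ := by ring

theorem exists_norm_diff_deriv_le₂ {R₁ R₂ r₁ r₂ β₁ β₂ : ℝ} (hc : F.Comm G) (hF : F.RieszBound R₁)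
    (hG : G.RieszBound R₂) (hr₁ : 0 < r₁) (hr₂ : 0 < r₂) (hβ₁ : 0 < β₁) (hβ₂ : 0 < β₂) :
    ∃ C : ℝ, 0 < C ∧ ∀ (n₁ n₂ i k : ℕ) (h₁ h₂ : ℝ) (f : X), |h₁| ≤ 2 * (2 : ℝ)⁻¹ ^ n₁ →
      |h₂| ≤ 2 * (2 : ℝ)⁻¹ ^ n₂ →
      ‖F.mul (fb n₁ i) (fun m => diffSymbol β₁ (m * h₁) * (Complex.I * m) ^ (r₁ : ℂ))
        (G.mul (fb n₂ k) (fun m => diffSymbol β₂ (m * h₂) * (Complex.I * m) ^ (r₂ : ℂ)) f)‖ₑ ≤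
      ENNReal.ofReal C * (ENNReal.ofReal (((2 : ℝ) ^ r₁) ^ (n₁ + i) * ((2 : ℝ) ^ r₂) ^ (n₂ + k)) *
        ‖F.diff (r₁ + β₁) ((2 : ℝ)⁻¹ ^ (n₁ + i + 1))
          (G.diff (r₂ + β₂) ((2 : ℝ)⁻¹ ^ (n₂ + k + 1)) f)‖ₑ) := by
  obtain ⟨C₁, hC₁, H₁⟩ := hF.exists_norm_diff_deriv_le hr₁ hβ₁
  obtain ⟨C₂, hC₂, H₂⟩ := hG.exists_norm_diff_deriv_le hr₂ hβ₂
  refine ⟨C₁ * C₂, by positivity, fun n₁ n₂ i k h₁ h₂ f hh₁ hh₂ => ?_⟩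
  have h1 := H₁ n₁ i h₁
    (G.mul (fb n₂ k) (fun m => diffSymbol β₂ (m * h₂) * (Complex.I * m) ^ (r₂ : ℂ)) f) hh₁
  rw [hc.diff_mul (by positivity)] at h1
  have h2 := H₂ n₂ k h₂ (F.diff (r₁ + β₁) ((2 : ℝ)⁻¹ ^ (n₁ + i + 1)) f) hh₂
  rw [← hc.diff_diff (by positivity) (by positivity)] at h2
  rw [← ofReal_norm, ← ofReal_norm, ← ENNReal.ofReal_mul (by positivity),
    ← ENNReal.ofReal_mul (by positivity)]
  refine ENNReal.ofReal_le_ofReal (h1.trans ?_)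
  calc _ ≤ C₁ * ((2 : ℝ) ^ r₁) ^ (n₁ + i) * (C₂ * ((2 : ℝ) ^ r₂) ^ (n₂ + k) *
        ‖F.diff (r₁ + β₁) ((2 : ℝ)⁻¹ ^ (n₁ + i + 1))
          (G.diff (r₂ + β₂) ((2 : ℝ)⁻¹ ^ (n₂ + k + 1)) f)‖) := by gcongr
    _ = _ := by ring

/-- Upper estimate of the differences of a mixed derivative. -/
theorem exists_enorm_diff_deriv_rpow_le {R₁ R₂ r₁ r₂ β₁ β₂ θ K : ℝ} (hX : SmoothNorm X θ K)
    (hc : F.Comm G) (hF : F.RieszBound R₁)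
    (hG : G.RieszBound R₂) (hr₁ : 0 < r₁) (hr₂ : 0 < r₂) (hβ₁ : 0 < β₁) (hβ₂ : 0 < β₂) :
    ∃ C : ℝ, 0 < C ∧ ∀ (n₁ n₂ : ℕ) (h₁ h₂ : ℝ) (f g : X), IsDeriv F G r₁ r₂ f g →
      F.S 0 g = 0 → G.S 0 g = 0 → |h₁| ≤ 2 * (2 : ℝ)⁻¹ ^ n₁ → |h₂| ≤ 2 * (2 : ℝ)⁻¹ ^ n₂ →
      ‖F.diff β₁ h₁ (G.diff β₂ h₂ g)‖ₑ ^ θ ≤ ENNReal.ofReal C * ∑' i : ℕ, ∑' k : ℕ,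
        (ENNReal.ofReal (((2 : ℝ) ^ r₁) ^ (n₁ + i) * ((2 : ℝ) ^ r₂) ^ (n₂ + k)) *
        ‖F.diff (r₁ + β₁) ((2 : ℝ)⁻¹ ^ (n₁ + i + 1))
          (G.diff (r₂ + β₂) ((2 : ℝ)⁻¹ ^ (n₂ + k + 1)) f)‖ₑ) ^ θ := by
  obtain ⟨C₁, hC₁, H₁⟩ := hF.exists_enorm_rpow_le hX
  obtain ⟨C₂, hC₂, H₂⟩ := hG.exists_enorm_rpow_le hX
  obtain ⟨C, hC, H⟩ := exists_norm_diff_deriv_le₂ hc hF hG hr₁ hr₂ hβ₁ hβ₂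
  have hθ : 0 ≤ θ := by linarith [hX.one_le]
  refine ⟨C₁ * C₂ * C ^ θ, by positivity, fun n₁ n₂ h₁ h₂ f g hfg hF0 hG0 hh₁ hh₂ => ?_⟩
  set u := F.diff β₁ h₁ (G.diff β₂ h₂ g) with hu
  have hSu : ∀ m n, F.S m (G.S n u) =
      (diffSymbol β₁ (m * h₁) * diffSymbol β₂ (n * h₂)) • F.S m (G.S n g) := by
    intro m n
    rw [hu, ← hc.diff_S hβ₁, F.S_diff hβ₁, G.S_diff hβ₂, map_smul, smul_smul]
  have hF0u : F.S 0 u = 0 := G.ext_S fun n => by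
    rw [← hc.S_S, hSu, hc.S_S, hF0]; simp
  have hG0u : G.S 0 u = 0 := F.ext_S fun n => by
    rw [hSu, hG0]; simp
  have hQ : ∀ i k, G.P (fb n₂ k) (F.P (fb n₁ i) u) =
      F.mul (fb n₁ i) (fun m => diffSymbol β₁ (m * h₁) * (Complex.I * m) ^ (r₁ : ℂ))
        (G.mul (fb n₂ k) (fun m => diffSymbol β₂ (m * h₂) * (Complex.I * m) ^ (r₂ : ℂ)) f) := by
    intro i k
    refine ext_S₂ F G fun m n => ?_
    rw [P, P, G.S_mul, ← hc.mul_S, ← hc.mul_S, F.S_mul, G.S_mul]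
    by_cases hn : n ∈ fb n₂ k
    · by_cases hm : m ∈ fb n₁ i
      · simp only [hn, hm, if_true, one_smul, map_smul, F.S_mul]
        rw [hSu, hfg m n, smul_smul, smul_smul]; congr 1; ring
      · simp [hn, hm, F.S_mul]
    · simp [hn]
  calc ‖u‖ₑ ^ θ ≤ ENNReal.ofReal C₁ * ∑' i, ‖F.P (fb n₁ i) u‖ₑ ^ θ := H₁ n₁ u hF0u
    _ ≤ ENNReal.ofReal C₁ * ∑' i, (ENNReal.ofReal C₂ *
          ∑' k, ‖G.P (fb n₂ k) (F.P (fb n₁ i) u)‖ₑ ^ θ) := by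
        gcongr with i
        refine H₂ n₂ _ ?_
        rw [P, ← hc.mul_S, hG0u, map_zero]
    _ ≤ ENNReal.ofReal C₁ * ∑' i, (ENNReal.ofReal C₂ * ∑' k, (ENNReal.ofReal C *
          (ENNReal.ofReal (((2 : ℝ) ^ r₁) ^ (n₁ + i) * ((2 : ℝ) ^ r₂) ^ (n₂ + k)) *
        ‖F.diff (r₁ + β₁) ((2 : ℝ)⁻¹ ^ (n₁ + i + 1))
          (G.diff (r₂ + β₂) ((2 : ℝ)⁻¹ ^ (n₂ + k + 1)) f)‖ₑ)) ^ θ) := by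
        gcongr with i k
        rw [hQ]
        exact H n₁ n₂ i k h₁ h₂ f hh₁ hh₂
    _ = _ := by
        simp only [ENNReal.mul_rpow_of_nonneg (ENNReal.ofReal C) _ hθ]
        simp only [ENNReal.tsum_mul_left]
        rw [ENNReal.ofReal_mul (by positivity), ENNReal.ofReal_mul (by positivity),
          ENNReal.ofReal_rpow_of_nonneg hC.le hθ]
        ring

/-- Existence of the mixed derivative. -/
theorem exists_isDeriv {R₁ R₂ r₁ r₂ β₁ β₂ θ K : ℝ} (hX : SmoothNorm X θ K)
    (hc : F.Comm G) (hF : F.RieszBound R₁)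
    (hG : G.RieszBound R₂) (hr₁ : 0 < r₁) (hr₂ : 0 < r₂) (hβ₁ : 0 < β₁) (hβ₂ : 0 < β₂) (f : X)
    (hF0 : F.S 0 f = 0) (hG0 : G.S 0 f = 0)
    (hf : ∑' i : ℕ, ∑' k : ℕ,
        (ENNReal.ofReal (((2 : ℝ) ^ r₁) ^ (0 + i) * ((2 : ℝ) ^ r₂) ^ (0 + k)) *
        ‖F.diff (r₁ + β₁) ((2 : ℝ)⁻¹ ^ (0 + i + 1))
          (G.diff (r₂ + β₂) ((2 : ℝ)⁻¹ ^ (0 + k + 1)) f)‖ₑ) ^ θ ≠ ⊤) :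
    ∃ g : X, IsDeriv F G r₁ r₂ f g ∧ F.S 0 g = 0 ∧ G.S 0 g = 0 := by
  obtain ⟨C₁, hC₁, H₁⟩ := hF.exists_summable hX
  obtain ⟨C₂, hC₂, H₂⟩ := hG.exists_summable hX
  obtain ⟨C, hC, H⟩ := exists_norm_deriv_le₂ hc hF hG hr₁ hr₂ hβ₁ hβ₂
  have hθ : 0 ≤ θ := by linarith [hX.one_le]
  set y : ℕ → ℕ → X := fun i k => F.mul (fb 0 i) (fun m => (Complex.I * m) ^ (r₁ : ℂ))
        (G.mul (fb 0 k) (fun m => (Complex.I * m) ^ (r₂ : ℂ)) f) with hy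
  have hsum : ∑' i, ∑' k, ‖y i k‖ₑ ^ θ ≠ ⊤ := by
    refine ne_top_of_le_ne_top (ENNReal.mul_ne_top (a := ENNReal.ofReal C ^ θ)
      (ENNReal.rpow_ne_top_of_nonneg hθ ENNReal.ofReal_ne_top) hf) ?_
    rw [← ENNReal.tsum_mul_left]
    refine ENNReal.tsum_le_tsum fun i => ?_
    rw [← ENNReal.tsum_mul_left]
    refine ENNReal.tsum_le_tsum fun k => ?_
    rw [← ENNReal.mul_rpow_of_nonneg _ _ hθ]
    exact ENNReal.rpow_le_rpow (H i k f) hθ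
  have hyG : ∀ i k, G.P (fb 0 k) (y i k) = y i k := fun i k => by
    simp only [hy]; rw [hc.mul_mul, P_mul, Finset.inter_self]
  have hyF : ∀ i k, F.P (fb 0 i) (y i k) = y i k := fun i k => by
    simp only [hy]; rw [P_mul, Finset.inter_self]
  have row := fun i => H₂ 0 (y i) (hyG i) (ENNReal.ne_top_of_tsum_ne_top hsum i)
  set z : ℕ → X := fun i => ∑' k, y i k with hz
  have hzF : ∀ i, F.P (fb 0 i) (z i) = z i := fun i => by
    simp only [hz]
    rw [(F.P (fb 0 i)).map_tsum (row i).1]; simp only [hyF]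
  have hzs : ∑' i, ‖z i‖ₑ ^ θ ≠ ⊤ := by
    refine ne_top_of_le_ne_top (ENNReal.mul_ne_top (a := ENNReal.ofReal C₂) ENNReal.ofReal_ne_top hsum) ?_
    rw [← ENNReal.tsum_mul_left]
    exact ENNReal.tsum_le_tsum fun i => (row i).2
  obtain ⟨hs, -⟩ := H₁ 0 z hzF hzs
  have hF0g : F.S 0 (∑' i, z i) = 0 := S_zero_tsum hzF hs
  have hG0g : G.S 0 (∑' i, z i) = 0 := by
    rw [(G.S 0).map_tsum hs]
    exact (tsum_congr fun i => S_zero_tsum (hyG i) (row i).1).trans tsum_zero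
  refine ⟨∑' i, z i, fun m n => ?_, hF0g, hG0g⟩
  by_cases hm : m = 0
  · subst hm; rw [hc.S_S, hc.S_S, hF0g, hF0]; simp
  by_cases hn : n = 0
  · subst hn; rw [hG0g, hG0]; simp
  obtain ⟨i, hi⟩ := exists_mem_fb 0 hm
  obtain ⟨k, hk⟩ := exists_mem_fb 0 hn
  rw [hc.S_S, S_tsum hzF hs hi, ← hc.S_S, S_tsum (hyG i) (row i).1 hk]
  simp only [hy]
  rw [← hc.mul_S, G.S_mul, if_pos hk, F.S_mul, if_pos hi, map_smul, smul_smul]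

end IsoFlow

theorem scaleKernel_le (r β : ℝ) (a i : ℕ) : ENNReal.ofReal (scaleKernel r β a i) ≤
    ∑' j : ℕ, ((if i = a + j then ENNReal.ofReal (((2 : ℝ) ^ (-r)) ^ j) else 0) +
      if a = i + j then ENNReal.ofReal (((2 : ℝ) ^ (-β)) ^ j) else 0) := by
  unfold scaleKernel
  split_ifs with h
  · refine le_trans ?_ (ENNReal.le_tsum (i - a))
    rw [if_pos (by omega)]
    exact le_self_add
  · refine le_trans ?_ (ENNReal.le_tsum (a - i))
    rw [if_pos (by omega : a = i + (a - i))]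
    exact le_add_self

theorem exists_tsum_scaleKernel_le {r β : ℝ} (hr : 0 < r) (hβ : 0 < β) :
    ∃ M : ℝ, 0 < M ∧ (∀ a, ∑' i, ENNReal.ofReal (scaleKernel r β a i) ≤ ENNReal.ofReal M) ∧
      ∀ i, ∑' a, ENNReal.ofReal (scaleKernel r β a i) ≤ ENNReal.ofReal M := by
  have geo : ∀ {q : ℝ}, 0 < q → Summable fun j : ℕ => ((2 : ℝ) ^ (-q)) ^ j := fun hq =>
    summable_geometric_of_lt_one (by positivity) (Real.rpow_lt_one_of_one_lt_of_neg (by norm_num)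
      (by linarith))
  have e : ∀ {q : ℝ}, 0 < q → ∑' j : ℕ, ENNReal.ofReal (((2 : ℝ) ^ (-q)) ^ j) =
      ENNReal.ofReal (∑' j : ℕ, ((2 : ℝ) ^ (-q)) ^ j) := fun hq =>
    (ENNReal.ofReal_tsum_of_nonneg (fun _ => by positivity) (geo hq)).symm
  have pos : ∀ {q : ℝ}, 0 < q → 0 < ∑' j : ℕ, ((2 : ℝ) ^ (-q)) ^ j := fun hq =>
    (geo hq).tsum_pos (fun _ => by positivity) 0 (by positivity)
  have one : ∀ (p : ℕ → Prop) [DecidablePred p] (c : ℝ≥0∞), (∀ x y, p x → p y → x = y) →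
      ∑' x, (if p x then c else 0) ≤ c := by
    intro p _ c hp
    by_cases hex : ∃ x, p x
    · obtain ⟨x, hx⟩ := hex
      rw [tsum_eq_single x fun y hy => if_neg fun hpy => hy (hp y x hpy hx), if_pos hx]
    · push Not at hex
      simp [hex]
  refine ⟨(∑' j : ℕ, ((2 : ℝ) ^ (-r)) ^ j) + ∑' j : ℕ, ((2 : ℝ) ^ (-β)) ^ j,
    add_pos (pos hr) (pos hβ), fun a => ?_, fun i => ?_⟩
  · refine (ENNReal.tsum_le_tsum fun i => scaleKernel_le r β a i).trans ?_
    rw [ENNReal.tsum_comm, ENNReal.ofReal_add (pos hr).le (pos hβ).le, ← e hr, ← e hβ,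
      ← ENNReal.tsum_add]
    refine ENNReal.tsum_le_tsum fun j => ?_
    rw [ENNReal.tsum_add]
    exact add_le_add (one (fun i => i = a + j) _ (by omega)) (one (fun i => a = i + j) _ (by omega))
  · refine (ENNReal.tsum_le_tsum fun a => scaleKernel_le r β a i).trans ?_
    rw [ENNReal.tsum_comm, ENNReal.ofReal_add (pos hr).le (pos hβ).le, ← e hr, ← e hβ,
      ← ENNReal.tsum_add]
    refine ENNReal.tsum_le_tsum fun j => ?_
    rw [ENNReal.tsum_add]
    exact add_le_add (one (fun a => i = a + j) _ (by omega)) (one (fun a => a = i + j) _ (by omega))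

namespace IsoFlow

variable {X : Type*} [NormedAddCommGroup X] [NormedSpace ℂ X] {F G : IsoFlow X} [CompleteSpace X]

variable (F) in
/-- The operator `L` is controlled by the modulus of smoothness at scale `2^{-n}`. -/
def Ctrl (β : ℝ) (n : ℕ) (c : ℝ) (L : X →L[ℂ] X) : Prop :=
  ∀ (x : X) (w : ℝ), (∀ h, |h| ≤ (2 : ℝ)⁻¹ ^ n → ‖F.diff β h x‖ ≤ w) → ‖L x‖ ≤ c * w

theorem RieszBound.ctrl_Z {R : ℝ} (hR : F.RieszBound R) {β : ℝ} (hβ : 0 < β) (n : ℕ) :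
    F.Ctrl β n (4 * R) (F.Z β n 0) := by
  intro x w hw
  have hR0 := hR.1
  have h1 := hw _ (le_of_eq (abs_of_pos (by positivity)))
  have h2 := hR.norm_P_le (B := 2 ^ (n + 0)) (fb_lo_pos n 0) (F.diff β ((2 : ℝ)⁻¹ ^ n) x)
  rw [← fb] at h2
  have h3 : F.Z β n 0 x = F.P (fb n 0) (F.diff β ((2 : ℝ)⁻¹ ^ n) x) := by
    rw [Z, if_pos rfl, ContinuousLinearMap.comp_apply, P, diff_mul _ hβ, mul_diff _ hβ]
  rw [h3]
  exact h2.trans (by gcongr)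

theorem RieszBound.exists_ctrl {R : ℝ} (hR : F.RieszBound R) {β : ℝ} (hβ : 0 < β) :
    ∃ C : ℝ, 0 < C ∧ ∀ n, F.Ctrl β n C (F.Z β n 0) ∧ ∀ N, F.Ctrl β n C (F.P (blk (2 ^ n) (2 ^ N))) := by
  obtain ⟨C, hC, H⟩ := hR.exists_jackson hβ
  refine ⟨max C (4 * R), lt_max_of_lt_left hC, fun n => ⟨fun x w hw => ?_, fun N x w hw => ?_⟩⟩
  · have hw0 : 0 ≤ w := (norm_nonneg _).trans (hw 0 (by rw [abs_zero]; positivity))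
    exact (hR.ctrl_Z hβ n x w hw).trans (by gcongr; exact le_max_right _ _)
  · have hw0 : 0 ≤ w := (norm_nonneg _).trans (hw 0 (by rw [abs_zero]; positivity))
    exact (H n N x w hw).trans (by gcongr; exact le_max_left _ _)

theorem Ctrl.comp (hc : F.Comm G) {β₁ β₂ : ℝ} (hβ₁ : 0 < β₁) (hβ₂ : 0 < β₂) {n₁ n₂ : ℕ} {c₁ c₂ : ℝ}
    {L L' : X →L[ℂ] X} (hL : F.Ctrl β₁ n₁ c₁ L) (hL' : G.Ctrl β₂ n₂ c₂ L')
    (hcomm : ∀ t x, L' (F.T t x) = F.T t (L' x)) {g : X} {w : ℝ}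
    (hw : ∀ h₁ h₂, |h₁| ≤ (2 : ℝ)⁻¹ ^ n₁ → |h₂| ≤ (2 : ℝ)⁻¹ ^ n₂ →
      ‖F.diff β₁ h₁ (G.diff β₂ h₂ g)‖ ≤ w) : ‖L (L' g)‖ ≤ c₁ * (c₂ * w) := by
  refine hL _ _ fun h₁ hh₁ => ?_
  rw [← F.comm_diff L' hcomm hβ₁]
  refine hL' _ _ fun h₂ hh₂ => ?_
  rw [← hc.diff_diff hβ₁ hβ₂]
  exact hw h₁ h₂ hh₁ hh₂

/-- The square function of `g` with bands measured by `Z` is bounded by its modulus. -/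
theorem exists_sum_Z_Z_rpow_le {R₁ R₂ β₁ β₂ τ C₁ C₂ : ℝ} (hc : F.Comm G) (hF : F.RieszBound R₁)
    (hG : G.RieszBound R₂) (hβ₁ : 0 < β₁) (hβ₂ : 0 < β₂) (hτ : 0 < τ)
    (hC₁ : 0 < C₁) (H₁ : ∀ (n N : ℕ) (x : X),
      ∑ i ∈ Finset.range N, ‖F.P (fb n i) x‖ ^ τ ≤ C₁ * ‖x‖ ^ τ)
    (hC₂ : 0 < C₂) (H₂ : ∀ (n N : ℕ) (x : X),
      ∑ i ∈ Finset.range N, ‖G.P (fb n i) x‖ ^ τ ≤ C₂ * ‖x‖ ^ τ) :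
    ∃ C : ℝ, 0 < C ∧ ∀ (n₁ n₂ : ℕ) (g : X) (w : ℝ),
      (∀ h₁ h₂, |h₁| ≤ (2 : ℝ)⁻¹ ^ n₁ → |h₂| ≤ (2 : ℝ)⁻¹ ^ n₂ →
        ‖F.diff β₁ h₁ (G.diff β₂ h₂ g)‖ ≤ w) →
      ∑' q : ℕ × ℕ, ‖F.Z β₁ n₁ q.1 (G.Z β₂ n₂ q.2 g)‖ₑ ^ τ ≤
        ENNReal.ofReal C * ENNReal.ofReal w ^ τ := by
  obtain ⟨D₁, hD₁, K₁⟩ := hF.exists_ctrl hβ₁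
  obtain ⟨D₂, hD₂, K₂⟩ := hG.exists_ctrl hβ₂
  refine ⟨(1 + C₁) * (1 + C₂) * (D₁ * D₂) ^ τ, by positivity, fun n₁ n₂ g w hw => ?_⟩
  have hw0 : 0 ≤ w := (norm_nonneg _).trans
    (hw 0 0 (by rw [abs_zero]; positivity) (by rw [abs_zero]; positivity))
  rw [ENNReal.tsum_eq_iSup_sum]
  refine iSup_le fun s => ?_
  obtain ⟨N, hN⟩ : ∃ N, s ⊆ Finset.range (N + 1) ×ˢ Finset.range (N + 1) := by
    obtain ⟨a, ha⟩ := (s.image Prod.fst).exists_nat_subset_range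
    obtain ⟨b, hb⟩ := (s.image Prod.snd).exists_nat_subset_range
    refine ⟨a + b, fun q hq => ?_⟩
    have h1 := ha (Finset.mem_image_of_mem _ hq)
    have h2 := hb (Finset.mem_image_of_mem _ hq)
    simp only [Finset.mem_range] at h1 h2
    simp only [Finset.mem_product, Finset.mem_range]
    omega
  set E := ENNReal.ofReal ((D₁ * D₂) ^ τ) * ENNReal.ofReal w ^ τ with hE
  have key : ∀ {L L' : X →L[ℂ] X}, F.Ctrl β₁ n₁ D₁ L → G.Ctrl β₂ n₂ D₂ L' →
      (∀ t x, L' (F.T t x) = F.T t (L' x)) → ‖L (L' g)‖ₑ ^ τ ≤ E := by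
    intro L L' h h' hcomm
    have h1 := Ctrl.comp hc hβ₁ hβ₂ h h' hcomm hw
    rw [hE, ENNReal.ofReal_rpow_of_nonneg hw0 hτ.le, ← ENNReal.ofReal_mul (by positivity),
      ← Real.mul_rpow (by positivity) hw0, ← ENNReal.ofReal_rpow_of_nonneg (by positivity) hτ.le,
      ← ofReal_norm]
    exact ENNReal.rpow_le_rpow (ENNReal.ofReal_le_ofReal (by linarith)) hτ.le
  set HF := F.P (blk (2 ^ n₁) (2 ^ (n₁ + N)))
  set HG := G.P (blk (2 ^ n₂) (2 ^ (n₂ + N))) with hHG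
  have cHG : ∀ t x, HG (F.T t x) = F.T t (HG x) := fun t x => hc.symm.mul_T _ _ t x
  have cZG : ∀ t x, G.Z β₂ n₂ 0 (F.T t x) = F.T t (G.Z β₂ n₂ 0 x) := fun t x =>
    hc.symm.Z_T hβ₂ _ _ t x
  have sumF : ∀ L' : X →L[ℂ] X, G.Ctrl β₂ n₂ D₂ L' → (∀ t x, L' (F.T t x) = F.T t (L' x)) →
      ∑ i ∈ Finset.range (N + 1), ‖F.Z β₁ n₁ i (L' g)‖ₑ ^ τ ≤ E + ENNReal.ofReal C₁ * E := by
    intro L' h' hcomm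
    refine (exists_sum_Z_rpow_le hτ hC₁ H₁ β₁ n₁ N _).trans ?_
    gcongr
    · exact key (K₁ n₁).1 h' hcomm
    · exact key ((K₁ n₁).2 _) h' hcomm
  calc _ ≤ ∑ q ∈ Finset.range (N + 1) ×ˢ Finset.range (N + 1),
        ‖F.Z β₁ n₁ q.1 (G.Z β₂ n₂ q.2 g)‖ₑ ^ τ := Finset.sum_le_sum_of_subset hN
    _ = ∑ i ∈ Finset.range (N + 1), ∑ k ∈ Finset.range (N + 1),
        ‖G.Z β₂ n₂ k (F.Z β₁ n₁ i g)‖ₑ ^ τ := by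
        rw [Finset.sum_product]
        simp only [hc.Z_Z hβ₁ hβ₂]
    _ ≤ ∑ i ∈ Finset.range (N + 1), (‖F.Z β₁ n₁ i (G.Z β₂ n₂ 0 g)‖ₑ ^ τ +
          ENNReal.ofReal C₂ * ‖F.Z β₁ n₁ i (HG g)‖ₑ ^ τ) := by
        refine Finset.sum_le_sum fun i _ => ?_
        rw [hc.Z_Z hβ₁ hβ₂, hHG, P, hc.Z_mul hβ₁, ← P]
        exact exists_sum_Z_rpow_le hτ hC₂ H₂ β₂ n₂ N _
    _ ≤ (E + ENNReal.ofReal C₁ * E) + ENNReal.ofReal C₂ * (E + ENNReal.ofReal C₁ * E) := by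
        rw [Finset.sum_add_distrib, ← Finset.mul_sum]
        gcongr
        · exact sumF _ (K₂ n₂).1 cZG
        · exact sumF _ ((K₂ n₂).2 _) cHG
    _ = _ := by
        rw [ENNReal.ofReal_mul (by positivity), ENNReal.ofReal_mul (by positivity),
          ENNReal.ofReal_add zero_le_one hC₁.le, ENNReal.ofReal_add zero_le_one hC₂.le, hE]
        simp only [ENNReal.ofReal_one]
        ring

theorem exists_norm_diff_integral_le₂ {R₁ R₂ r₁ r₂ β₁ β₂ : ℝ} (hc : F.Comm G) (hF : F.RieszBound R₁)
    (hG : G.RieszBound R₂) (hr₁ : 0 < r₁) (hr₂ : 0 < r₂) (hβ₁ : 0 < β₁) (hβ₂ : 0 < β₂) :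
    ∃ C : ℝ, 0 < C ∧ ∀ (n₁ n₂ a b i k : ℕ) (h₁ h₂ : ℝ) (g : X), |h₁| ≤ 2 * (2 : ℝ)⁻¹ ^ (n₁ + a) →
      |h₂| ≤ 2 * (2 : ℝ)⁻¹ ^ (n₂ + b) →
      ENNReal.ofReal (((2 : ℝ) ^ r₁) ^ (n₁ + a) * ((2 : ℝ) ^ r₂) ^ (n₂ + b)) *
      ‖F.mul (fb n₁ i) (fun m => diffSymbol (r₁ + β₁) (m * h₁) * (Complex.I * m) ^ ((-r₁ : ℝ) : ℂ))
        (G.mul (fb n₂ k) (fun m => diffSymbol (r₂ + β₂) (m * h₂) *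
          (Complex.I * m) ^ ((-r₂ : ℝ) : ℂ)) g)‖ₑ ≤
      ENNReal.ofReal C * (ENNReal.ofReal (scaleKernel r₁ β₁ a i) *
        ENNReal.ofReal (scaleKernel r₂ β₂ b k) * ‖F.Z β₁ n₁ i (G.Z β₂ n₂ k g)‖ₑ) := by
  obtain ⟨C₁, hC₁, H₁⟩ := hF.exists_norm_diff_integral_le hr₁ hβ₁
  obtain ⟨C₂, hC₂, H₂⟩ := hG.exists_norm_diff_integral_le hr₂ hβ₂
  refine ⟨C₁ * C₂, by positivity, fun n₁ n₂ a b i k h₁ h₂ g hh₁ hh₂ => ?_⟩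
  have h1 := H₁ n₁ a i h₁ (G.mul (fb n₂ k) (fun m => diffSymbol (r₂ + β₂) (m * h₂) *
          (Complex.I * m) ^ ((-r₂ : ℝ) : ℂ)) g) hh₁
  rw [hc.Z_mul hβ₁] at h1
  have h2 := H₂ n₂ b k h₂ (F.Z β₁ n₁ i g) hh₂
  rw [← hc.Z_Z hβ₁ hβ₂] at h2
  have k1 := scaleKernel_nonneg r₁ β₁ a i
  have k2 := scaleKernel_nonneg r₂ β₂ b k
  have e : ∀ (r : ℝ) (n : ℕ), ((2 : ℝ) ^ r) ^ n * ((2 : ℝ) ^ (-r)) ^ n = 1 := fun r n => by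
    rw [← mul_pow, ← Real.rpow_add (by norm_num)]; simp
  rw [← ofReal_norm, ← ofReal_norm, ← ENNReal.ofReal_mul (by positivity),
    ← ENNReal.ofReal_mul (by positivity), ← ENNReal.ofReal_mul (by positivity),
    ← ENNReal.ofReal_mul (by positivity)]
  refine ENNReal.ofReal_le_ofReal ((mul_le_mul_of_nonneg_left h1 (by positivity)).trans ?_)
  calc _ ≤ ((2 : ℝ) ^ r₁) ^ (n₁ + a) * ((2 : ℝ) ^ r₂) ^ (n₂ + b) *
        (C₁ * ((2 : ℝ) ^ (-r₁)) ^ (n₁ + a) * scaleKernel r₁ β₁ a i *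
          (C₂ * ((2 : ℝ) ^ (-r₂)) ^ (n₂ + b) * scaleKernel r₂ β₂ b k *
            ‖F.Z β₁ n₁ i (G.Z β₂ n₂ k g)‖)) := by gcongr
    _ = (((2 : ℝ) ^ r₁) ^ (n₁ + a) * ((2 : ℝ) ^ (-r₁)) ^ (n₁ + a)) *
        (((2 : ℝ) ^ r₂) ^ (n₂ + b) * ((2 : ℝ) ^ (-r₂)) ^ (n₂ + b)) *
        (C₁ * C₂ * (scaleKernel r₁ β₁ a i * scaleKernel r₂ β₂ b k *
          ‖F.Z β₁ n₁ i (G.Z β₂ n₂ k g)‖)) := by ring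
    _ = _ := by rw [e, e, one_mul, one_mul]

/-- Lower estimate of the differences of a mixed derivative. -/
theorem exists_tsum_diff_integral_rpow_le {R₁ R₂ r₁ r₂ β₁ β₂ τ C₁ C₂ : ℝ} (hc : F.Comm G)
    (hF : F.RieszBound R₁) (hG : G.RieszBound R₂) (hr₁ : 0 < r₁) (hr₂ : 0 < r₂)
    (hβ₁ : 0 < β₁) (hβ₂ : 0 < β₂) (hτ : 1 ≤ τ)
    (hC₁ : 0 < C₁) (H₁ : ∀ (n N : ℕ) (x : X),
      ∑ i ∈ Finset.range N, ‖F.P (fb n i) x‖ ^ τ ≤ C₁ * ‖x‖ ^ τ)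
    (hC₂ : 0 < C₂) (H₂ : ∀ (n N : ℕ) (x : X),
      ∑ i ∈ Finset.range N, ‖G.P (fb n i) x‖ ^ τ ≤ C₂ * ‖x‖ ^ τ) :
    ∃ C : ℝ, 0 < C ∧ ∀ (n₁ n₂ : ℕ) (f g : X) (w : ℝ), IsDeriv F G r₁ r₂ f g →
      F.S 0 f = 0 → G.S 0 f = 0 →
      (∀ h₁ h₂, |h₁| ≤ (2 : ℝ)⁻¹ ^ n₁ → |h₂| ≤ (2 : ℝ)⁻¹ ^ n₂ →
        ‖F.diff β₁ h₁ (G.diff β₂ h₂ g)‖ ≤ w) →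
      ∑' q : ℕ × ℕ, (ENNReal.ofReal (((2 : ℝ) ^ r₁) ^ (n₁ + q.1) * ((2 : ℝ) ^ r₂) ^ (n₂ + q.2)) *
        ⨆ (h₁ : ℝ) (_ : |h₁| ≤ 2 * (2 : ℝ)⁻¹ ^ (n₁ + q.1)) (h₂ : ℝ)
          (_ : |h₂| ≤ 2 * (2 : ℝ)⁻¹ ^ (n₂ + q.2)),
          ‖F.diff (r₁ + β₁) h₁ (G.diff (r₂ + β₂) h₂ f)‖ₑ) ^ τ ≤
        ENNReal.ofReal C * ENNReal.ofReal w ^ τ := by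
  obtain ⟨C, hC, H⟩ := exists_norm_diff_integral_le₂ hc hF hG hr₁ hr₂ hβ₁ hβ₂
  obtain ⟨D, hD, H'⟩ := exists_sum_Z_Z_rpow_le hc hF hG hβ₁ hβ₂ (by linarith) hC₁ H₁ hC₂ H₂
  obtain ⟨M₁, hM₁, hM₁a, hM₁b⟩ := exists_tsum_scaleKernel_le hr₁ hβ₁
  obtain ⟨M₂, hM₂, hM₂a, hM₂b⟩ := exists_tsum_scaleKernel_le hr₂ hβ₂
  have hτ0 : 0 ≤ τ := by linarith
  refine ⟨C ^ τ * (M₁ * M₂) ^ τ * D, by positivity, fun n₁ n₂ f g w hfg hF0 hG0 hw => ?_⟩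
  have hα₁ : 0 < r₁ + β₁ := by positivity
  have hα₂ : 0 < r₂ + β₂ := by positivity
  set k : ℕ × ℕ → ℕ × ℕ → ℝ≥0∞ := fun p q => ENNReal.ofReal (scaleKernel r₁ β₁ p.1 q.1) *
        ENNReal.ofReal (scaleKernel r₂ β₂ p.2 q.2) with hk
  set y : ℕ × ℕ → ℝ≥0∞ := fun q => ‖F.Z β₁ n₁ q.1 (G.Z β₂ n₂ q.2 g)‖ₑ with hy
  have bound : ∀ p : ℕ × ℕ, ENNReal.ofReal (((2 : ℝ) ^ r₁) ^ (n₁ + p.1) * ((2 : ℝ) ^ r₂) ^ (n₂ + p.2)) *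
        (⨆ (h₁ : ℝ) (_ : |h₁| ≤ 2 * (2 : ℝ)⁻¹ ^ (n₁ + p.1)) (h₂ : ℝ)
          (_ : |h₂| ≤ 2 * (2 : ℝ)⁻¹ ^ (n₂ + p.2)),
          ‖F.diff (r₁ + β₁) h₁ (G.diff (r₂ + β₂) h₂ f)‖ₑ) ≤
        ENNReal.ofReal C * ∑' q, k p q * y q := by
    rintro ⟨a, b⟩
    simp only [ENNReal.mul_iSup]
    refine iSup₂_le fun h₁ hh₁ => iSup₂_le fun h₂ hh₂ => ?_
    set u := F.diff (r₁ + β₁) h₁ (G.diff (r₂ + β₂) h₂ f) with hu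
    have hSu : ∀ m n, F.S m (G.S n u) =
        (diffSymbol (r₁ + β₁) (m * h₁) * diffSymbol (r₂ + β₂) (n * h₂)) • F.S m (G.S n f) := by
      intro m n
      rw [hu, ← hc.diff_S hα₁, F.S_diff hα₁, G.S_diff hα₂, map_smul, smul_smul]
    have hF0u : F.S 0 u = 0 := G.ext_S fun n => by
      rw [← hc.S_S, hSu, hc.S_S, hF0]; simp
    have hG0u : G.S 0 u = 0 := F.ext_S fun n => by
      rw [hSu, hG0]; simp
    have inv : ∀ (r : ℝ) {m : ℤ}, m ≠ 0 →
        (Complex.I * m) ^ ((-r : ℝ) : ℂ) * (Complex.I * m) ^ (r : ℂ) = 1 := fun r m hm => by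
      have : Complex.I * m ≠ 0 := mul_ne_zero Complex.I_ne_zero (by exact_mod_cast hm)
      rw [← Complex.cpow_add _ _ this]; simp
    have hQ : ∀ i k, G.P (fb n₂ k) (F.P (fb n₁ i) u) =
        F.mul (fb n₁ i) (fun m => diffSymbol (r₁ + β₁) (m * h₁) * (Complex.I * m) ^ ((-r₁ : ℝ) : ℂ))
        (G.mul (fb n₂ k) (fun m => diffSymbol (r₂ + β₂) (m * h₂) *
          (Complex.I * m) ^ ((-r₂ : ℝ) : ℂ)) g) := by
      intro i k
      refine ext_S₂ F G fun m n => ?_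
      rw [P, P, G.S_mul, ← hc.mul_S, ← hc.mul_S, F.S_mul, G.S_mul]
      by_cases hn : n ∈ fb n₂ k
      · by_cases hm : m ∈ fb n₁ i
        · simp only [hn, hm, if_true, one_smul, map_smul, F.S_mul]
          rw [hSu, hfg m n, smul_smul, smul_smul]
          have hm0 : m ≠ 0 := fun h => zero_notMem_fb _ _ (h ▸ hm)
          have hn0 : n ≠ 0 := fun h => zero_notMem_fb _ _ (h ▸ hn)
          congr 1
          linear_combination (-diffSymbol (r₁ + β₁) (m * h₁) * diffSymbol (r₂ + β₂) (n * h₂)) *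
            (inv r₁ hm0 * ((Complex.I * n) ^ ((-r₂ : ℝ) : ℂ) * (Complex.I * n) ^ (r₂ : ℂ)) + inv r₂ hn0)
        · simp [hn, hm, F.S_mul]
      · simp [hn]
    calc _ ≤ ENNReal.ofReal (((2 : ℝ) ^ r₁) ^ (n₁ + a) * ((2 : ℝ) ^ r₂) ^ (n₂ + b)) *
          ∑' i, ∑' k, ‖G.P (fb n₂ k) (F.P (fb n₁ i) u)‖ₑ := by
          gcongr
          refine (F.enorm_le_tsum_P n₁ hF0u).trans (ENNReal.tsum_le_tsum fun i => ?_)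
          refine G.enorm_le_tsum_P n₂ ?_
          rw [P, ← hc.mul_S, hG0u, map_zero]
      _ = ∑' q : ℕ × ℕ, ENNReal.ofReal (((2 : ℝ) ^ r₁) ^ (n₁ + a) * ((2 : ℝ) ^ r₂) ^ (n₂ + b)) *
          ‖G.P (fb n₂ q.2) (F.P (fb n₁ q.1) u)‖ₑ := by
          rw [ENNReal.tsum_mul_left, ENNReal.tsum_prod']
      _ ≤ ∑' q : ℕ × ℕ, ENNReal.ofReal C * (k (a, b) q * y q) := by
          refine ENNReal.tsum_le_tsum fun q => ?_
          rw [hQ]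
          exact H n₁ n₂ a b q.1 q.2 h₁ h₂ g hh₁ hh₂
      _ = _ := ENNReal.tsum_mul_left
  have s1 : ∀ p, ∑' q, k p q ≤ ENNReal.ofReal (M₁ * M₂) := fun p => by
    rw [ENNReal.tsum_prod', ENNReal.ofReal_mul hM₁.le]
    simp only [hk, ENNReal.tsum_mul_left, ENNReal.tsum_mul_right]
    exact mul_le_mul' (hM₁a _) (hM₂a _)
  have s2 : ∀ q, ∑' p, k p q ≤ ENNReal.ofReal (M₁ * M₂) := fun p => by
    rw [ENNReal.tsum_prod', ENNReal.ofReal_mul hM₁.le]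
    simp only [hk, ENNReal.tsum_mul_left, ENNReal.tsum_mul_right]
    exact mul_le_mul' (hM₁b _) (hM₂b _)
  calc _ ≤ ∑' p, (ENNReal.ofReal C * ∑' q, k p q * y q) ^ τ :=
        ENNReal.tsum_le_tsum fun p => ENNReal.rpow_le_rpow (bound p) hτ0
    _ = ENNReal.ofReal C ^ τ * ∑' p, (∑' q, k p q * y q) ^ τ := by
        simp only [ENNReal.mul_rpow_of_nonneg (ENNReal.ofReal C) _ hτ0, ENNReal.tsum_mul_left]
    _ ≤ ENNReal.ofReal C ^ τ * (ENNReal.ofReal (M₁ * M₂) ^ τ *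
          (ENNReal.ofReal D * ENNReal.ofReal w ^ τ)) := by
        gcongr
        refine (ENNReal.tsum_rpow_tsum_mul_le hτ s1 s2).trans ?_
        gcongr
        exact H' n₁ n₂ g w hw
    _ = _ := by
        rw [ENNReal.ofReal_mul (p := C ^ τ * (M₁ * M₂) ^ τ) (by positivity),
          ENNReal.ofReal_mul (p := C ^ τ) (by positivity),
          ← ENNReal.ofReal_rpow_of_nonneg hC.le hτ0,
          ← ENNReal.ofReal_rpow_of_nonneg (by positivity) hτ0]
        ring

end IsoFlow

theorem half_pow_antitone {a b : ℕ} (h : a ≤ b) : (2 : ℝ)⁻¹ ^ b ≤ (2 : ℝ)⁻¹ ^ a :=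
  pow_le_pow_of_le_one (by norm_num) (by norm_num) h

theorem half_pow_rpow_neg_sub_one (ρ : ℝ) (k : ℕ) :
    ((2 : ℝ)⁻¹ ^ k) ^ (-ρ - 1) * (2 : ℝ)⁻¹ ^ k = ((2 : ℝ) ^ ρ) ^ k := by
  have : 0 < (2 : ℝ)⁻¹ ^ k := by positivity
  rw [Real.rpow_sub_one this.ne', div_mul_cancel₀ _ this.ne', half_pow_rpow_neg]

theorem tsum_le_lintegral {Ψ : ℝ → ℝ≥0∞} (hΨ : Monotone Ψ) {ρ : ℝ} (hρ : 0 < ρ) {n : ℕ} {δ : ℝ}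
    (hδ : (2 : ℝ)⁻¹ ^ n ≤ δ) :
    ∑' i : ℕ, ENNReal.ofReal (((2 : ℝ) ^ ρ) ^ (n + i)) * Ψ ((2 : ℝ)⁻¹ ^ (n + i + 1)) ≤
      2 * ∫⁻ t in Set.Ioo 0 δ, ENNReal.ofReal (t ^ (-ρ - 1)) * Ψ t := by
  set I : ℕ → Set ℝ := fun i => Set.Ioo ((2 : ℝ)⁻¹ ^ (n + i + 1)) ((2 : ℝ)⁻¹ ^ (n + i)) with hI
  have hdisj : Pairwise (Function.onFun Disjoint I) := by
    have key : ∀ i j, i < j → Disjoint (I i) (I j) := fun i j hij => by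
      rw [Set.disjoint_left]
      rintro t ht ht'
      have h3 : (2 : ℝ)⁻¹ ^ (n + j) ≤ (2 : ℝ)⁻¹ ^ (n + i + 1) := half_pow_antitone (by omega)
      have h1 : (2 : ℝ)⁻¹ ^ (n + i + 1) < t := ht.1
      have h2 : t < (2 : ℝ)⁻¹ ^ (n + j) := ht'.2
      linarith
    intro i j hij
    rcases lt_or_gt_of_ne hij with h | h
    · exact key i j h
    · exact (key j i h).symm
  have hsub : (⋃ i, I i) ⊆ Set.Ioo 0 δ := by
    refine Set.iUnion_subset fun i t ht => ⟨lt_trans (by positivity) ht.1, ht.2.trans_le ?_⟩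
    exact (half_pow_antitone (by omega)).trans hδ
  have piece : ∀ i, ENNReal.ofReal (((2 : ℝ) ^ ρ) ^ (n + i)) * Ψ ((2 : ℝ)⁻¹ ^ (n + i + 1)) ≤
      2 * ∫⁻ t in I i, ENNReal.ofReal (t ^ (-ρ - 1)) * Ψ t := by
    intro i
    have h1 : ∫⁻ _ in I i, ENNReal.ofReal (((2 : ℝ)⁻¹ ^ (n + i)) ^ (-ρ - 1)) *
        Ψ ((2 : ℝ)⁻¹ ^ (n + i + 1)) ≤ ∫⁻ t in I i, ENNReal.ofReal (t ^ (-ρ - 1)) * Ψ t := by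
      refine setLIntegral_mono' measurableSet_Ioo fun t ht => ?_
      have h0 : 0 < t := lt_trans (by positivity) ht.1
      exact mul_le_mul' (ENNReal.ofReal_le_ofReal
        (Real.rpow_le_rpow_of_nonpos h0 ht.2.le (by linarith))) (hΨ ht.1.le)
    rw [setLIntegral_const, Real.volume_Ioo] at h1
    refine le_trans (le_of_eq ?_) (mul_le_mul_right h1 2)
    have e : (2 : ℝ≥0∞) = ENNReal.ofReal 2 := by simp
    have e2 : (2 : ℝ)⁻¹ ^ (n + i) - (2 : ℝ)⁻¹ ^ (n + i + 1) = (2 : ℝ)⁻¹ ^ (n + i) / 2 := by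
      rw [pow_succ]; ring
    rw [mul_right_comm, ← mul_assoc, e, e2, ← ENNReal.ofReal_mul (by positivity),
      ← ENNReal.ofReal_mul (by positivity), ← half_pow_rpow_neg_sub_one ρ]
    congr 2; ring
  calc _ ≤ ∑' i, 2 * ∫⁻ t in I i, ENNReal.ofReal (t ^ (-ρ - 1)) * Ψ t := ENNReal.tsum_le_tsum piece
    _ = 2 * ∫⁻ t in ⋃ i, I i, ENNReal.ofReal (t ^ (-ρ - 1)) * Ψ t := by
      rw [ENNReal.tsum_mul_left, lintegral_iUnion (fun i => measurableSet_Ioo) hdisj]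
    _ ≤ _ := by gcongr

theorem lintegral_le_tsum {Ψ : ℝ → ℝ≥0∞} (hΨ : Monotone Ψ) {ρ : ℝ} (hρ : 0 < ρ) {n : ℕ} {δ : ℝ}
    (hδ : δ ≤ 2 * (2 : ℝ)⁻¹ ^ n) :
    ∫⁻ t in Set.Ioo 0 δ, ENNReal.ofReal (t ^ (-ρ - 1)) * Ψ t ≤
    ∑' i : ℕ, ENNReal.ofReal (((2 : ℝ) ^ ρ) ^ (n + i)) * Ψ (2 * (2 : ℝ)⁻¹ ^ (n + i)) := by
  set I : ℕ → Set ℝ := fun i => Set.Ioc ((2 : ℝ)⁻¹ ^ (n + i)) (2 * (2 : ℝ)⁻¹ ^ (n + i)) with hI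
  have hsub : Set.Ioo 0 δ ⊆ ⋃ i, I i := by
    intro t ht
    have hex : ∃ i : ℕ, (2 : ℝ)⁻¹ ^ (n + i) < t := by
      obtain ⟨i, hi⟩ := exists_pow_lt_of_lt_one ht.1 (by norm_num : (2 : ℝ)⁻¹ < 1)
      exact ⟨i, (half_pow_antitone (by omega)).trans_lt hi⟩
    classical
    refine Set.mem_iUnion.2 ⟨Nat.find hex, Nat.find_spec hex, ?_⟩
    rcases Nat.eq_zero_or_pos (Nat.find hex) with h0 | h0
    · rw [h0, add_zero]; exact ht.2.le.trans hδ
    · have := Nat.find_min hex (m := Nat.find hex - 1) (by omega)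
      rw [not_lt] at this
      refine this.trans (le_of_eq ?_)
      obtain ⟨j, hj⟩ : ∃ j, Nat.find hex = j + 1 := ⟨Nat.find hex - 1, by omega⟩
      rw [hj, Nat.add_sub_cancel, ← add_assoc, pow_succ]; ring
  refine (lintegral_mono_set hsub).trans ((lintegral_iUnion_le I _).trans
    (ENNReal.tsum_le_tsum fun i => ?_))
  have h1 : ∫⁻ t in I i, ENNReal.ofReal (t ^ (-ρ - 1)) * Ψ t ≤
      ∫⁻ _ in I i, ENNReal.ofReal (((2 : ℝ)⁻¹ ^ (n + i)) ^ (-ρ - 1)) * Ψ (2 * (2 : ℝ)⁻¹ ^ (n + i)) := by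
    refine setLIntegral_mono' measurableSet_Ioc fun t ht => ?_
    have h0 : 0 < (2 : ℝ)⁻¹ ^ (n + i) := by positivity
    exact mul_le_mul' (ENNReal.ofReal_le_ofReal
      (Real.rpow_le_rpow_of_nonpos h0 ht.1.le (by linarith))) (hΨ ht.2)
  refine h1.trans (le_of_eq ?_)
  rw [setLIntegral_const, Real.volume_Ioc, mul_right_comm, ← ENNReal.ofReal_mul (by positivity),
    ← half_pow_rpow_neg_sub_one ρ]
  congr 3; ring

section TwoDim

variable {Φ : ℝ → ℝ → ℝ≥0∞} {r₁ r₂ s δ₁ δ₂ : ℝ} {n₁ n₂ : ℕ}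

theorem lintegral_weight_eq (r₁ r₂ s δ₁ δ₂ : ℝ) (Φ : ℝ → ℝ → ℝ≥0∞) :
    ∫⁻ t₁ in Set.Ioo (0:ℝ) δ₁, ∫⁻ t₂ in Set.Ioo (0:ℝ) δ₂,
      ENNReal.ofReal (t₁ ^ (-r₁*s-1) * t₂ ^ (-r₂*s-1)) * Φ t₁ t₂ =
    ∫⁻ t₁ in Set.Ioo (0:ℝ) δ₁, ENNReal.ofReal (t₁ ^ (-(r₁*s)-1)) * ∫⁻ t₂ in Set.Ioo (0:ℝ) δ₂,
      ENNReal.ofReal (t₂ ^ (-(r₂*s)-1)) * Φ t₁ t₂ := by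
  refine setLIntegral_congr_fun measurableSet_Ioo fun t₁ ht₁ => ?_
  rw [← lintegral_const_mul' _ _ ENNReal.ofReal_ne_top]
  refine setLIntegral_congr_fun measurableSet_Ioo fun t₂ _ => ?_
  rw [ENNReal.ofReal_mul (Real.rpow_nonneg ht₁.1.le _), mul_assoc, neg_mul, neg_mul]

theorem weight_rpow (hs : 0 < s) (k₁ k₂ : ℕ) (v : ℝ≥0∞) :
    (ENNReal.ofReal (((2 : ℝ) ^ r₁) ^ k₁ * ((2 : ℝ) ^ r₂) ^ k₂) * v) ^ s =
      ENNReal.ofReal (((2 : ℝ) ^ (r₁ * s)) ^ k₁) *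
        (ENNReal.ofReal (((2 : ℝ) ^ (r₂ * s)) ^ k₂) * v ^ s) := by
  have e : ∀ (r : ℝ) (k : ℕ), (((2 : ℝ) ^ r) ^ k) ^ s = ((2 : ℝ) ^ (r * s)) ^ k := fun r k => by
    have h2 : (0 : ℝ) ≤ 2 := by norm_num
    rw [← Real.rpow_natCast, ← Real.rpow_natCast, ← Real.rpow_mul h2, ← Real.rpow_mul h2,
      ← Real.rpow_mul h2]
    congr 1; ring
  rw [ENNReal.mul_rpow_of_nonneg _ _ hs.le, ENNReal.ofReal_rpow_of_nonneg (by positivity) hs.le,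
    Real.mul_rpow (by positivity) (by positivity), e, e, ENNReal.ofReal_mul (by positivity), mul_assoc]

theorem tsum_le_lintegral₂ (hΦ : ∀ {a a' b b'}, a ≤ a' → b ≤ b' → Φ a b ≤ Φ a' b')
    (hr₁ : 0 < r₁) (hr₂ : 0 < r₂) (hs : 0 < s) (hδ₁ : (2 : ℝ)⁻¹ ^ n₁ ≤ δ₁)
    (hδ₂ : (2 : ℝ)⁻¹ ^ n₂ ≤ δ₂) :
    ∑' i : ℕ, ∑' k : ℕ, (ENNReal.ofReal (((2 : ℝ) ^ r₁) ^ (n₁ + i) * ((2 : ℝ) ^ r₂) ^ (n₂ + k)) *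
        Φ ((2 : ℝ)⁻¹ ^ (n₁ + i + 1)) ((2 : ℝ)⁻¹ ^ (n₂ + k + 1))) ^ s ≤
      4 * ∫⁻ t₁ in Set.Ioo (0:ℝ) δ₁, ∫⁻ t₂ in Set.Ioo (0:ℝ) δ₂,
        ENNReal.ofReal (t₁ ^ (-r₁*s-1) * t₂ ^ (-r₂*s-1)) * Φ t₁ t₂ ^ s := by
  rw [lintegral_weight_eq]
  simp only [weight_rpow hs, ENNReal.tsum_mul_left]
  set Ψ : ℝ → ℝ≥0∞ := fun t₁ => ∫⁻ t₂ in Set.Ioo (0:ℝ) δ₂,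
      ENNReal.ofReal (t₂ ^ (-(r₂*s)-1)) * Φ t₁ t₂ ^ s with hΨ
  have hmono : Monotone Ψ := fun a b hab => lintegral_mono fun t =>
    mul_le_mul_right (ENNReal.rpow_le_rpow (hΦ hab le_rfl) hs.le) _
  calc _ ≤ ∑' i : ℕ, ENNReal.ofReal (((2 : ℝ) ^ (r₁ * s)) ^ (n₁ + i)) *
        (2 * Ψ ((2 : ℝ)⁻¹ ^ (n₁ + i + 1))) := by
        gcongr with i
        exact tsum_le_lintegral (Ψ := fun t => Φ ((2 : ℝ)⁻¹ ^ (n₁ + i + 1)) t ^ s)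
          (fun a b hab => ENNReal.rpow_le_rpow (hΦ le_rfl hab) hs.le) (by positivity) hδ₂
    _ = 2 * ∑' i : ℕ, ENNReal.ofReal (((2 : ℝ) ^ (r₁ * s)) ^ (n₁ + i)) *
        Ψ ((2 : ℝ)⁻¹ ^ (n₁ + i + 1)) := by
        rw [← ENNReal.tsum_mul_left]; simp only [mul_left_comm]
    _ ≤ 2 * (2 * ∫⁻ t₁ in Set.Ioo (0:ℝ) δ₁, ENNReal.ofReal (t₁ ^ (-(r₁*s)-1)) * Ψ t₁) := by
        gcongr
        exact tsum_le_lintegral hmono (by positivity) hδ₁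
    _ = _ := by rw [← mul_assoc, show (2 : ℝ≥0∞) * 2 = 4 by norm_num]

theorem lintegral_le_tsum₂ (hΦ : ∀ {a a' b b'}, a ≤ a' → b ≤ b' → Φ a b ≤ Φ a' b')
    (hr₁ : 0 < r₁) (hr₂ : 0 < r₂) (hs : 0 < s) (hδ₁ : δ₁ ≤ 2 * (2 : ℝ)⁻¹ ^ n₁)
    (hδ₂ : δ₂ ≤ 2 * (2 : ℝ)⁻¹ ^ n₂) :
    ∫⁻ t₁ in Set.Ioo (0:ℝ) δ₁, ∫⁻ t₂ in Set.Ioo (0:ℝ) δ₂,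
        ENNReal.ofReal (t₁ ^ (-r₁*s-1) * t₂ ^ (-r₂*s-1)) * Φ t₁ t₂ ^ s ≤
    ∑' q : ℕ × ℕ, (ENNReal.ofReal (((2 : ℝ) ^ r₁) ^ (n₁ + q.1) * ((2 : ℝ) ^ r₂) ^ (n₂ + q.2)) *
        Φ (2 * (2 : ℝ)⁻¹ ^ (n₁ + q.1)) (2 * (2 : ℝ)⁻¹ ^ (n₂ + q.2))) ^ s := by
  rw [lintegral_weight_eq, ENNReal.tsum_prod']
  simp only [weight_rpow hs, ENNReal.tsum_mul_left]
  set Ψ : ℝ → ℝ≥0∞ := fun t₁ => ∫⁻ t₂ in Set.Ioo (0:ℝ) δ₂,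
      ENNReal.ofReal (t₂ ^ (-(r₂*s)-1)) * Φ t₁ t₂ ^ s with hΨ
  have hmono : Monotone Ψ := fun a b hab => lintegral_mono fun t =>
    mul_le_mul_right (ENNReal.rpow_le_rpow (hΦ hab le_rfl) hs.le) _
  refine (lintegral_le_tsum hmono (by positivity) hδ₁).trans (ENNReal.tsum_le_tsum fun i => ?_)
  gcongr
  exact lintegral_le_tsum (Ψ := fun t => Φ (2 * (2 : ℝ)⁻¹ ^ (n₁ + i)) t ^ s)
    (fun a b hab => ENNReal.rpow_le_rpow (hΦ le_rfl hab) hs.le) (by positivity) hδ₂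

end TwoDim

theorem one_add_pow_le_quadratic {x : ℝ} (hx : |x| ≤ 1) (n : ℕ) :
    (1 + x) ^ n ≤ 1 + n * x + 4 ^ n * x ^ 2 := by
  obtain ⟨h1, h2⟩ := abs_le.1 hx
  induction n with
  | zero => simp; positivity
  | succ n ih =>
    have h3 : (1 + x) ^ (n + 1) ≤ (1 + n * x + 4 ^ n * x ^ 2) * (1 + x) := by
      rw [pow_succ]; exact mul_le_mul_of_nonneg_right ih (by linarith)
    have h4 : (n : ℝ) ≤ 4 ^ n := by
      exact_mod_cast (Nat.lt_pow_self (by norm_num : 1 < 4)).le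
    have h5 : (4 : ℝ) ^ n * x ^ 2 * x ≤ 4 ^ n * x ^ 2 * 1 :=
      mul_le_mul_of_nonneg_left h2 (by positivity)
    have h6 : (n : ℝ) * x ^ 2 ≤ 4 ^ n * x ^ 2 := mul_le_mul_of_nonneg_right h4 (sq_nonneg x)
    have h7 : (0 : ℝ) ≤ 4 ^ n * x ^ 2 := by positivity
    have h8 : (4 : ℝ) ^ (n + 1) * x ^ 2 = 4 * (4 ^ n * x ^ 2) := by ring
    refine h3.trans ?_
    rw [h8]
    push_cast
    nlinarith

theorem half_add_rpow_le {x y r : ℝ} (hx : 0 ≤ x) (hy : 0 ≤ y) (hr : 1 ≤ r) :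
    ((x + y) / 2) ^ r ≤ (x ^ r + y ^ r) / 2 := by
  have := (convexOn_rpow hr).2 (Set.mem_Ici.2 hx) (Set.mem_Ici.2 hy)
    (show (0 : ℝ) ≤ 1/2 by norm_num) (show (0 : ℝ) ≤ 1/2 by norm_num) (by norm_num)
  simp only [smul_eq_mul] at this
  calc ((x + y) / 2) ^ r = (1/2 * x + 1/2 * y) ^ r := by congr 1; ring
    _ ≤ _ := this
    _ = _ := by ring

theorem half_add_rpow_ge {x y r : ℝ} (hx : 0 ≤ x) (hy : 0 ≤ y) (hr : 0 < r) (hr1 : r ≤ 1) :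
    (x ^ r + y ^ r) / 2 ≤ ((x + y) / 2) ^ r := by
  have h := half_add_rpow_le (rpow_nonneg hx r) (rpow_nonneg hy r) (one_le_inv_iff₀.2 ⟨hr, hr1⟩)
  rw [Real.rpow_rpow_inv hx hr.ne', Real.rpow_rpow_inv hy hr.ne'] at h
  have h0 : 0 ≤ (x ^ r + y ^ r) / 2 := by positivity
  have := Real.rpow_le_rpow (by positivity) h hr.le
  rwa [Real.rpow_inv_rpow h0 hr.ne'] at this

theorem add_rpow_add_sub_rpow_le {s d q : ℝ} (hd : |d| ≤ s) (hq : 1 ≤ q) {e : ℝ}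
    (he : d ^ 2 ≤ s * e) (he0 : 0 ≤ e) :
    (s + d) ^ q + (s - d) ^ q ≤ 2 * (s + 4 ^ ⌈q⌉₊ * e) ^ q := by
  obtain ⟨h1, h2⟩ := abs_le.1 hd
  have hs : 0 ≤ s := (abs_nonneg d).trans hd
  have ha : 0 ≤ s + d := by linarith
  have hb : 0 ≤ s - d := by linarith
  set n := ⌈q⌉₊ with hn
  have hqn : q ≤ n := Nat.le_ceil q
  have hn1 : 1 ≤ n := by
    have : (1 : ℝ) ≤ n := hq.trans hqn
    exact_mod_cast this
  have hW : 0 ≤ s + 4 ^ n * e := by positivity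
  have key : ((s + d) ^ n + (s - d) ^ n) / 2 ≤ (s + 4 ^ n * e) ^ n := by
    rcases hs.eq_or_lt with h0 | h0
    · have hd0 : d = 0 := by rw [← h0] at hd; exact abs_nonpos_iff.1 hd
      rw [← h0, hd0]
      simp only [add_zero, sub_zero, zero_add, zero_pow (show n ≠ 0 by omega), zero_div]
      positivity
    · have hx : |d / s| ≤ 1 := by rw [abs_div, abs_of_pos h0, div_le_one h0]; exact hd
      have e1 := one_add_pow_le_quadratic hx n
      have e2 := one_add_pow_le_quadratic (x := -(d / s)) (by rwa [abs_neg]) n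
      have f1 : (s + d) ^ n = s ^ n * (1 + d / s) ^ n := by
        rw [← mul_pow]; congr 1; field_simp
      have f2 : (s - d) ^ n = s ^ n * (1 + -(d / s)) ^ n := by
        rw [← mul_pow]; congr 1; field_simp; ring
      have f3 : 1 + 4 ^ n * (d / s) ^ 2 ≤ (1 + 4 ^ n * (d / s) ^ 2) ^ n :=
        le_self_pow₀ (by have : 0 ≤ 4 ^ n * (d / s) ^ 2 := by positivity
                         linarith) (by omega)
      have f4 : s * (1 + 4 ^ n * (d / s) ^ 2) ≤ s + 4 ^ n * e := by
        have : s * (4 ^ n * (d / s) ^ 2) = 4 ^ n * (d ^ 2 / s) := by field_simp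
        rw [mul_add, mul_one, this]
        gcongr
        rwa [div_le_iff₀ h0, mul_comm]
      calc ((s + d) ^ n + (s - d) ^ n) / 2 ≤ s ^ n * (1 + 4 ^ n * (d / s) ^ 2) := by
            rw [f1, f2, ← mul_add, mul_div_assoc]
            gcongr
            nlinarith
        _ ≤ s ^ n * (1 + 4 ^ n * (d / s) ^ 2) ^ n := by gcongr
        _ = (s * (1 + 4 ^ n * (d / s) ^ 2)) ^ n := by rw [mul_pow]
        _ ≤ _ := by gcongr
  have hr : 1 ≤ (n : ℝ) / q := by rw [le_div_iff₀ (by linarith)]; linarith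
  have h3 := half_add_rpow_le (rpow_nonneg ha q) (rpow_nonneg hb q) hr
  have hq0 : q ≠ 0 := by linarith
  rw [← Real.rpow_mul ha, ← Real.rpow_mul hb, mul_div_cancel₀ _ hq0, Real.rpow_natCast,
    Real.rpow_natCast] at h3
  have h4 := h3.trans key
  have h5 : ((s + d) ^ q + (s - d) ^ q) / 2 ≤ (s + 4 ^ n * e) ^ q := by
    have := Real.rpow_le_rpow (by positivity) h4 (show 0 ≤ q / n by positivity)
    have hn0 : (n : ℝ) ≠ 0 := by positivity
    rwa [← Real.rpow_mul (by positivity), ← Real.rpow_natCast, ← Real.rpow_mul hW,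
      show (n : ℝ) / q * (q / n) = 1 by field_simp, Real.rpow_one, mul_div_cancel₀ _ hn0] at this
  linarith

theorem norm_add_rpow_add_norm_sub_rpow_le {p : ℝ} (hp : 2 ≤ p) (a b : ℂ) :
    ‖a + b‖ ^ p + ‖a - b‖ ^ p ≤
      2 * (‖a‖ ^ 2 + (1 + 4 ^ (⌈p / 2⌉₊ + 1)) * ‖b‖ ^ 2) ^ (p / 2) := by
  have e1 : ∀ z : ℂ, ‖z‖ ^ p = (‖z‖ ^ 2) ^ (p / 2) := fun z => by
    rw [← Real.rpow_natCast, ← Real.rpow_mul (norm_nonneg z)]; congr 1; push_cast; ring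
  have e2 := norm_add_sq_real a b
  have e3 := norm_sub_sq_real a b
  have hi := abs_real_inner_le_norm a b
  have hd : |2 * inner ℝ a b| ≤ ‖a‖ ^ 2 + ‖b‖ ^ 2 := by
    rw [abs_mul, abs_two]
    nlinarith [sq_nonneg (‖a‖ - ‖b‖)]
  have hsq : (2 * inner ℝ a b) ^ 2 ≤ (‖a‖ ^ 2 + ‖b‖ ^ 2) * (4 * ‖b‖ ^ 2) := by
    have : (inner ℝ a b) ^ 2 ≤ (‖a‖ * ‖b‖) ^ 2 := sq_le_sq' (abs_le.1 hi).1 (abs_le.1 hi).2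
    nlinarith [sq_nonneg (‖b‖ ^ 2)]
  have := add_rpow_add_sub_rpow_le hd (show 1 ≤ p / 2 by linarith) hsq (by positivity)
  rw [e1, e1, e2, e3]
  convert this using 2
  · congr 1; ring
  · congr 1; ring
  · congr 1; ring

theorem norm_add_rpow_add_norm_sub_rpow_le' {p : ℝ} (hp : 1 < p) (hp2 : p ≤ 2) (a b : ℂ) :
    ‖a + b‖ ^ p + ‖a - b‖ ^ p ≤ 2 * ‖a‖ ^ p + 2 * ‖b‖ ^ p := by
  have e1 : ∀ z : ℂ, ‖z‖ ^ p = (‖z‖ ^ 2) ^ (p / 2) := fun z => by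
    rw [← Real.rpow_natCast, ← Real.rpow_mul (norm_nonneg z)]; congr 1; push_cast; ring
  have e2 := parallelogram_law_with_norm ℝ a b
  have h1 := half_add_rpow_ge (sq_nonneg ‖a + b‖) (sq_nonneg ‖a - b‖)
    (show 0 < p / 2 by linarith) (by linarith)
  have h2 : (‖a + b‖ ^ 2 + ‖a - b‖ ^ 2) / 2 = ‖a‖ ^ 2 + ‖b‖ ^ 2 := by nlinarith
  rw [h2] at h1
  have h3 := Real.rpow_add_le_add_rpow (sq_nonneg ‖a‖) (sq_nonneg ‖b‖)
    (show 0 ≤ p / 2 by linarith) (by linarith)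
  rw [e1 (a + b), e1 (a - b), e1 a, e1 b]
  linarith

section LpSmooth

variable {Ω : Type*} [MeasurableSpace Ω] {μ : Measure Ω} {p : ℝ}

theorem eLpNorm_ofReal_rpow (hp : 0 < p) (u : Ω → ℂ) :
    eLpNorm u (ENNReal.ofReal p) μ ^ p = ∫⁻ ω, ‖u ω‖ₑ ^ p ∂μ := by
  rw [eLpNorm_eq_lintegral_rpow_enorm_toReal (by simpa using hp) ENNReal.ofReal_ne_top,
    ENNReal.toReal_ofReal hp.le, ← ENNReal.rpow_mul, one_div, inv_mul_cancel₀ hp.ne', ENNReal.rpow_one]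

theorem Lp.enorm_rpow (hp : 0 < p) (u : Lp ℂ (ENNReal.ofReal p) μ) :
    ‖u‖ₑ ^ p = ∫⁻ ω, ‖u ω‖ₑ ^ p ∂μ := by
  rw [Lp.enorm_def, eLpNorm_ofReal_rpow hp]

theorem Lp.enorm_eq (hp : 0 < p) (u : Lp ℂ (ENNReal.ofReal p) μ) :
    ‖u‖ₑ = (∫⁻ ω, ‖u ω‖ₑ ^ p ∂μ) ^ (1 / p) := by
  rw [← Lp.enorm_rpow hp, one_div, ENNReal.rpow_rpow_inv hp.ne']

theorem enorm_rpow_eq_ofReal {E : Type*} [SeminormedAddCommGroup E] (hp : 0 ≤ p) (z : E) :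
    ‖z‖ₑ ^ p = ENNReal.ofReal (‖z‖ ^ p) := by
  rw [← ofReal_norm, ENNReal.ofReal_rpow_of_nonneg (norm_nonneg z) hp]

variable [Fact (1 ≤ ENNReal.ofReal p)]

theorem Lp.lintegral_add_sub (hp : 0 < p) (u v : Lp ℂ (ENNReal.ofReal p) μ) :
    ‖u + v‖ₑ ^ p + ‖u - v‖ₑ ^ p = ∫⁻ ω, (‖u ω + v ω‖ₑ ^ p + ‖u ω - v ω‖ₑ ^ p) ∂μ := by
  rw [lintegral_add_left', Lp.enorm_rpow hp, Lp.enorm_rpow hp]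
  · congr 1
    · refine lintegral_congr_ae ?_
      filter_upwards [Lp.coeFn_add u v] with ω h
      rw [h, Pi.add_apply]
    · refine lintegral_congr_ae ?_
      filter_upwards [Lp.coeFn_sub u v] with ω h
      rw [h, Pi.sub_apply]
  · exact ((Lp.aestronglyMeasurable u).add (Lp.aestronglyMeasurable v)).enorm.pow_const _

theorem smoothNorm_Lp_of_le_two (hp : 1 < p) (hp2 : p ≤ 2) :
    SmoothNorm (Lp ℂ (ENNReal.ofReal p) μ) p 2 where
  one_le := hp.le
  le_two := hp2
  nonneg := by norm_num
  le u v := by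
    have hp0 : 0 < p := by linarith
    have h : ‖u + v‖ₑ ^ p + ‖u - v‖ₑ ^ p ≤ 2 * ‖u‖ₑ ^ p + 2 * ‖v‖ₑ ^ p := by
      rw [Lp.lintegral_add_sub hp0, Lp.enorm_rpow hp0, Lp.enorm_rpow hp0,
        ← lintegral_const_mul' _ _ (by simp), ← lintegral_const_mul' _ _ (by simp),
        ← lintegral_add_left' (((Lp.aestronglyMeasurable u).enorm.pow_const _).const_mul _)]
      refine lintegral_mono fun ω => ?_
      have := norm_add_rpow_add_norm_sub_rpow_le' hp hp2 (u ω) (v ω)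
      have e : (2 : ℝ≥0∞) = ENNReal.ofReal 2 := by simp
      simp only [enorm_rpow_eq_ofReal hp0.le]
      rw [e, ← ENNReal.ofReal_mul (by norm_num), ← ENNReal.ofReal_mul (by norm_num),
        ← ENNReal.ofReal_add (by positivity) (by positivity),
        ← ENNReal.ofReal_add (by positivity) (by positivity)]
      exact ENNReal.ofReal_le_ofReal this
    have e : (2 : ℝ≥0∞) = ENNReal.ofReal 2 := by simp
    simp only [enorm_rpow_eq_ofReal hp0.le] at h
    rw [e, ← ENNReal.ofReal_mul (by norm_num), ← ENNReal.ofReal_mul (by norm_num),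
        ← ENNReal.ofReal_add (by positivity) (by positivity),
        ← ENNReal.ofReal_add (by positivity) (by positivity),
        ENNReal.ofReal_le_ofReal_iff (by positivity)] at h
    exact h

theorem smoothNorm_Lp_of_two_le (hp2 : 2 ≤ p) :
    SmoothNorm (Lp ℂ (ENNReal.ofReal p) μ) 2 (2 * (1 + 4 ^ (⌈p / 2⌉₊ + 1))) where
  one_le := by norm_num
  le_two := le_rfl
  nonneg := by positivity
  le u v := by
    have hp0 : 0 < p := by linarith
    set K : ℝ := 1 + 4 ^ (⌈p / 2⌉₊ + 1) with hK
    have hK0 : 0 ≤ K := by positivity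
    have hq : 1 ≤ p / 2 := by linarith
    have e : (2 : ℝ≥0∞) = ENNReal.ofReal 2 := by simp
    have h : ‖u + v‖ₑ ^ p + ‖u - v‖ₑ ^ p ≤
        2 * (‖u‖ₑ ^ (2 : ℝ) + ENNReal.ofReal K * ‖v‖ₑ ^ (2 : ℝ)) ^ (p / 2) := by
      have h1 := ENNReal.lintegral_Lp_add_le (μ := μ) (p := p / 2) (f := fun ω => ‖u ω‖ₑ ^ (2 : ℝ))
        (g := fun ω => ENNReal.ofReal K * ‖v ω‖ₑ ^ (2 : ℝ))
        ((Lp.aestronglyMeasurable u).enorm.pow_const _)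
        (((Lp.aestronglyMeasurable v).enorm.pow_const _).const_mul _) hq
      have hq0 : p / 2 ≠ 0 := by linarith
      have e1 : ∀ w : Lp ℂ (ENNReal.ofReal p) μ,
          (∫⁻ ω, (‖w ω‖ₑ ^ (2 : ℝ)) ^ (p / 2) ∂μ) ^ (1 / (p / 2)) = ‖w‖ₑ ^ (2 : ℝ) := fun w => by
        simp only [← ENNReal.rpow_mul, mul_div_cancel₀ p (two_ne_zero (α := ℝ))]
        rw [← Lp.enorm_rpow hp0, ← ENNReal.rpow_mul]
        congr 1; field_simp
      have e2 : (∫⁻ ω, (ENNReal.ofReal K * ‖v ω‖ₑ ^ (2 : ℝ)) ^ (p / 2) ∂μ) ^ (1 / (p / 2)) =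
          ENNReal.ofReal K * ‖v‖ₑ ^ (2 : ℝ) := by
        have hKt : ENNReal.ofReal K ^ (p / 2) ≠ ⊤ :=
          ENNReal.rpow_ne_top_of_nonneg (by linarith) ENNReal.ofReal_ne_top
        simp only [ENNReal.mul_rpow_of_nonneg _ _ (show 0 ≤ p / 2 by linarith)]
        rw [lintegral_const_mul' _ _ hKt, ENNReal.mul_rpow_of_nonneg _ _ (by positivity), e1,
          one_div, ENNReal.rpow_rpow_inv hq0]
      simp only [Pi.add_apply] at h1
      rw [e1, e2] at h1
      have h2 := ENNReal.rpow_le_rpow h1 (show 0 ≤ p / 2 by linarith)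
      rw [one_div, ENNReal.rpow_inv_rpow hq0] at h2
      refine le_trans ?_ (mul_le_mul_right h2 2)
      rw [Lp.lintegral_add_sub hp0, ← lintegral_const_mul' _ _ (by simp)]
      refine lintegral_mono fun ω => ?_
      have := norm_add_rpow_add_norm_sub_rpow_le hp2 (u ω) (v ω)
      simp only [enorm_rpow_eq_ofReal hp0.le, enorm_rpow_eq_ofReal zero_le_two, Real.rpow_two]
      rw [← ENNReal.ofReal_mul hK0, ← ENNReal.ofReal_add (by positivity) (by positivity),
        ← ENNReal.ofReal_add (by positivity) (by positivity),
        ENNReal.ofReal_rpow_of_nonneg (by positivity) (by positivity), e,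
        ← ENNReal.ofReal_mul (by norm_num)]
      exact ENNReal.ofReal_le_ofReal this
    have h' : ‖u + v‖ ^ p + ‖u - v‖ ^ p ≤ 2 * (‖u‖ ^ 2 + K * ‖v‖ ^ 2) ^ (p / 2) := by
      simp only [enorm_rpow_eq_ofReal hp0.le, enorm_rpow_eq_ofReal zero_le_two, Real.rpow_two] at h
      rwa [← ENNReal.ofReal_mul hK0, ← ENNReal.ofReal_add (by positivity) (by positivity),
        ← ENNReal.ofReal_add (by positivity) (by positivity),
        ENNReal.ofReal_rpow_of_nonneg (by positivity) (by positivity), e,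
        ← ENNReal.ofReal_mul (by norm_num), ENNReal.ofReal_le_ofReal_iff (by positivity)] at h
    have e3 : ∀ z : Lp ℂ (ENNReal.ofReal p) μ, ‖z‖ ^ p = (‖z‖ ^ 2) ^ (p / 2) := fun z => by
      rw [← Real.rpow_natCast, ← Real.rpow_mul (norm_nonneg z)]; congr 1; push_cast; ring
    have h3 := half_add_rpow_le (sq_nonneg ‖u + v‖) (sq_nonneg ‖u - v‖) hq
    rw [← e3, ← e3] at h3
    have h4 := h3.trans (show _ ≤ (‖u‖ ^ 2 + K * ‖v‖ ^ 2) ^ (p / 2) by linarith)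
    have h5 := (Real.rpow_le_rpow_iff (by positivity) (by positivity) (by linarith)).1 h4
    simp only [Real.rpow_two]
    linarith

theorem exists_smoothNorm_Lp (hp : 1 < p) :
    ∃ K, SmoothNorm (Lp ℂ (ENNReal.ofReal p) μ) (min 2 p) K := by
  rcases le_total p 2 with h | h
  · rw [min_eq_right h]; exact ⟨_, smoothNorm_Lp_of_le_two hp h⟩
  · rw [min_eq_left h]; exact ⟨_, smoothNorm_Lp_of_two_le h⟩

end LpSmooth

section Pairing

variable {Ω : Type*} [MeasurableSpace Ω] {μ : Measure Ω} {p q : ℝ}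

/-- The bilinear pairing `∫ u v` between `L_p` and `L_q`. -/
def lpPair (μ : Measure Ω) (hpq : p.HolderConjugate q) [Fact (1 ≤ ENNReal.ofReal p)]
    [Fact (1 ≤ ENNReal.ofReal q)] :
    Lp ℂ (ENNReal.ofReal p) μ →L[ℂ] Lp ℂ (ENNReal.ofReal q) μ →L[ℂ] ℂ :=
  have := hpq.ennrealOfReal
  (ContinuousLinearMap.mul ℂ ℂ).lpPairing μ (ENNReal.ofReal p) (ENNReal.ofReal q)

variable (hpq : p.HolderConjugate q) [Fact (1 ≤ ENNReal.ofReal p)] [Fact (1 ≤ ENNReal.ofReal q)]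

theorem lpPair_apply (u : Lp ℂ (ENNReal.ofReal p) μ) (v : Lp ℂ (ENNReal.ofReal q) μ) :
    lpPair μ hpq u v = ∫ ω, u ω * v ω ∂μ := by
  have := hpq.ennrealOfReal
  exact ContinuousLinearMap.lpPairing_eq_integral (ContinuousLinearMap.mul ℂ ℂ) u v

theorem norm_lpPair_le (u : Lp ℂ (ENNReal.ofReal p) μ) (v : Lp ℂ (ENNReal.ofReal q) μ) :
    ‖lpPair μ hpq u v‖ ≤ ‖u‖ * ‖v‖ := by
  have h1 : ‖lpPair μ hpq u v‖ₑ ≤ ‖u‖ₑ * ‖v‖ₑ := by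
    rw [lpPair_apply, Lp.enorm_eq hpq.pos, Lp.enorm_eq hpq.symm.pos]
    refine (enorm_integral_le_lintegral_enorm _).trans ?_
    simp only [enorm_mul]
    exact ENNReal.lintegral_mul_le_Lp_mul_Lq μ hpq (Lp.aestronglyMeasurable u).enorm
      (Lp.aestronglyMeasurable v).enorm
  rw [← ofReal_norm, ← ofReal_norm, ← ofReal_norm,
    ← ENNReal.ofReal_mul (norm_nonneg u)] at h1
  exact (ENNReal.ofReal_le_ofReal_iff (by positivity)).1 h1

theorem exists_norming_lpPair (u : Lp ℂ (ENNReal.ofReal p) μ) :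
    ∃ v : Lp ℂ (ENNReal.ofReal q) μ, ‖v‖ ≤ 1 ∧ lpPair μ hpq u v = ‖u‖ := by
  rcases eq_or_ne u 0 with rfl | hu
  · exact ⟨0, by simp, by simp⟩
  have hp := hpq.pos
  have hq := hpq.symm.pos
  have hp1 := hpq.lt
  set y : Ω → ℂ := fun ω => starRingEnd ℂ (u ω) * ((‖u ω‖ ^ (p - 2) : ℝ) : ℂ) with hy
  have hym : AEStronglyMeasurable y μ := by
    have hm := (Lp.aestronglyMeasurable u).aemeasurable
    refine AEMeasurable.aestronglyMeasurable ?_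
    exact (Complex.continuous_conj.measurable.comp_aemeasurable hm).mul
      (Complex.measurable_ofReal.comp_aemeasurable (hm.norm.pow_const _))
  have hyn : ∀ ω, ‖y ω‖ = ‖u ω‖ ^ (p - 1) := fun ω => by
    rw [hy]
    simp only [norm_mul, RCLike.norm_conj, Complex.norm_real, Real.norm_eq_abs]
    rw [abs_of_nonneg (by positivity)]
    rcases (norm_nonneg (u ω)).eq_or_lt with h | h
    · rw [← h, zero_mul, Real.zero_rpow (by linarith)]
    · nth_rewrite 1 [← Real.rpow_one ‖u ω‖]
      rw [← Real.rpow_add h]; congr 1; ring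
  have hyq : ∀ ω, ‖y ω‖ₑ ^ q = ‖u ω‖ₑ ^ p := fun ω => by
    rw [enorm_rpow_eq_ofReal hq.le, enorm_rpow_eq_ofReal hp.le, hyn,
      ← Real.rpow_mul (norm_nonneg _), hpq.sub_one_mul_conj]
  have hyN : eLpNorm y (ENNReal.ofReal q) μ ^ q = ‖u‖ₑ ^ p := by
    rw [eLpNorm_ofReal_rpow hq, Lp.enorm_rpow hp]
    simp only [hyq]
  have hyt : eLpNorm y (ENNReal.ofReal q) μ < ⊤ := by
    have : eLpNorm y (ENNReal.ofReal q) μ ^ q < ⊤ := by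
      rw [hyN]; exact ENNReal.rpow_lt_top_of_nonneg hp.le (by simp)
    exact (ENNReal.rpow_lt_top_iff_of_pos hq).1 this
  have hyL : MemLp y (ENNReal.ofReal q) μ := ⟨hym, hyt⟩
  have hu0 : 0 < ‖u‖ := norm_pos_iff.2 hu
  have hvn : ‖hyL.toLp y‖ = ‖u‖ ^ (p - 1) := by
    have h1 : ‖hyL.toLp y‖ₑ ^ q = ‖u‖ₑ ^ p := by
      rw [Lp.enorm_def, eLpNorm_congr_ae hyL.coeFn_toLp, hyN]
    rw [enorm_rpow_eq_ofReal hq.le, enorm_rpow_eq_ofReal hp.le,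
      ENNReal.ofReal_eq_ofReal_iff (by positivity) (by positivity)] at h1
    have h2 : ‖u‖ ^ p = (‖u‖ ^ (p - 1)) ^ q := by
      rw [← Real.rpow_mul (norm_nonneg _), hpq.sub_one_mul_conj]
    rw [h2] at h1
    exact (Real.rpow_left_inj (norm_nonneg _) (by positivity) hq.ne').1 h1
  refine ⟨(((‖u‖ ^ (p - 1))⁻¹ : ℝ) : ℂ) • hyL.toLp y, ?_, ?_⟩
  · rw [norm_smul, hvn, Complex.norm_real, Real.norm_of_nonneg (by positivity),
      inv_mul_cancel₀ (by positivity)]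
  · have hint : ∫ ω, u ω * hyL.toLp y ω ∂μ = ((‖u‖ ^ p : ℝ) : ℂ) := by
      have h1 : ∫ ω, u ω * hyL.toLp y ω ∂μ = ∫ ω, ((‖u ω‖ ^ p : ℝ) : ℂ) ∂μ := by
        refine integral_congr_ae ?_
        filter_upwards [hyL.coeFn_toLp] with ω h
        rw [h, hy]
        dsimp only
        rw [← mul_assoc, Complex.mul_conj, Complex.normSq_eq_norm_sq, ← Complex.ofReal_mul]
        congr 1
        rcases (norm_nonneg (u ω)).eq_or_lt with h | h
        · rw [← h, Real.zero_rpow hp.ne']; simp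
        · rw [← Real.rpow_natCast, ← Real.rpow_add h]; congr 1; push_cast; ring
      rw [h1, integral_complex_ofReal]
      congr 1
      rw [integral_eq_lintegral_of_nonneg_ae (Filter.Eventually.of_forall fun ω => by positivity)
        ((Lp.aestronglyMeasurable u).norm.aemeasurable.pow_const _).aestronglyMeasurable]
      simp only [← enorm_rpow_eq_ofReal hp.le]
      rw [← Lp.enorm_rpow hp, enorm_rpow_eq_ofReal hp.le, ENNReal.toReal_ofReal (by positivity)]
    rw [map_smul, lpPair_apply, hint, smul_eq_mul, ← Complex.ofReal_mul]
    congr 1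
    rw [← Real.rpow_neg hu0.le, ← Real.rpow_add hu0]
    conv_rhs => rw [← Real.rpow_one ‖u‖]
    congr 1; ring

end Pairing

/-- A continuous, measure preserving, `2 * π`-periodic flow on a compact space together with a
unimodular eigenfunction of frequency one. -/
structure CircleFlow (Ω : Type*) [TopologicalSpace Ω] [MeasurableSpace Ω] (μ : Measure Ω) where
  τ : ℝ → C(Ω, Ω)
  cont : Continuous fun q : ℝ × Ω => τ q.1 q.2
  zero' : ∀ ω, τ 0 ω = ω
  add' : ∀ s t ω, τ (s + t) ω = τ s (τ t ω)
  periodic' : ∀ s, τ (s + 2 * π) = τ s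
  mp : ∀ s, MeasurePreserving (τ s) μ μ
  χ : C(Ω, ℂ)
  norm_χ : ∀ ω, ‖χ ω‖ = 1
  χ_τ : ∀ t ω, χ (τ t ω) = chr 1 t * χ ω

namespace CircleFlow

variable {Ω : Type*} [TopologicalSpace Ω] [MeasurableSpace Ω] {μ : Measure Ω} (Φ : CircleFlow Ω μ)

theorem continuous_τ : Continuous Φ.τ := ContinuousMap.continuous_of_continuous_uncurry _ Φ.cont

section Cont

variable [CompactSpace Ω]

/-- The flow induced on continuous functions. -/
def flowC : IsoFlow C(Ω, ℂ) where
  T t :=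
    { toFun := fun u => u.comp (Φ.τ t)
      map_add' := fun u v => rfl
      map_smul' := fun c u => rfl
      cont := ContinuousMap.continuous_precomp _ }
  zero' u := by ext ω; exact congrArg u (Φ.zero' ω)
  add' s t u := by
    ext ω
    change u (Φ.τ (s + t) ω) = u (Φ.τ t (Φ.τ s ω))
    rw [add_comm, Φ.add']
  norm' s u := by
    refine le_antisymm ?_ ?_
    · exact (ContinuousMap.norm_le _ (norm_nonneg u)).2 fun ω => u.norm_coe_le_norm _
    · refine (ContinuousMap.norm_le _ (norm_nonneg _)).2 fun ω => ?_
      have h : (u.comp (Φ.τ s)) (Φ.τ (-s) ω) = u ω := by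
        change u (Φ.τ s (Φ.τ (-s) ω)) = u ω
        rw [← Φ.add', add_neg_cancel, Φ.zero']
      rw [← h]
      exact ContinuousMap.norm_coe_le_norm (u.comp (Φ.τ s)) _
  cont' u := (ContinuousMap.continuous_postcomp u).comp Φ.continuous_τ
  periodic' s u := by
    change u.comp _ = u.comp _
    rw [Φ.periodic']

theorem flowC_T_apply (t : ℝ) (u : C(Ω, ℂ)) (ω : Ω) : Φ.flowC.T t u ω = u (Φ.τ t ω) := rfl

end Cont

section LpFlow

variable [BorelSpace Ω] [R1Space Ω] [μ.InnerRegularCompactLTTop] [IsLocallyFiniteMeasure μ]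
  (p : ℝ) [Fact (1 ≤ ENNReal.ofReal p)]

/-- The flow induced on `L_p`. -/
def flowLp : IsoFlow (Lp ℂ (ENNReal.ofReal p) μ) where
  T t := (Lp.compMeasurePreservingₗᵢ ℂ (Φ.τ t) (Φ.mp t)).toContinuousLinearMap
  zero' u := by
    have h : (Φ.τ 0 : Ω → Ω) = id := funext Φ.zero'
    refine Lp.ext ?_
    filter_upwards [Lp.coeFn_compMeasurePreserving u (Φ.mp 0)] with ω hω
    exact hω.trans (by rw [h]; rfl)
  add' s t u := by
    have h : (Φ.τ (s + t) : Ω → Ω) = Φ.τ t ∘ Φ.τ s := funext fun ω => by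
      rw [add_comm, Φ.add']; rfl
    change Lp.compMeasurePreserving _ (Φ.mp (s + t)) u = Lp.compMeasurePreserving _ (Φ.mp s)
      (Lp.compMeasurePreserving _ (Φ.mp t) u)
    rw [← Lp.compMeasurePreserving_comp_apply]
    congr 2
  norm' s u := Lp.norm_compMeasurePreserving u (Φ.mp s)
  cont' u := continuous_const.compMeasurePreservingLp Φ.continuous_τ Φ.mp ENNReal.ofReal_ne_top
  periodic' s u := by
    change Lp.compMeasurePreserving _ (Φ.mp _) u = Lp.compMeasurePreserving _ (Φ.mp s) u
    congr 2
    rw [Φ.periodic']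

theorem coeFn_flowLp_T (t : ℝ) (u : Lp ℂ (ENNReal.ofReal p) μ) :
    ((Φ.flowLp p).T t u : Ω → ℂ) =ᵐ[μ] u ∘ Φ.τ t :=
  Lp.coeFn_compMeasurePreserving u (Φ.mp t)

theorem flowLp_T_toLp {v : Ω → ℂ} (hv : MemLp v (ENNReal.ofReal p) μ) (t : ℝ) :
    (Φ.flowLp p).T t (hv.toLp v) = (hv.comp_measurePreserving (Φ.mp t)).toLp (v ∘ Φ.τ t) :=
  Lp.toLp_compMeasurePreserving hv (Φ.mp t)

omit [R1Space Ω] [μ.InnerRegularCompactLTTop] [IsLocallyFiniteMeasure μ] in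
theorem measurableEmbedding_τ (t : ℝ) : MeasurableEmbedding (Φ.τ t) := by
  have h1 : ∀ s, Φ.τ (-s) ∘ Φ.τ s = id := fun s => funext fun ω => by
    change Φ.τ (-s) (Φ.τ s ω) = ω
    rw [← Φ.add', neg_add_cancel, Φ.zero']
  let e : Ω ≃ᵐ Ω :=
    { toFun := Φ.τ t
      invFun := Φ.τ (-t)
      left_inv := fun ω => congrFun (h1 t) ω
      right_inv := fun ω => by simpa using congrFun (h1 (-t)) ω
      measurable_toFun := (Φ.τ t).continuous.measurable
      measurable_invFun := (Φ.τ (-t)).continuous.measurable }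
  exact e.measurableEmbedding

theorem adjoint_flowLp {p q : ℝ} (hpq : p.HolderConjugate q) [Fact (1 ≤ ENNReal.ofReal p)]
    [Fact (1 ≤ ENNReal.ofReal q)] :
    IsoFlow.Adjoint (Φ.flowLp p) (Φ.flowLp q).rev (lpPair μ hpq) where
  norm_le := norm_lpPair_le hpq
  norming := exists_norming_lpPair hpq
  adj t u v := by
    rw [lpPair_apply, lpPair_apply]
    change _ = ∫ ω, u ω * ((Φ.flowLp q).T (-t) v) ω ∂μ
    have h1 : ∫ ω, ((Φ.flowLp p).T t u) ω * v ω ∂μ = ∫ ω, u (Φ.τ t ω) * v ω ∂μ := by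
      refine integral_congr_ae ?_
      filter_upwards [Φ.coeFn_flowLp_T p t u] with ω h
      rw [h]; rfl
    have h2 : ∫ ω, u ω * ((Φ.flowLp q).T (-t) v) ω ∂μ = ∫ ω, u ω * v (Φ.τ (-t) ω) ∂μ := by
      refine integral_congr_ae ?_
      filter_upwards [Φ.coeFn_flowLp_T q (-t) v] with ω h
      rw [h]; rfl
    rw [h1, h2, ← (Φ.mp t).integral_comp (Φ.measurableEmbedding_τ t)
      (fun ω => u ω * v (Φ.τ (-t) ω))]
    refine integral_congr_ae (Filter.Eventually.of_forall fun ω => ?_)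
    dsimp only
    rw [← Φ.add', neg_add_cancel, Φ.zero']

variable [CompactSpace Ω] [IsFiniteMeasure μ] [SecondCountableTopologyEither Ω ℂ]

theorem toLp_flowC_T (t : ℝ) (u : C(Ω, ℂ)) :
    ContinuousMap.toLp (ENNReal.ofReal p) μ ℂ (Φ.flowC.T t u) =
      (Φ.flowLp p).T t (ContinuousMap.toLp (ENNReal.ofReal p) μ ℂ u) := by
  refine Lp.ext ?_
  have h1 := (Φ.mp t).quasiMeasurePreserving.ae_eq_comp
    (ContinuousMap.coeFn_toLp (p := ENNReal.ofReal p) μ (𝕜 := ℂ) u)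
  filter_upwards [ContinuousMap.coeFn_toLp (p := ENNReal.ofReal p) μ (𝕜 := ℂ) (Φ.flowC.T t u),
    Φ.coeFn_flowLp_T p t (ContinuousMap.toLp (ENNReal.ofReal p) μ ℂ u), h1] with ω h2 h3 h4
  rw [h2, h3, h4]; rfl

end LpFlow

end CircleFlow

theorem exists_norm_rpow_le_re {p : ℝ} (hp : 1 < p) (hp2 : p ≤ 2) :
    ∃ A B : ℝ, 0 < A ∧ 0 < B ∧ ∀ z : ℂ, 0 < z.re →
      ‖z‖ ^ p ≤ A * z.re ^ p - B * (z ^ (p : ℂ)).re := by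
  have hπ := Real.pi_pos
  set φ₀ : ℝ := (π / (2 * p) + π / 2) / 2 with hφ₀
  have hlt : π / (2 * p) < π / 2 := by
    apply div_lt_div_of_pos_left hπ <;> linarith
  have hpos : 0 < π / (2 * p) := by positivity
  have h1 : p * (π / (2 * p)) = π / 2 := by field_simp
  have hlo : π / 2 < p * φ₀ := by
    have := mul_lt_mul_of_pos_left hlt (by linarith : 0 < p)
    rw [hφ₀]; nlinarith
  have hhi : p * φ₀ < π := by
    rw [hφ₀]; nlinarith
  have hcos : cos (p * φ₀) < 0 := cos_neg_of_pi_div_two_lt_of_lt hlo (by linarith)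
  have hcos0 : 0 < cos φ₀ := cos_pos_of_mem_Ioo ⟨by linarith, by linarith⟩
  set B : ℝ := 1 / (-cos (p * φ₀)) with hB
  have hBpos : 0 < B := by have := neg_pos.2 hcos; positivity
  have hc : 0 < cos φ₀ ^ p := rpow_pos_of_pos hcos0 _
  refine ⟨(1 + B) / cos φ₀ ^ p, B, by positivity, hBpos, fun z hz => ?_⟩
  have hz0 : z ≠ 0 := fun h => by simp [h] at hz
  have hn : 0 < ‖z‖ := norm_pos_iff.2 hz0
  have harg : |z.arg| < π / 2 := Complex.abs_arg_lt_pi_div_two_iff.2 (Or.inl hz)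
  have hre : z.re = ‖z‖ * cos z.arg := (Complex.norm_mul_cos_arg z).symm
  have hrp : (z ^ (p : ℂ)).re = ‖z‖ ^ p * cos (p * z.arg) := by
    rw [Complex.cpow_def_of_ne_zero hz0, Complex.exp_re, Complex.re_mul_ofReal,
      Complex.im_mul_ofReal, Complex.log_re, Complex.log_im, rpow_def_of_pos hn, mul_comm p]
  have hcz : 0 < cos z.arg := by
    by_contra! hneg
    have := mul_nonpos_of_nonneg_of_nonpos hn.le hneg
    linarith
  rw [hre, hrp, mul_rpow hn.le hcz.le]
  have key : 1 ≤ (1 + B) / cos φ₀ ^ p * cos z.arg ^ p - B * cos (p * z.arg) := by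
    rw [← cos_abs z.arg, ← cos_abs (p * z.arg), abs_mul, abs_of_pos (by linarith : 0 < p)]
    rcases le_or_gt φ₀ |z.arg| with h | h
    · have e1 : cos (p * |z.arg|) ≤ cos (p * φ₀) := by
        apply cos_le_cos_of_nonneg_of_le_pi
        · linarith
        · nlinarith
        · nlinarith
      have e2 : B * cos (p * φ₀) = -1 := by
        rw [hB, one_div, inv_neg, neg_mul, inv_mul_cancel₀ hcos.ne]
      have e3 : 0 ≤ (1 + B) / cos φ₀ ^ p * cos |z.arg| ^ p := by
        have : 0 ≤ cos |z.arg| := by rw [cos_abs]; exact hcz.le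
        positivity
      nlinarith
    · have e1 : cos φ₀ ≤ cos |z.arg| := by
        apply cos_le_cos_of_nonneg_of_le_pi (abs_nonneg _) <;> linarith
      have e2 : cos φ₀ ^ p ≤ cos |z.arg| ^ p := rpow_le_rpow hcos0.le e1 (by linarith)
      have e3 : 1 + B ≤ (1 + B) / cos φ₀ ^ p * cos |z.arg| ^ p := by
        rw [div_mul_eq_mul_div, le_div_iff₀ hc]
        exact mul_le_mul_of_nonneg_left e2 (by positivity)
      have := cos_le_one (p * |z.arg|)
      nlinarith
  have := mul_le_mul_of_nonneg_left key (rpow_nonneg hn.le p)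
  linarith

/-- The Poisson kernel at radius `r`. -/
def poisson (w : ℂ) (h : ℝ) : ℝ := (2 * (1 - w * chr (-1) h)⁻¹ - 1).re

theorem one_sub_ne_zero_of_norm_lt {w : ℂ} (hw : ‖w‖ < 1) (h : ℝ) : 1 - w * chr (-1) h ≠ 0 := by
  intro e
  have : ‖w * chr (-1) h‖ = 1 := by rw [← sub_eq_zero.1 e, norm_one]
  rw [norm_mul, norm_chr, mul_one] at this
  linarith

theorem poisson_pos {w : ℂ} (hw : ‖w‖ < 1) (h : ℝ) : 0 < poisson w h := by
  have h0 := one_sub_ne_zero_of_norm_lt hw h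
  have hn : ‖w * chr (-1) h‖ < 1 := by rwa [norm_mul, norm_chr, mul_one]
  unfold poisson
  set a := w * chr (-1) h
  have h2 : 0 < Complex.normSq (1 - a) := Complex.normSq_pos.2 h0
  have h3 : Complex.normSq a < 1 := by
    rw [Complex.normSq_eq_norm_sq]
    have := norm_nonneg a
    nlinarith
  have h4 : (2 * (1 - a)⁻¹ - 1).re = (1 - Complex.normSq a) / Complex.normSq (1 - a) := by
    rw [eq_div_iff h2.ne', Complex.sub_re, show (2 * (1 - a)⁻¹).re = 2 * ((1 - a)⁻¹).re by simp, Complex.inv_re, sub_mul, mul_assoc,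
      div_mul_cancel₀ _ h2.ne']
    simp only [Complex.normSq_apply, Complex.sub_re, Complex.sub_im, Complex.one_re, Complex.one_im]
    ring
  rw [h4]
  exact div_pos (by linarith) h2

theorem continuous_inv_one_sub {w : ℂ} (hw : ‖w‖ < 1) :
    Continuous fun h : ℝ => (1 - w * chr (-1) h)⁻¹ :=
  Continuous.inv₀ (continuous_const.sub (continuous_const.mul (continuous_chr _)))
    (one_sub_ne_zero_of_norm_lt hw)

theorem continuous_poisson {w : ℂ} (hw : ‖w‖ < 1) : Continuous (poisson w) :=
  Complex.continuous_re.comp ((continuous_const.mul (continuous_inv_one_sub hw)).sub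
    continuous_const)

theorem chr_natCast_neg (n : ℕ) (h : ℝ) : chr (-(n : ℤ)) h = chr (-1) h ^ n := by
  rw [chr, chr, ← Complex.exp_nat_mul]
  congr 1
  push_cast
  ring

theorem hasSum_pow_mul_integral {w : ℂ} (hw : ‖w‖ < 1) {v : ℝ → ℂ} (hv : Continuous v) :
    HasSum (fun n : ℕ => w ^ n * ((2 * π)⁻¹ • ∫ h in (0:ℝ)..2 * π, chr (-(n : ℤ)) h * v h))
      ((2 * π)⁻¹ • ∫ h in (0:ℝ)..2 * π, (1 - w * chr (-1) h)⁻¹ * v h) := by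
  have key : HasSum (fun n : ℕ => ∫ h in (0:ℝ)..2 * π, (w * chr (-1) h) ^ n * v h)
      (∫ h in (0:ℝ)..2 * π, (1 - w * chr (-1) h)⁻¹ * v h) := by
    have hn : ∀ h, ‖w * chr (-1) h‖ < 1 := fun h => by rwa [norm_mul, norm_chr, mul_one]
    refine intervalIntegral.hasSum_integral_of_dominated_convergence
      (fun n h => ‖w‖ ^ n * ‖v h‖) (fun n => ?_) (fun n => ?_) ?_ ?_ ?_
    · exact (((continuous_const.mul (continuous_chr _)).pow n).mul hv).aestronglyMeasurable
    · refine Filter.Eventually.of_forall fun h _ => ?_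
      rw [norm_mul, norm_pow, norm_mul, norm_chr, mul_one]
    · exact Filter.Eventually.of_forall fun h _ =>
        (summable_geometric_of_lt_one (norm_nonneg w) hw).mul_right _
    · simp_rw [tsum_mul_right]
      exact (continuous_const.mul hv.norm).intervalIntegrable _ _
    · exact Filter.Eventually.of_forall fun h _ => (hasSum_geometric_of_norm_lt_one (hn h)).mul_right _
  refine (key.const_smul ((2 * π)⁻¹ : ℝ)).congr_fun fun n => ?_
  rw [mul_smul_comm, ← intervalIntegral.integral_const_mul]
  congr 1
  refine intervalIntegral.integral_congr fun h _ => ?_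
  simp only [chr_natCast_neg, mul_pow, mul_assoc]

theorem re_integral_eq_poisson {w : ℂ} (hw : ‖w‖ < 1) {v : ℝ → ℝ} (hv : Continuous v) :
    (2 * ((2 * π)⁻¹ • ∫ h in (0:ℝ)..2 * π, (1 - w * chr (-1) h)⁻¹ * (v h : ℂ)) -
      (2 * π)⁻¹ • ∫ h in (0:ℝ)..2 * π, (v h : ℂ)).re =
      (2 * π)⁻¹ * ∫ h in (0:ℝ)..2 * π, poisson w h * v h := by
  have hv' : Continuous fun h => (v h : ℂ) := Complex.continuous_ofReal.comp hv
  have hi : IntervalIntegrable (fun h => 2 * ((1 - w * chr (-1) h)⁻¹ * (v h : ℂ))) volume 0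
      (2 * π) :=
    (continuous_const.mul ((continuous_inv_one_sub hw).mul hv')).intervalIntegrable _ _
  have hi2 : IntervalIntegrable (fun h => (v h : ℂ)) volume 0 (2 * π) := hv'.intervalIntegrable _ _
  rw [mul_smul_comm, ← intervalIntegral.integral_const_mul, ← smul_sub,
    ← intervalIntegral.integral_sub hi hi2, Complex.smul_re, smul_eq_mul]
  congr 1
  have := Complex.reCLM.intervalIntegral_comp_comm (hi.sub hi2)
  rw [Complex.reCLM_apply] at this
  rw [← this]
  refine intervalIntegral.integral_congr fun h _ => ?_
  simp only [Complex.reCLM_apply, poisson, ← Complex.re_mul_ofReal]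
  congr 1
  ring

theorem integral_chr_neg_natCast (n : ℕ) :
    (2 * π)⁻¹ • ∫ h in (0:ℝ)..2 * π, chr (-(n : ℤ)) h = if n = 0 then (1 : ℂ) else 0 := by
  split_ifs with h
  · subst h
    simp only [Nat.cast_zero, neg_zero, chr_zero_left]
    rw [intervalIntegral.integral_const, sub_zero, smul_smul, inv_mul_cancel₀ (by positivity),
      one_smul]
  · have hne : ((-(n : ℤ) : ℤ) : ℂ) ≠ 0 := by exact_mod_cast fun h' => h (by omega)
    have : ∀ x : ℝ, chr (-(n : ℤ)) x =
        Complex.exp ((((-(n : ℤ) : ℤ) : ℂ) * Complex.I) * x) := by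
      intro x; rw [chr]; congr 1; push_cast; ring
    simp only [this]
    rw [integral_exp_mul_complex (mul_ne_zero hne Complex.I_ne_zero), ← this, chr_two_pi]
    simp

theorem integral_poisson {w : ℂ} (hw : ‖w‖ < 1) :
    (2 * π)⁻¹ * ∫ h in (0:ℝ)..2 * π, poisson w h = 1 := by
  have h1 := (hasSum_pow_mul_integral hw (v := fun _ => 1) continuous_const)
  have h2 := re_integral_eq_poisson hw (v := fun _ => 1) continuous_const
  simp only [mul_one, Complex.ofReal_one] at h1 h2
  simp only [integral_chr_neg_natCast] at h1
  have h3 : HasSum (fun n : ℕ => w ^ n * if n = 0 then (1 : ℂ) else 0) 1 := by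
    convert hasSum_single 0 (f := fun n : ℕ => w ^ n * if n = 0 then (1 : ℂ) else 0) ?_ using 1
    · simp
    · intro n hn
      simp [hn]
  have h4 := integral_chr_neg_natCast 0
  simp only [Nat.cast_zero, neg_zero, chr_zero_left, if_true] at h4
  rw [h1.unique h3, h4] at h2
  rw [← h2]
  norm_num

namespace IsoFlow

variable {X : Type*} [NormedAddCommGroup X] [NormedSpace ℂ X] [CompleteSpace X] (F : IsoFlow X)

omit [CompleteSpace X] in
theorem norm_S_opNorm_le (m : ℤ) : ‖F.S m‖ ≤ 1 :=
  ContinuousLinearMap.opNorm_le_bound _ zero_le_one fun x => by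
    rw [one_mul]; exact F.norm_S_le m x

theorem summable_pow_smul_S {w : ℂ} (hw : ‖w‖ < 1) :
    Summable fun n : ℕ => w ^ n • F.S (n : ℤ) := by
  refine Summable.of_norm_bounded (summable_geometric_of_lt_one (norm_nonneg w) hw) fun n => ?_
  rw [norm_smul, norm_pow]
  exact mul_le_of_le_one_right (by positivity) (F.norm_S_opNorm_le _)

/-- The Abel means of the projection onto the nonnegative frequencies. -/
def abel (w : ℂ) : X →L[ℂ] X := ∑' n : ℕ, w ^ n • F.S (n : ℤ)

theorem hasSum_abel {w : ℂ} (hw : ‖w‖ < 1) (x : X) :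
    HasSum (fun n : ℕ => w ^ n • F.S (n : ℤ) x) (F.abel w x) :=
  (F.summable_pow_smul_S hw).hasSum.mapL (ContinuousLinearMap.apply ℂ X x)

theorem S_abel {w : ℂ} (hw : ‖w‖ < 1) (m : ℤ) (x : X) :
    F.S m (F.abel w x) = if 0 ≤ m then w ^ m.toNat • F.S m x else 0 := by
  have h := (F.hasSum_abel hw x).mapL (F.S m)
  simp only [map_smul, S_S] at h
  refine h.unique ?_
  split_ifs with hm
  · lift m to ℕ using hm
    have := hasSum_single m (f := fun n : ℕ => w ^ n • if (m : ℤ) = n then F.S (n : ℤ) x else 0)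
      fun n hn => by rw [if_neg (by omega), smul_zero]
    simpa using this
  · have : (fun n : ℕ => w ^ n • if m = (n : ℤ) then F.S (n : ℤ) x else 0) = fun _ => 0 := by
      ext n
      rw [if_neg (by omega), smul_zero]
    rw [this]
    exact hasSum_zero

theorem T_abel {w : ℂ} (hw : ‖w‖ < 1) (t : ℝ) (x : X) :
    F.T t (F.abel w x) = F.abel (w * chr 1 t) x := by
  have hw' : ‖w * chr 1 t‖ < 1 := by rwa [norm_mul, norm_chr, mul_one]
  refine F.ext_S fun m => ?_
  rw [S_T, F.S_abel hw, F.S_abel hw']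
  split_ifs with hm
  · lift m to ℕ using hm
    rw [smul_smul, Int.toNat_natCast, mul_pow, mul_comm]
    congr 2
    rw [chr, chr, ← Complex.exp_nat_mul]
    congr 1
    push_cast
    ring
  · rw [smul_zero]

/-- The Abel means of the conjugation operator `u ↦ u + i ũ`. -/
def conjAbel (w : ℂ) : X →L[ℂ] X := (2 : ℂ) • F.abel w - F.S 0

omit [CompleteSpace X] in
theorem conjAbel_apply (w : ℂ) (x : X) : F.conjAbel w x = (2 : ℂ) • F.abel w x - F.S 0 x := rfl

theorem T_conjAbel {w : ℂ} (hw : ‖w‖ < 1) (t : ℝ) (x : X) :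
    F.T t (F.conjAbel w x) = F.conjAbel (w * chr 1 t) x := by
  rw [conjAbel_apply, map_sub, map_smul, T_abel F hw, T_S, chr_zero_left, one_smul, conjAbel_apply]

theorem comm_abel {Y : Type*} [NormedAddCommGroup Y] [NormedSpace ℂ Y] [CompleteSpace Y]
    (G : IsoFlow Y) (A : X →L[ℂ] Y) (hA : ∀ s x, A (F.T s x) = G.T s (A x)) (m : ℤ) (x : X) :
    A (F.S m x) = G.S m (A x) := by
  rw [S_apply, S_apply, A.map_smul_of_tower, ← A.intervalIntegral_comp_comm]
  · simp [hA]
  · exact (F.continuous_chr_smul _ _).intervalIntegrable _ _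

end IsoFlow

namespace CircleFlow

variable {Ω : Type*} [TopologicalSpace Ω] [MeasurableSpace Ω] {μ : Measure Ω} (Φ : CircleFlow Ω μ)
  [CompactSpace Ω]

theorem flowC_S_apply (m : ℤ) (u : C(Ω, ℂ)) (ω : Ω) :
    Φ.flowC.S m u ω = (2 * π)⁻¹ • ∫ h in (0:ℝ)..2 * π, chr (-m) h * u (Φ.τ h ω) := by
  rw [IsoFlow.S_apply]
  have := (ContinuousMap.evalCLM (M := ℂ) ℂ ω).intervalIntegral_comp_comm
    ((Φ.flowC.continuous_chr_smul (-m) u).intervalIntegrable (0:ℝ) (2 * π)) (μ := volume)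
  have e := (ContinuousMap.evalCLM (M := ℂ) ℂ ω).map_smul_of_tower (2 * π)⁻¹
    (∫ h in (0:ℝ)..2 * π, chr (-m) h • Φ.flowC.T h u)
  rw [← this] at e
  exact e

omit [CompactSpace Ω] in
theorem continuous_orbit (u : C(Ω, ℂ)) (ω : Ω) : Continuous fun h => u (Φ.τ h ω) :=
  u.continuous.comp (Φ.cont.comp (continuous_id.prodMk continuous_const))

theorem hasSum_abel_apply {w : ℂ} (hw : ‖w‖ < 1) (u : C(Ω, ℂ)) (ω : Ω) :
    HasSum (fun n : ℕ => w ^ n * Φ.flowC.S n u ω) (Φ.flowC.abel w u ω) :=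
  (Φ.flowC.hasSum_abel hw u).mapL (ContinuousMap.evalCLM (M := ℂ) ℂ ω)

theorem abel_apply {w : ℂ} (hw : ‖w‖ < 1) (u : C(Ω, ℂ)) (ω : Ω) :
    Φ.flowC.abel w u ω =
      (2 * π)⁻¹ • ∫ h in (0:ℝ)..2 * π, (1 - w * chr (-1) h)⁻¹ * u (Φ.τ h ω) := by
  refine (Φ.hasSum_abel_apply hw u ω).unique ?_
  simp only [flowC_S_apply]
  exact hasSum_pow_mul_integral hw (Φ.continuous_orbit u ω)

theorem differentiableOn_conjAbel (u : C(Ω, ℂ)) (ω : Ω) :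
    DifferentiableOn ℂ (fun w => Φ.flowC.conjAbel w u ω) (Metric.ball 0 1) := by
  have h : DifferentiableOn ℂ (fun w : ℂ => ∑' n : ℕ, w ^ n * Φ.flowC.S n u ω)
      (Metric.ball 0 1) := by
    intro w hw
    obtain ⟨r, hr, hr1⟩ := exists_between (mem_ball_zero_iff.1 hw)
    have : DifferentiableOn ℂ (fun w : ℂ => ∑' n : ℕ, w ^ n * Φ.flowC.S n u ω)
        (Metric.ball 0 r) := by
      refine Complex.differentiableOn_tsum_of_summable_norm (u := fun n : ℕ => r ^ n * ‖u‖)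
        ((summable_geometric_of_lt_one ((norm_nonneg w).trans hr.le) hr1).mul_right _)
        (fun n => by fun_prop) Metric.isOpen_ball fun n z hz => ?_
      rw [norm_mul, norm_pow]
      have hz' := (mem_ball_zero_iff.1 hz).le
      exact mul_le_mul (pow_le_pow_left₀ (norm_nonneg z) hz' n)
        ((ContinuousMap.norm_coe_le_norm _ ω).trans (Φ.flowC.norm_S_le n u)) (norm_nonneg _)
        (pow_nonneg ((norm_nonneg z).trans hz') n)
    exact (this.differentiableAt (Metric.isOpen_ball.mem_nhds (mem_ball_zero_iff.2 hr))).differentiableWithinAt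
  have h2 : DifferentiableOn ℂ (fun w : ℂ => 2 * (∑' n : ℕ, w ^ n * Φ.flowC.S n u ω) -
      Φ.flowC.S 0 u ω) (Metric.ball 0 1) := (h.const_mul 2).sub_const _
  refine h2.congr fun w hw => ?_
  rw [(Φ.hasSum_abel_apply (mem_ball_zero_iff.1 hw) u ω).tsum_eq]
  rfl

theorem re_conjAbel_apply {w : ℂ} (hw : ‖w‖ < 1) {u : C(Ω, ℂ)} {v : Ω → ℝ} (hv : Continuous v)
    (huv : ∀ ω, u ω = v ω) (ω : Ω) :
    (Φ.flowC.conjAbel w u ω).re = (2 * π)⁻¹ * ∫ h in (0:ℝ)..2 * π, poisson w h * v (Φ.τ h ω) := by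
  have h1 : Continuous fun h => v (Φ.τ h ω) :=
    hv.comp (Φ.cont.comp (continuous_id.prodMk continuous_const))
  rw [← re_integral_eq_poisson hw h1]
  change (2 * (Φ.flowC.abel w u ω) - Φ.flowC.S 0 u ω).re = _
  rw [abel_apply Φ hw, flowC_S_apply]
  simp only [neg_zero, chr_zero_left, one_mul, huv]

theorem re_conjAbel_pos {w : ℂ} (hw : ‖w‖ < 1) {u : C(Ω, ℂ)} {v : Ω → ℝ} (hv : Continuous v)
    (huv : ∀ ω, u ω = v ω) (hpos : ∀ ω, 0 < v ω) (ω : Ω) : 0 < (Φ.flowC.conjAbel w u ω).re := by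
  rw [Φ.re_conjAbel_apply hw hv huv]
  refine mul_pos (by positivity) (intervalIntegral.intervalIntegral_pos_of_pos ?_
    (fun h => mul_pos (poisson_pos hw h) (hpos _)) (by positivity))
  have h1 : Continuous fun h => v (Φ.τ h ω) :=
    hv.comp (Φ.cont.comp (continuous_id.prodMk continuous_const))
  exact ((continuous_poisson hw).mul h1).intervalIntegrable _ _

end CircleFlow

namespace CircleFlow

variable {Ω : Type*} [TopologicalSpace Ω] [MeasurableSpace Ω] {μ : Measure Ω} (Φ : CircleFlow Ω μ)
  [CompactSpace Ω]

theorem circleMap_zero_eq (ρ t : ℝ) : circleMap 0 ρ t = ρ * chr 1 t := by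
  simp [circleMap, chr]

theorem integral_conjAbel_rpow {ρ : ℝ} (h0 : 0 ≤ ρ) (h1 : ρ < 1) (p : ℝ) {u : C(Ω, ℂ)} {v : Ω → ℝ}
    (hv : Continuous v) (huv : ∀ ω, u ω = v ω) (hpos : ∀ ω, 0 < v ω) (ω : Ω) :
    0 ≤ (∫ t in (0:ℝ)..2 * π, (Φ.flowC.conjAbel ρ u (Φ.τ t ω)) ^ (p : ℂ)).re := by
  have hn : ‖(ρ : ℂ)‖ < 1 := by rwa [Complex.norm_real, Real.norm_of_nonneg h0]
  have hd : DifferentiableOn ℂ (fun w => (Φ.flowC.conjAbel w u ω) ^ (p : ℂ)) (Metric.ball 0 1) :=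
    (Φ.differentiableOn_conjAbel u ω).cpow_const fun w hw =>
      Or.inl (Φ.re_conjAbel_pos (mem_ball_zero_iff.1 hw) hv huv hpos ω)
  have hc : DiffContOnCl ℂ (fun w => (Φ.flowC.conjAbel w u ω) ^ (p : ℂ)) (Metric.ball 0 |ρ|) := by
    refine (hd.mono ?_).diffContOnCl
    rw [abs_of_nonneg h0]
    exact Metric.closure_ball_subset_closedBall.trans (Metric.closedBall_subset_ball h1)
  have h2 := hc.circleAverage
  rw [Real.circleAverage] at h2
  have h3 : ∀ t : ℝ, Φ.flowC.conjAbel (circleMap 0 ρ t) u ω = Φ.flowC.conjAbel ρ u (Φ.τ t ω) := by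
    intro t
    rw [circleMap_zero_eq, ← Φ.flowC.T_conjAbel hn, flowC_T_apply]
  simp only [h3] at h2
  have h4 : ∫ t in (0:ℝ)..2 * π, (Φ.flowC.conjAbel ρ u (Φ.τ t ω)) ^ (p : ℂ) =
      (2 * π) • (Φ.flowC.conjAbel 0 u ω) ^ (p : ℂ) := by
    rw [← h2, smul_smul, mul_inv_cancel₀ (by positivity), one_smul]
  have h5 : Φ.flowC.conjAbel 0 u ω = ((Φ.flowC.conjAbel 0 u ω).re : ℂ) := by
    have e : Φ.flowC.conjAbel 0 u ω = Φ.flowC.S 0 u ω := by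
      have : Φ.flowC.abel 0 u ω = (0 : ℂ) ^ 0 * Φ.flowC.S 0 u ω :=
        (Φ.hasSum_abel_apply (w := 0) (by simp) u ω).unique
          (hasSum_single 0 fun n hn => by simp [hn])
      change 2 * Φ.flowC.abel 0 u ω - Φ.flowC.S 0 u ω = Φ.flowC.S 0 u ω
      rw [this, pow_zero]
      ring
    rw [e, flowC_S_apply]
    simp only [neg_zero, chr_zero_left, one_mul, huv]
    rw [intervalIntegral.integral_ofReal, ← Complex.coe_smul, smul_eq_mul, ← Complex.ofReal_mul,
      Complex.ofReal_re]
  have h6 := Φ.re_conjAbel_pos (w := 0) (by simp) hv huv hpos ω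
  rw [h4, h5, Complex.smul_re, ← Complex.ofReal_cpow h6.le, Complex.ofReal_re, smul_eq_mul]
  positivity

variable [BorelSpace Ω] [IsFiniteMeasure μ] [SecondCountableTopologyEither Ω ℂ]

omit [SecondCountableTopologyEither Ω ℂ] in
theorem re_integral_conjAbel_rpow_nonneg {ρ : ℝ} (h0 : 0 ≤ ρ) (h1 : ρ < 1) (p : ℝ) {u : C(Ω, ℂ)}
    {v : Ω → ℝ} (hv : Continuous v) (huv : ∀ ω, u ω = v ω) (hpos : ∀ ω, 0 < v ω) :
    0 ≤ (∫ ω, (Φ.flowC.conjAbel ρ u ω) ^ (p : ℂ) ∂μ).re := by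
  have hn : ‖(ρ : ℂ)‖ < 1 := by rwa [Complex.norm_real, Real.norm_of_nonneg h0]
  set g : Ω → ℂ := fun ω => (Φ.flowC.conjAbel ρ u ω) ^ (p : ℂ) with hg
  have hgc : Continuous g := (ContinuousMap.continuous _).cpow continuous_const fun ω =>
    Or.inl (Φ.re_conjAbel_pos hn hv huv hpos ω)
  obtain ⟨M, hM⟩ : ∃ M, ∀ ω, ‖g ω‖ ≤ M :=
    ⟨‖(⟨g, hgc⟩ : C(Ω, ℂ))‖, fun ω => ContinuousMap.norm_coe_le_norm ⟨g, hgc⟩ ω⟩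
  have hjc : Continuous fun q : ℝ × Ω => g (Φ.τ q.1 q.2) := hgc.comp Φ.cont
  have hi : Integrable (Function.uncurry fun (t : ℝ) (ω : Ω) => g (Φ.τ t ω))
      ((volume.restrict (Set.Ioc 0 (2 * π))).prod μ) :=
    Integrable.of_bound (C := M) hjc.aestronglyMeasurable (Filter.Eventually.of_forall fun q => hM _)
  have hswap := integral_integral_swap hi
  have e1 : ∀ t, ∫ ω, g (Φ.τ t ω) ∂μ = ∫ ω, g ω ∂μ := fun t =>
    (Φ.mp t).integral_comp' (f := (⟨⟨Φ.τ t, Φ.τ (-t), fun ω => by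
      rw [← Φ.add', neg_add_cancel, Φ.zero'], fun ω => by
      rw [← Φ.add', add_neg_cancel, Φ.zero']⟩, (Φ.τ t).continuous.measurable,
      (Φ.τ (-t)).continuous.measurable⟩ : Ω ≃ᵐ Ω)) g
  simp only [e1] at hswap
  rw [integral_const, measureReal_restrict_apply_univ, Real.volume_real_Ioc_of_le (by positivity),
    sub_zero] at hswap
  have h2 : 0 ≤ ((2 * π) • ∫ ω, g ω ∂μ).re := by
    rw [hswap, ← RCLike.re_eq_complex_re, ← integral_re (f := fun ω => ∫ t in Set.Ioc 0 (2 * π), g (Φ.τ t ω)) hi.integral_prod_right]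
    refine integral_nonneg fun ω => ?_
    have := Φ.integral_conjAbel_rpow h0 h1 p hv huv hpos ω
    rwa [intervalIntegral.integral_of_le (by positivity)] at this
  rw [Complex.smul_re, smul_eq_mul] at h2
  exact nonneg_of_mul_nonneg_right h2 (by positivity)

variable {p : ℝ} [Fact (1 ≤ ENNReal.ofReal p)]

theorem norm_toLp_rpow (hp : 0 < p) (u : C(Ω, ℂ)) :
    ‖ContinuousMap.toLp (ENNReal.ofReal p) μ ℂ u‖ ^ p = ∫ ω, ‖u ω‖ ^ p ∂μ := by
  have hc : Continuous fun ω => ‖u ω‖ ^ p := u.continuous.norm.rpow_const fun _ => Or.inr hp.le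
  have h := Lp.enorm_rpow hp (ContinuousMap.toLp (ENNReal.ofReal p) μ ℂ u)
  have h2 : ∫⁻ ω, ‖(ContinuousMap.toLp (ENNReal.ofReal p) μ ℂ u) ω‖ₑ ^ p ∂μ =
      ∫⁻ ω, ENNReal.ofReal (‖u ω‖ ^ p) ∂μ := by
    refine lintegral_congr_ae ?_
    filter_upwards [ContinuousMap.coeFn_toLp (p := ENNReal.ofReal p) μ (𝕜 := ℂ) u] with ω h
    rw [h, enorm_rpow_eq_ofReal hp.le]
  rw [h2, enorm_rpow_eq_ofReal hp.le] at h
  rw [integral_eq_lintegral_of_nonneg_ae (Filter.Eventually.of_forall fun ω => by positivity)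
    hc.aestronglyMeasurable, ← h, ENNReal.toReal_ofReal (by positivity)]

end CircleFlow

namespace CircleFlow

variable {Ω : Type*} [TopologicalSpace Ω] [MeasurableSpace Ω] {μ : Measure Ω} (Φ : CircleFlow Ω μ)
  [CompactSpace Ω] [BorelSpace Ω] [IsFiniteMeasure μ] [SecondCountableTopologyEither Ω ℂ]
  [R1Space Ω] [μ.InnerRegularCompactLTTop] {p : ℝ} [Fact (1 ≤ ENNReal.ofReal p)]

theorem toLp_flowC_S (m : ℤ) (u : C(Ω, ℂ)) :
    ContinuousMap.toLp (ENNReal.ofReal p) μ ℂ (Φ.flowC.S m u) =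
      (Φ.flowLp p).S m (ContinuousMap.toLp (ENNReal.ofReal p) μ ℂ u) :=
  Φ.flowC.comm_abel (Φ.flowLp p) _ (fun s x => Φ.toLp_flowC_T p s x) m u

theorem integral_re_conjAbel_rpow_le {w : ℂ} (hw : ‖w‖ < 1) (hp : 0 < p) {u : C(Ω, ℂ)}
    {v : Ω → ℝ} (hv : Continuous v) (huv : ∀ ω, u ω = v ω) :
    ∫ ω, |(Φ.flowC.conjAbel w u ω).re| ^ p ∂μ ≤
      ‖ContinuousMap.toLp (ENNReal.ofReal p) μ ℂ u‖ ^ p := by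
  set J : C(Ω, ℂ) →L[ℂ] Lp ℂ (ENNReal.ofReal p) μ := ContinuousMap.toLp (ENNReal.ofReal p) μ ℂ
  have hcont : Continuous fun h => poisson w h • Φ.flowC.T h u :=
    (continuous_poisson hw).smul (Φ.flowC.cont' u)
  set R : C(Ω, ℂ) := (2 * π)⁻¹ • ∫ h in (0:ℝ)..2 * π, poisson w h • Φ.flowC.T h u with hR
  have h1 : ∀ ω, R ω = ((Φ.flowC.conjAbel w u ω).re : ℂ) := fun ω => by
    have := (ContinuousMap.evalCLM (M := ℂ) ℂ ω).intervalIntegral_comp_comm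
      (hcont.intervalIntegrable (0:ℝ) (2 * π)) (μ := volume)
    have e := (ContinuousMap.evalCLM (M := ℂ) ℂ ω).map_smul_of_tower (2 * π)⁻¹
      (∫ h in (0:ℝ)..2 * π, poisson w h • Φ.flowC.T h u)
    rw [← this] at e
    refine e.trans ?_
    rw [Φ.re_conjAbel_apply hw hv huv, Complex.ofReal_mul, ← intervalIntegral.integral_ofReal,
      ← Complex.real_smul]
    congr 1
    refine intervalIntegral.integral_congr fun h _ => ?_
    rw [Complex.ofReal_mul, ← huv, ← Complex.real_smul]
    exact (ContinuousMap.evalCLM (M := ℂ) ℂ ω).map_smul_of_tower (poisson w h) (Φ.flowC.T h u)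
  have h2 : ‖J R‖ ≤ ‖J u‖ := by
    rw [hR, J.map_smul_of_tower, ← J.intervalIntegral_comp_comm (hcont.intervalIntegrable _ _),
      norm_smul, Real.norm_of_nonneg (by positivity)]
    have h3 : ‖∫ h in (0:ℝ)..2 * π, J (poisson w h • Φ.flowC.T h u)‖ ≤
        ∫ h in (0:ℝ)..2 * π, poisson w h * ‖J u‖ := by
      refine intervalIntegral.norm_integral_le_of_norm_le (by positivity)
        (Filter.Eventually.of_forall fun h _ => ?_)
        (((continuous_poisson hw).mul continuous_const).intervalIntegrable _ _)
      rw [J.map_smul_of_tower, norm_smul, Real.norm_of_nonneg (poisson_pos hw h).le,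
        Φ.toLp_flowC_T, (Φ.flowLp p).norm']
    rw [intervalIntegral.integral_mul_const] at h3
    calc _ ≤ (2 * π)⁻¹ * ((∫ h in (0:ℝ)..2 * π, poisson w h) * ‖J u‖) :=
          mul_le_mul_of_nonneg_left h3 (by positivity)
      _ = ‖J u‖ := by rw [← mul_assoc, integral_poisson hw, one_mul]
  calc _ = ‖J R‖ ^ p := by
        rw [norm_toLp_rpow hp]
        refine integral_congr_ae (Filter.Eventually.of_forall fun ω => ?_)
        dsimp only
        rw [h1, Complex.norm_real, Real.norm_eq_abs]
    _ ≤ _ := rpow_le_rpow (norm_nonneg _) h2 hp.le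

theorem exists_norm_conjAbel_le (hp : 1 < p) (hp2 : p ≤ 2) :
    ∃ C : ℝ, 0 < C ∧ ∀ ρ : ℝ, 0 ≤ ρ → ρ < 1 → ∀ (u : C(Ω, ℂ)) (v : Ω → ℝ), Continuous v →
      (∀ ω, u ω = v ω) → (∀ ω, 0 < v ω) →
      ‖ContinuousMap.toLp (ENNReal.ofReal p) μ ℂ (Φ.flowC.conjAbel ρ u)‖ ≤
        C * ‖ContinuousMap.toLp (ENNReal.ofReal p) μ ℂ u‖ := by
  obtain ⟨A, B, hA, hB, hAB⟩ := exists_norm_rpow_le_re hp hp2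
  have hp0 : 0 < p := by linarith
  refine ⟨A ^ (1 / p), by positivity, fun ρ h0 h1 u v hv huv hpos => ?_⟩
  have hn : ‖(ρ : ℂ)‖ < 1 := by rwa [Complex.norm_real, Real.norm_of_nonneg h0]
  rw [← rpow_le_rpow_iff (norm_nonneg _) (by positivity) hp0, mul_rpow (by positivity) (norm_nonneg _),
    ← rpow_mul hA.le, one_div_mul_cancel hp0.ne', rpow_one]
  set E := Φ.flowC.conjAbel ρ u
  have hEp : ∀ ω, 0 < (E ω).re := Φ.re_conjAbel_pos hn hv huv hpos
  have hint : ∀ {φ : Ω → ℝ}, Continuous φ → Integrable φ μ := fun {φ} hφ =>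
    Integrable.of_bound (C := ‖(⟨φ, hφ⟩ : C(Ω, ℝ))‖) hφ.aestronglyMeasurable
      (Filter.Eventually.of_forall fun ω => ContinuousMap.norm_coe_le_norm ⟨φ, hφ⟩ ω)
  have hg : Continuous fun ω => (E ω) ^ (p : ℂ) :=
    E.continuous.cpow continuous_const fun ω => Or.inl (hEp ω)
  have hgi : Integrable (fun ω => (E ω) ^ (p : ℂ)) μ :=
    Integrable.of_bound (C := ‖(⟨_, hg⟩ : C(Ω, ℂ))‖) hg.aestronglyMeasurable
      (Filter.Eventually.of_forall fun ω => ContinuousMap.norm_coe_le_norm ⟨_, hg⟩ ω)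
  have hre : Continuous fun ω => |(E ω).re| ^ p :=
    (Complex.continuous_re.comp E.continuous).abs.rpow_const fun _ => Or.inr hp0.le
  rw [norm_toLp_rpow hp0]
  have hreg : Continuous fun ω => ((E ω) ^ (p : ℂ)).re := Complex.continuous_re.comp hg
  have i1 : Integrable (fun ω => |(E ω).re| ^ p) μ := hint hre
  have i2 : Integrable (fun ω => ((E ω) ^ (p : ℂ)).re) μ := hint hreg
  calc ∫ ω, ‖E ω‖ ^ p ∂μ ≤ ∫ ω, (A * |(E ω).re| ^ p - B * ((E ω) ^ (p : ℂ)).re) ∂μ := by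
        refine integral_mono (hint (E.continuous.norm.rpow_const fun _ => Or.inr hp0.le))
          ((i1.const_mul A).sub (i2.const_mul B)) fun ω => ?_
        dsimp only
        rw [abs_of_pos (hEp ω)]
        exact hAB _ (hEp ω)
    _ = A * ∫ ω, |(E ω).re| ^ p ∂μ - B * (∫ ω, (E ω) ^ (p : ℂ) ∂μ).re := by
        rw [integral_sub (i1.const_mul A) (i2.const_mul B), integral_const_mul, integral_const_mul]
        congr 2
        exact integral_re hgi
    _ ≤ A * ∫ ω, |(E ω).re| ^ p ∂μ := by
        have := Φ.re_integral_conjAbel_rpow_nonneg (μ := μ) h0 h1 p hv huv hpos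
        have := mul_nonneg hB.le this
        linarith
    _ ≤ _ := mul_le_mul_of_nonneg_left (Φ.integral_re_conjAbel_rpow_le hn hp0 hv huv) hA.le

end CircleFlow

namespace CircleFlow

variable {Ω : Type*} [TopologicalSpace Ω] [MeasurableSpace Ω] {μ : Measure Ω} (Φ : CircleFlow Ω μ)
  [CompactSpace Ω] [BorelSpace Ω] [IsFiniteMeasure μ] [SecondCountableTopologyEither Ω ℂ]
  {p : ℝ} [Fact (1 ≤ ENNReal.ofReal p)]

theorem norm_toLp_mono {u v : C(Ω, ℂ)} (h : ∀ ω, ‖u ω‖ ≤ ‖v ω‖) :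
    ‖ContinuousMap.toLp (ENNReal.ofReal p) μ ℂ u‖ ≤
      ‖ContinuousMap.toLp (ENNReal.ofReal p) μ ℂ v‖ := by
  refine Lp.norm_le_norm_of_ae_le ?_
  filter_upwards [ContinuousMap.coeFn_toLp (p := ENNReal.ofReal p) μ (𝕜 := ℂ) u,
    ContinuousMap.coeFn_toLp (p := ENNReal.ofReal p) μ (𝕜 := ℂ) v] with ω h1 h2
  rw [h1, h2]
  exact h ω

variable [R1Space Ω] [μ.InnerRegularCompactLTTop]

theorem exists_norm_abel_le (hp : 1 < p) (hp2 : p ≤ 2) :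
    ∃ C : ℝ, 0 < C ∧ ∀ ρ : ℝ, 0 ≤ ρ → ρ < 1 → ∀ u : C(Ω, ℂ),
      ‖ContinuousMap.toLp (ENNReal.ofReal p) μ ℂ (Φ.flowC.abel ρ u)‖ ≤
        C * ‖ContinuousMap.toLp (ENNReal.ofReal p) μ ℂ u‖ := by
  obtain ⟨C, hC, hC'⟩ := Φ.exists_norm_conjAbel_le (μ := μ) hp hp2
  set J : C(Ω, ℂ) →L[ℂ] Lp ℂ (ENNReal.ofReal p) μ := ContinuousMap.toLp (ENNReal.ofReal p) μ ℂ
  have hposit : ∀ ρ : ℝ, 0 ≤ ρ → ρ < 1 → ∀ (u : C(Ω, ℂ)) (v : Ω → ℝ), Continuous v →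
      (∀ ω, u ω = v ω) → (∀ ω, 0 < v ω) → ‖J (Φ.flowC.abel ρ u)‖ ≤ (C + 1) * ‖J u‖ := by
    intro ρ h0 h1 u v hv huv hpos
    have e : Φ.flowC.abel ρ u = (2⁻¹ : ℂ) • (Φ.flowC.conjAbel ρ u + Φ.flowC.S 0 u) := by
      rw [IsoFlow.conjAbel_apply, sub_add_cancel, smul_smul, inv_mul_cancel₀ two_ne_zero, one_smul]
    have h2 := hC' ρ h0 h1 u v hv huv hpos
    have h3 : ‖J (Φ.flowC.S 0 u)‖ ≤ ‖J u‖ := by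
      rw [Φ.toLp_flowC_S]
      exact (Φ.flowLp p).norm_S_le _ _
    rw [e, map_smul, map_add, norm_smul, norm_inv, Complex.norm_ofNat]
    have := norm_add_le (J (Φ.flowC.conjAbel ρ u)) (J (Φ.flowC.S 0 u))
    have := norm_nonneg (J (Φ.flowC.conjAbel ρ u) + J (Φ.flowC.S 0 u))
    linarith
  have hreal : ∀ ρ : ℝ, 0 ≤ ρ → ρ < 1 → ∀ (u : C(Ω, ℂ)) (v : C(Ω, ℝ)),
      (∀ ω, u ω = v ω) → ‖J (Φ.flowC.abel ρ u)‖ ≤ 2 * (C + 1) * ‖J u‖ := by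
    intro ρ h0 h1 u v huv
    set N := ‖J 1‖
    have key : ∀ ε : ℝ, 0 < ε → ‖J (Φ.flowC.abel ρ u)‖ ≤ 2 * (C + 1) * (‖J u‖ + ε * N) := by
      intro ε hε
      let c (s : C(Ω, ℝ)) : C(Ω, ℂ) := ⟨fun ω => (max (s ω) 0 + ε : ℝ), by fun_prop⟩
      let d (s : C(Ω, ℝ)) : C(Ω, ℂ) := ⟨fun ω => (max (s ω) 0 : ℝ), by fun_prop⟩
      have hcd : ∀ s, c s = d s + (ε : ℂ) • 1 := fun s => by
        ext ω; simp [c, d]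
      have hb : ∀ s : C(Ω, ℝ), (∀ ω, |s ω| = |v ω|) →
          ‖J (Φ.flowC.abel ρ (c s))‖ ≤ (C + 1) * (‖J u‖ + ε * N) := by
        intro s hs
        refine (hposit ρ h0 h1 (c s) (fun ω => max (s ω) 0 + ε) (by fun_prop) (fun ω => rfl)
          (fun ω => by positivity)).trans (mul_le_mul_of_nonneg_left ?_ (by positivity))
        rw [hcd, map_add, map_smul]
        refine (norm_add_le _ _).trans (add_le_add ?_ ?_)
        · refine norm_toLp_mono fun ω => ?_
          simp only [d, ContinuousMap.coe_mk, huv, Complex.norm_real, Real.norm_eq_abs, ← hs ω]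
          rw [abs_of_nonneg (le_max_right _ _)]
          exact max_le (le_abs_self _) (abs_nonneg _)
        · rw [norm_smul, Complex.norm_real, Real.norm_of_nonneg hε.le]
      have hu : u = c v - c (-v) := by
        ext ω
        simp only [c, huv, ContinuousMap.sub_apply, ContinuousMap.coe_mk, ContinuousMap.neg_apply]
        rw [← Complex.ofReal_sub]
        congr 1
        rcases le_total 0 (v ω) with h | h
        · rw [max_eq_left h, max_eq_right (by linarith)]; ring
        · rw [max_eq_right h, max_eq_left (by linarith)]; ring
      have b1 := hb v fun _ => rfl
      have b2 := hb (-v) fun ω => by simp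
      calc _ = ‖J (Φ.flowC.abel ρ (c v)) - J (Φ.flowC.abel ρ (c (-v)))‖ := by
            rw [hu, map_sub, map_sub]
        _ ≤ _ := by
            refine (norm_sub_le _ _).trans ?_
            linarith
    have ht : Filter.Tendsto (fun ε : ℝ => 2 * (C + 1) * (‖J u‖ + ε * N)) (nhdsWithin 0 (Set.Ioi 0))
        (nhds (2 * (C + 1) * (‖J u‖ + 0 * N))) :=
      (Continuous.tendsto (by fun_prop) 0).mono_left nhdsWithin_le_nhds
    rw [zero_mul, add_zero] at ht
    exact ge_of_tendsto ht (Filter.eventually_of_mem self_mem_nhdsWithin key)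
  refine ⟨4 * (C + 1), by positivity, fun ρ h0 h1 u => ?_⟩
  let a : C(Ω, ℂ) := ⟨fun ω => ((u ω).re : ℂ), by fun_prop⟩
  let b : C(Ω, ℂ) := ⟨fun ω => ((u ω).im : ℂ), by fun_prop⟩
  have hu : u = a + Complex.I • b := by
    ext ω
    simp only [a, b, ContinuousMap.add_apply, ContinuousMap.smul_apply, ContinuousMap.coe_mk,
      smul_eq_mul]
    rw [mul_comm, Complex.re_add_im]
  have ha : ‖J (Φ.flowC.abel ρ a)‖ ≤ 2 * (C + 1) * ‖J u‖ :=
    (hreal ρ h0 h1 a ⟨fun ω => (u ω).re, by fun_prop⟩ fun ω => rfl).trans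
      (mul_le_mul_of_nonneg_left (norm_toLp_mono fun ω => by
        simpa [a] using Complex.abs_re_le_norm (u ω)) (by positivity))
  have hb : ‖J (Φ.flowC.abel ρ b)‖ ≤ 2 * (C + 1) * ‖J u‖ :=
    (hreal ρ h0 h1 b ⟨fun ω => (u ω).im, by fun_prop⟩ fun ω => rfl).trans
      (mul_le_mul_of_nonneg_left (norm_toLp_mono fun ω => by
        simpa [b] using Complex.abs_im_le_norm (u ω)) (by positivity))
  calc _ = ‖J (Φ.flowC.abel ρ a) + Complex.I • J (Φ.flowC.abel ρ b)‖ := by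
        conv_lhs => rw [hu, map_add, map_smul, map_add, map_smul]
    _ ≤ _ := by
        refine (norm_add_le _ _).trans ?_
        rw [norm_smul, Complex.norm_I, one_mul]
        linarith

end CircleFlow

namespace CircleFlow

variable {Ω : Type*} [TopologicalSpace Ω] [MeasurableSpace Ω] {μ : Measure Ω} (Φ : CircleFlow Ω μ)

theorem χ_ne_zero (ω : Ω) : Φ.χ ω ≠ 0 := norm_ne_zero_iff.1 (by rw [Φ.norm_χ]; exact one_ne_zero)

/-- The integer powers of the eigenfunction. -/
def chi (a : ℤ) : C(Ω, ℂ) :=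
  ⟨fun ω => Φ.χ ω ^ a, Φ.χ.continuous.zpow₀ a fun ω => Or.inl (Φ.χ_ne_zero ω)⟩

theorem chi_apply (a : ℤ) (ω : Ω) : Φ.chi a ω = Φ.χ ω ^ a := rfl

theorem norm_chi (a : ℤ) (ω : Ω) : ‖Φ.chi a ω‖ = 1 := by
  rw [chi_apply, norm_zpow, Φ.norm_χ, one_zpow]

theorem chi_τ (a : ℤ) (t : ℝ) (ω : Ω) : Φ.chi a (Φ.τ t ω) = chr a t * Φ.chi a ω := by
  rw [chi_apply, chi_apply, Φ.χ_τ, mul_zpow, chr, chr, ← Complex.exp_int_mul]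
  congr 2
  push_cast
  ring

theorem chi_mul_chi_neg (a : ℤ) : Φ.chi a * Φ.chi (-a) = 1 := by
  ext ω
  rw [ContinuousMap.mul_apply, chi_apply, chi_apply, zpow_neg,
    mul_inv_cancel₀ (zpow_ne_zero _ (Φ.χ_ne_zero ω)), ContinuousMap.one_apply]

variable [CompactSpace Ω]

theorem S_chi_mul (k a : ℤ) (v : C(Ω, ℂ)) :
    Φ.flowC.S k (Φ.chi a * v) = Φ.chi a * Φ.flowC.S (k - a) v := by
  ext ω
  rw [flowC_S_apply, ContinuousMap.mul_apply, flowC_S_apply, mul_smul_comm,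
    ← intervalIntegral.integral_const_mul]
  congr 1
  refine intervalIntegral.integral_congr fun h _ => ?_
  rw [ContinuousMap.mul_apply, chi_τ, neg_sub, sub_eq_add_neg, chr_add_left]
  ring

theorem sum_pow_smul_S {ρ : ℂ} (hρ : ‖ρ‖ < 1) {a b : ℤ} (hab : a ≤ b) (u : C(Ω, ℂ)) :
    ∑ m ∈ Finset.Ico a b, ρ ^ (m - a).toNat • Φ.flowC.S m u =
      Φ.chi a * Φ.flowC.abel ρ (Φ.chi (-a) * u) -
        ρ ^ (b - a).toNat • (Φ.chi b * Φ.flowC.abel ρ (Φ.chi (-b) * u)) := by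
  have key : ∀ k c : ℤ, Φ.flowC.S k (Φ.chi c * Φ.flowC.abel ρ (Φ.chi (-c) * u)) =
      if c ≤ k then ρ ^ (k - c).toNat • Φ.flowC.S k u else 0 := by
    intro k c
    rw [S_chi_mul, Φ.flowC.S_abel hρ, S_chi_mul]
    have : k - c - -c = k := by ring
    rw [this]
    by_cases h : c ≤ k
    · rw [if_pos h, if_pos (by omega), mul_smul_comm, ← mul_assoc, chi_mul_chi_neg, one_mul]
    · rw [if_neg h, if_neg (by omega), mul_zero]
  refine Φ.flowC.ext_S fun k => ?_
  rw [map_sum, map_sub, map_smul, key, key]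
  simp only [map_smul, IsoFlow.S_S, smul_ite, smul_zero]
  rw [Finset.sum_ite_eq]
  simp only [Finset.mem_Ico]
  by_cases h1 : a ≤ k
  · by_cases h2 : b ≤ k
    · rw [if_neg (by omega), if_pos h1, if_pos h2, smul_smul, ← pow_add,
        show (b - a).toNat + (k - b).toNat = (k - a).toNat by omega, sub_self]
    · rw [if_pos (by omega), if_pos h1, if_neg h2, sub_zero]
  · rw [if_neg (by omega), if_neg h1, if_neg (by omega), sub_zero]

variable [BorelSpace Ω] [IsFiniteMeasure μ] [SecondCountableTopologyEither Ω ℂ]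
  [R1Space Ω] [μ.InnerRegularCompactLTTop] [NormalSpace Ω] [μ.WeaklyRegular]
  {p : ℝ} [Fact (1 ≤ ENNReal.ofReal p)]

theorem exists_rieszBound_of_le_two (hp : 1 < p) (hp2 : p ≤ 2) :
    ∃ R, (Φ.flowLp p).RieszBound R := by
  obtain ⟨C, hC, hC'⟩ := Φ.exists_norm_abel_le (μ := μ) hp hp2
  set J : C(Ω, ℂ) →L[ℂ] Lp ℂ (ENNReal.ofReal p) μ := ContinuousMap.toLp (ENNReal.ofReal p) μ ℂ
    with hJ
  have hchi : ∀ (c : ℤ) (u : C(Ω, ℂ)), ‖J (Φ.chi c * u)‖ ≤ ‖J u‖ := fun c u =>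
    norm_toLp_mono fun ω => by rw [ContinuousMap.mul_apply, norm_mul, norm_chi, one_mul]
  have hpi : ∀ ρ : ℝ, 0 ≤ ρ → ρ < 1 → ∀ (c : ℤ) (u : C(Ω, ℂ)),
      ‖J (Φ.chi c * Φ.flowC.abel ρ (Φ.chi (-c) * u))‖ ≤ C * ‖J u‖ := fun ρ h0 h1 c u =>
    (hchi _ _).trans ((hC' ρ h0 h1 _).trans (mul_le_mul_of_nonneg_left (hchi _ _) hC.le))
  refine ⟨2 * C, by positivity, fun a b x => ?_⟩
  rcases lt_or_ge b a with hab | hab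
  · rw [Finset.Ico_eq_empty (by omega), Finset.sum_empty, norm_zero]
    positivity
  have hdense : DenseRange J := ContinuousMap.toLp_denseRange ℂ μ ℂ ENNReal.ofReal_ne_top
  refine hdense.induction_on (p := fun x => ‖∑ m ∈ Finset.Ico a b, (Φ.flowLp p).S m x‖ ≤
    2 * C * ‖x‖) x ?_ fun u => ?_
  · exact isClosed_le (by fun_prop) (by fun_prop)
  have ht : Filter.Tendsto (fun ρ : ℝ => ‖∑ m ∈ Finset.Ico a b,
      (ρ : ℂ) ^ (m - a).toNat • (Φ.flowLp p).S m (J u)‖) (nhdsWithin 1 (Set.Ioo 0 1))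
      (nhds ‖∑ m ∈ Finset.Ico a b, ((1 : ℝ) : ℂ) ^ (m - a).toNat • (Φ.flowLp p).S m (J u)‖) :=
    (Continuous.tendsto (by fun_prop) 1).mono_left nhdsWithin_le_nhds
  simp only [Complex.ofReal_one, one_pow, one_smul] at ht
  have : (nhdsWithin (1 : ℝ) (Set.Ioo 0 1)).NeBot := right_nhdsWithin_Ioo_neBot zero_lt_one
  refine le_of_tendsto ht (Filter.eventually_of_mem self_mem_nhdsWithin fun ρ hρ => ?_)
  have hn : ‖(ρ : ℂ)‖ < 1 := by rw [Complex.norm_real, Real.norm_of_nonneg hρ.1.le]; exact hρ.2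
  have e : ∑ m ∈ Finset.Ico a b, (ρ : ℂ) ^ (m - a).toNat • (Φ.flowLp p).S m (J u) =
      J (∑ m ∈ Finset.Ico a b, (ρ : ℂ) ^ (m - a).toNat • Φ.flowC.S m u) := by
    rw [map_sum]
    refine Finset.sum_congr rfl fun m _ => ?_
    rw [map_smul, hJ, toLp_flowC_S]
  rw [e, Φ.sum_pow_smul_S hn hab, map_sub, map_smul]
  refine (norm_sub_le _ _).trans ?_
  rw [norm_smul, norm_pow]
  have h1 := hpi ρ hρ.1.le hρ.2 a u
  have h2 := hpi ρ hρ.1.le hρ.2 b u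
  have h3 : ‖(ρ : ℂ)‖ ^ (b - a).toNat ≤ 1 := pow_le_one₀ (norm_nonneg _) hn.le
  have h4 := mul_le_mul h3 h2 (norm_nonneg _) zero_le_one
  linarith

theorem exists_rieszBound (hp : 1 < p) : ∃ R, (Φ.flowLp p).RieszBound R := by
  rcases le_total p 2 with hp2 | hp2
  · exact Φ.exists_rieszBound_of_le_two hp hp2
  have hpq := Real.HolderConjugate.conjExponent hp
  set q := p.conjExponent
  have hq1 : 1 < q := hpq.symm.lt
  have : Fact (1 ≤ ENNReal.ofReal q) := ⟨by simpa using hq1.le⟩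
  have hq2 : q ≤ 2 := by
    rw [hpq.conjugate_eq, div_le_iff₀ (by linarith)]
    linarith
  obtain ⟨R, hR⟩ := Φ.exists_rieszBound_of_le_two (μ := μ) hq1 hq2
  exact ⟨R, (Φ.adjoint_flowLp hpq).rieszBound hR.rev⟩

end CircleFlow

instance fact_two_pi_pos : Fact (0 < 2 * π) := ⟨Real.two_pi_pos⟩

/-- The two-dimensional torus `(ℝ / (2 * π) ℤ)²`. -/
abbrev Torus : Type := AddCircle (2 * π) × AddCircle (2 * π)

namespace Torus

theorem fourier_add_coe (t : ℝ) (a : AddCircle (2 * π)) :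
    fourier 1 ((t : AddCircle (2 * π)) + a) = chr 1 t * fourier 1 a := by
  induction a using QuotientAddGroup.induction_on with
  | H x =>
    change fourier 1 ((t : AddCircle (2 * π)) + (x : AddCircle (2 * π))) =
      chr 1 t * fourier 1 (x : AddCircle (2 * π))
    rw [← AddCircle.coe_add, fourier_coe_apply, fourier_coe_apply, chr, ← Complex.exp_add]
    congr 1
    have h : (π : ℂ) ≠ 0 := by exact_mod_cast Real.pi_ne_zero
    push_cast
    field_simp

/-- Translation in the first variable. -/
def flowX : CircleFlow Torus volume where
  τ t := ⟨fun q => ((t : AddCircle (2 * π)) + q.1, q.2), by fun_prop⟩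
  cont := by
    have h : Continuous fun t : ℝ => (t : AddCircle (2 * π)) := AddCircle.continuous_mk' _
    exact ((h.comp continuous_fst).add (continuous_fst.comp continuous_snd)).prodMk
      (continuous_snd.comp continuous_snd)
  zero' q := by simp
  add' s t q := by simp [add_assoc]
  periodic' s := by
    ext q <;> simp
  mp s := (measurePreserving_add_left volume (s : AddCircle (2 * π))).prod (MeasurePreserving.id volume)
  χ := (fourier 1).comp ContinuousMap.fst
  norm_χ q := by
    change ‖fourier 1 q.1‖ = 1
    exact Circle.norm_coe _
  χ_τ t q := fourier_add_coe t q.1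

/-- Translation in the second variable. -/
def flowY : CircleFlow Torus volume where
  τ t := ⟨fun q => (q.1, (t : AddCircle (2 * π)) + q.2), by fun_prop⟩
  cont := by
    have h : Continuous fun t : ℝ => (t : AddCircle (2 * π)) := AddCircle.continuous_mk' _
    exact (continuous_fst.comp continuous_snd).prodMk
      ((h.comp continuous_fst).add (continuous_snd.comp continuous_snd))
  zero' q := by simp
  add' s t q := by simp [add_assoc]
  periodic' s := by
    ext q <;> simp
  mp s := (MeasurePreserving.id volume).prod (measurePreserving_add_left volume (s : AddCircle (2 * π)))
  χ := (fourier 1).comp ContinuousMap.snd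
  norm_χ q := by
    change ‖fourier 1 q.2‖ = 1
    exact Circle.norm_coe _
  χ_τ t q := fourier_add_coe t q.2

@[simp] theorem flowX_τ (t : ℝ) (q : Torus) : flowX.τ t q = ((t : AddCircle (2 * π)) + q.1, q.2) := rfl

@[simp] theorem flowY_τ (t : ℝ) (q : Torus) : flowY.τ t q = (q.1, (t : AddCircle (2 * π)) + q.2) := rfl

variable (p : ℝ) [Fact (1 ≤ ENNReal.ofReal p)]

/-- Translations in the first variable on `L_p` of the torus. -/
abbrev FX : IsoFlow (Lp ℂ (ENNReal.ofReal p) (volume : Measure Torus)) := flowX.flowLp p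

/-- Translations in the second variable on `L_p` of the torus. -/
abbrev FY : IsoFlow (Lp ℂ (ENNReal.ofReal p) (volume : Measure Torus)) := flowY.flowLp p

theorem comm_FX_FY : IsoFlow.Comm (FX p) (FY p) := by
  intro s t u
  refine Lp.ext ?_
  have h1 := flowX.coeFn_flowLp_T (p := p) s ((FY p).T t u)
  have h2 := (flowX.mp s).quasiMeasurePreserving.ae_eq (flowY.coeFn_flowLp_T (p := p) t u)
  have h3 := flowY.coeFn_flowLp_T (p := p) t ((FX p).T s u)
  have h4 := (flowY.mp t).quasiMeasurePreserving.ae_eq (flowX.coeFn_flowLp_T (p := p) s u)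
  exact (h1.trans h2).trans (h3.trans h4).symm

variable {p}

theorem exists_rieszBound_FX (hp : 1 < p) : ∃ R, (FX p).RieszBound R := flowX.exists_rieszBound hp

theorem exists_rieszBound_FY (hp : 1 < p) : ∃ R, (FY p).RieszBound R := flowY.exists_rieszBound hp

end Torus

namespace Torus

/-- The exponential of frequency `(m, n)`. -/
def expo (m n : ℤ) : C(Torus, ℂ) := flowX.chi m * flowY.chi n

theorem expo_coe (m n : ℤ) (s t : ℝ) :
    expo m n ((s : AddCircle (2 * π)), (t : AddCircle (2 * π))) = chr m s * chr n t := by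
  have h1 : flowX.χ ((0 : AddCircle (2 * π)), (t : AddCircle (2 * π))) = 1 := by
    change fourier 1 (0 : AddCircle (2 * π)) = 1
    simp
  have h2 : flowY.χ ((s : AddCircle (2 * π)), (0 : AddCircle (2 * π))) = 1 := by
    change fourier 1 (0 : AddCircle (2 * π)) = 1
    simp
  have h3 := flowX.chi_τ m s ((0 : AddCircle (2 * π)), (t : AddCircle (2 * π)))
  have h4 := flowY.chi_τ n t ((s : AddCircle (2 * π)), (0 : AddCircle (2 * π)))
  rw [flowX_τ, add_zero, flowX.chi_apply m (0, _), h1, one_zpow, mul_one] at h3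
  rw [flowY_τ, add_zero, flowY.chi_apply n (_, 0), h2, one_zpow, mul_one] at h4
  change flowX.chi m _ * flowY.chi n _ = _
  rw [h3, h4]

theorem integral_eq_intervalIntegral {u : Torus → ℂ} (hu : Integrable u) :
    ∫ q, u q = ∫ x in (0:ℝ)..2 * π, ∫ y in (0:ℝ)..2 * π,
      u ((x : AddCircle (2 * π)), (y : AddCircle (2 * π))) := by
  rw [show (volume : Measure Torus) = (volume : Measure (AddCircle (2 * π))).prod volume from rfl,
    integral_prod u hu, ← AddCircle.intervalIntegral_preimage (2 * π) 0, zero_add]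
  refine intervalIntegral.integral_congr fun x _ => ?_
  have := AddCircle.intervalIntegral_preimage (2 * π) 0
    fun b => u ((x : AddCircle (2 * π)), b)
  rw [zero_add] at this
  exact this.symm

theorem flowC_S_S (m n : ℤ) (u : C(Torus, ℂ)) :
    flowX.flowC.S m (flowY.flowC.S n u) =
      ((((2 * π) ^ 2)⁻¹ : ℝ) * ∫ q, u q * expo (-m) (-n) q : ℂ) • expo m n := by
  set W := flowX.flowC.S m (flowY.flowC.S n u) with hW
  have hc : IsoFlow.Comm flowX.flowC flowY.flowC := fun s t v => rfl
  have hW' : W = flowY.flowC.S n (flowX.flowC.S m u) := hc.S_S m n u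
  have hx (t : ℝ) (q : Torus) : W (flowX.τ t q) = chr m t * W q := by
    have := congrArg (fun v : C(Torus, ℂ) => v q) (flowX.flowC.T_S m t (flowY.flowC.S n u))
    exact this
  have hy (t : ℝ) (q : Torus) : W (flowY.τ t q) = chr n t * W q := by
    have := congrArg (fun v : C(Torus, ℂ) => v q) (flowY.flowC.T_S n t (flowX.flowC.S m u))
    rw [hW']
    exact this
  have h0 : W ((0 : AddCircle (2 * π)), (0 : AddCircle (2 * π))) =
      (((2 * π) ^ 2)⁻¹ : ℝ) * ∫ q, u q * expo (-m) (-n) q := by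
    rw [integral_eq_intervalIntegral]
    · rw [hW, CircleFlow.flowC_S_apply, show ((2 * π) ^ 2)⁻¹ = (2 * π)⁻¹ * (2 * π)⁻¹ by rw [sq, mul_inv],
        Complex.real_smul, Complex.ofReal_mul, mul_assoc]
      congr 1
      rw [← intervalIntegral.integral_const_mul]
      refine intervalIntegral.integral_congr fun x _ => ?_
      rw [CircleFlow.flowC_S_apply, Complex.real_smul, mul_left_comm,
        ← intervalIntegral.integral_const_mul]
      congr 1
      refine intervalIntegral.integral_congr fun y _ => ?_
      rw [expo_coe, flowX_τ, flowY_τ, add_zero, add_zero]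
      ring
    · exact (u.continuous.mul (expo (-m) (-n)).continuous).integrable_of_hasCompactSupport
        (HasCompactSupport.of_compactSpace _)
  ext ⟨a, b⟩
  induction a using QuotientAddGroup.induction_on with
  | H s =>
  induction b using QuotientAddGroup.induction_on with
  | H t =>
    have e1 := hx s ((0 : AddCircle (2 * π)), (t : AddCircle (2 * π)))
    have e2 := hy t ((0 : AddCircle (2 * π)), (0 : AddCircle (2 * π)))
    rw [flowX_τ, add_zero] at e1
    rw [flowY_τ, add_zero] at e2
    change W ((s : AddCircle (2 * π)), (t : AddCircle (2 * π))) = _ * expo m n (_, _)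
    refine e1.trans ?_
    refine Eq.trans ?_ (congrArg _ (expo_coe m n s t).symm)
    change chr m s * W (0, (t : AddCircle (2 * π))) = _
    rw [e2, h0]
    ring

variable {p : ℝ} [Fact (1 ≤ ENNReal.ofReal p)]

theorem S_S (hp : 1 < p) (m n : ℤ) (u : Lp ℂ (ENNReal.ofReal p) (volume : Measure Torus)) :
    (FX p).S m ((FY p).S n u) =
      ((((2 * π) ^ 2)⁻¹ : ℝ) * ∫ q, u q * expo (-m) (-n) q : ℂ) •
        ContinuousMap.toLp (ENNReal.ofReal p) volume ℂ (expo m n) := by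
  have hpq := Real.HolderConjugate.conjExponent hp
  have : Fact (1 ≤ ENNReal.ofReal p.conjExponent) := ⟨by simpa using hpq.symm.lt.le⟩
  set E : Lp ℂ (ENNReal.ofReal p.conjExponent) (volume : Measure Torus) :=
    ContinuousMap.toLp (ENNReal.ofReal p.conjExponent) volume ℂ (expo (-m) (-n)) with hE
  have hint (v : Lp ℂ (ENNReal.ofReal p) (volume : Measure Torus)) :
      ∫ q, v q * expo (-m) (-n) q = (lpPair volume hpq).flip E v := by
    rw [ContinuousLinearMap.flip_apply, lpPair_apply]
    refine integral_congr_ae ?_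
    filter_upwards [ContinuousMap.coeFn_toLp (p := ENNReal.ofReal p.conjExponent) volume (𝕜 := ℂ)
      (expo (-m) (-n))] with q hq
    rw [hE, hq]
  rw [hint]
  refine DenseRange.induction_on (p := fun v => (FX p).S m ((FY p).S n v) =
      ((((2 * π) ^ 2)⁻¹ : ℝ) * (lpPair volume hpq).flip E v : ℂ) •
        ContinuousMap.toLp (ENNReal.ofReal p) volume ℂ (expo m n))
    (ContinuousMap.toLp_denseRange ℂ (volume : Measure Torus) ℂ ENNReal.ofReal_ne_top) u
    (isClosed_eq (by fun_prop) (by fun_prop)) fun v => ?_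
  rw [← hint, ← CircleFlow.toLp_flowC_S, ← CircleFlow.toLp_flowC_S, flowC_S_S, map_smul]
  congr 2
  refine integral_congr_ae ?_
  filter_upwards [ContinuousMap.coeFn_toLp (p := ENNReal.ofReal p) volume (𝕜 := ℂ) v] with q hq
  rw [hq]

end Torus

namespace CircleFlow

variable {Ω : Type*} [TopologicalSpace Ω] [MeasurableSpace Ω] {μ : Measure Ω} (Φ : CircleFlow Ω μ)

/-- The fractional difference of a real function along the flow, computed pointwise. -/
def realDiff (α h : ℝ) (u : Ω → ℝ) (ω : Ω) : ℝ := ∑' ν : ℕ, diffCoeff α ν * u (Φ.τ ((α - ν) * h) ω)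

variable [BorelSpace Ω] [R1Space Ω] [μ.InnerRegularCompactLTTop] [IsLocallyFiniteMeasure μ]
variable {p : ℝ} [Fact (1 ≤ ENNReal.ofReal p)]

theorem realDiff_ae_eq {α : ℝ} (hα : 0 < α) (h : ℝ) {u : Ω → ℝ} {U : Lp ℂ (ENNReal.ofReal p) μ}
    (hu : (fun ω => (u ω : ℂ)) =ᵐ[μ] U) :
    (fun ω => (Φ.realDiff α h u ω : ℂ)) =ᵐ[μ] (Φ.flowLp p).diff α h U := by
  have hs : ∑' ν : ℕ, ‖(diffCoeff α ν : ℂ) • (Φ.flowLp p).T ((α - ν) * h) U‖ₑ ≠ ∞ := by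
    refine tsum_enorm_ne_top_iff_summable_norm.2 ?_
    refine Summable.of_nonneg_of_le (fun _ => norm_nonneg _) (fun ν => ?_)
      ((summable_abs_diffCoeff hα).mul_right ‖U‖)
    exact (((diffCoeff α ν : ℂ) • (Φ.flowLp p).T ((α - ν) * h)).le_opNorm U).trans
      (mul_le_mul_of_nonneg_right ((Φ.flowLp p).norm_diff_term_le α h ν) (norm_nonneg _))
  have h1 := Lp.coeFn_tsum hs
  rw [((Φ.flowLp p).hasSum_diff hα h U).tsum_eq] at h1
  have h2 : ∀ᵐ ω ∂μ, ∀ ν : ℕ, ((diffCoeff α ν : ℂ) • (Φ.flowLp p).T ((α - ν) * h) U :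
      Lp ℂ (ENNReal.ofReal p) μ) ω = ((diffCoeff α ν * u (Φ.τ ((α - ν) * h) ω) : ℝ) : ℂ) := by
    refine ae_all_iff.2 fun ν => ?_
    filter_upwards [Lp.coeFn_smul (diffCoeff α ν : ℂ) ((Φ.flowLp p).T ((α - ν) * h) U),
      Φ.coeFn_flowLp_T (p := p) ((α - ν) * h) U,
      (Φ.mp ((α - ν) * h)).quasiMeasurePreserving.ae_eq hu] with ω e1 e2 e3
    rw [e1, Pi.smul_apply, e2]
    change _ * U (Φ.τ ((α - ν) * h) ω) = _
    rw [Complex.ofReal_mul]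
    exact congrArg _ e3.symm
  filter_upwards [h1, h2] with ω e1 e2
  rw [e1, realDiff, Complex.ofReal_tsum]
  exact tsum_congr fun ν => (e2 ν).symm

end CircleFlow

namespace Torus

/-- The doubly periodic function on the plane induced by a function on the torus. -/
def per (u : Torus → ℝ) : ℝ → ℝ → ℝ := fun x y => u ((x : AddCircle (2 * π)), (y : AddCircle (2 * π)))

theorem exists_per_eq {f : ℝ → ℝ → ℝ} (hf : Measurable (Function.uncurry f))
    (hx : ∀ y, Function.Periodic (fun x => f x y) (2 * π))
    (hy : ∀ x, Function.Periodic (f x) (2 * π)) : ∃ u : Torus → ℝ, Measurable u ∧ per u = f := by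
  set r : AddCircle (2 * π) → ℝ := fun a => (AddCircle.equivIoc (2 * π) 0 a : ℝ) with hr
  have hrm : Measurable r :=
    measurable_subtype_coe.comp (AddCircle.measurableEquivIoc (2 * π) 0).measurable
  have hper {g : ℝ → ℝ} (hg : Function.Periodic g (2 * π)) (x : ℝ) :
      g (r (x : AddCircle (2 * π))) = g x := by
    rw [← hg.lift_coe (r x), ← hg.lift_coe x]
    exact congrArg _ AddCircle.coe_equivIoc
  refine ⟨fun q => f (r q.1) (r q.2), hf.comp ((hrm.comp measurable_fst).prodMk
    (hrm.comp measurable_snd)), ?_⟩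
  ext x y
  exact (hper (hx _) x).trans (hper (hy x) y)

theorem diffX_per (α h : ℝ) (u : Torus → ℝ) : diffX α h (per u) = per (flowX.realDiff α h u) := by
  ext x y
  refine tsum_congr fun ν => ?_
  rw [diffCoeff, flowX_τ, per]
  congr 3
  rw [add_comm x, AddCircle.coe_add]

theorem diffY_per (α h : ℝ) (u : Torus → ℝ) : diffY α h (per u) = per (flowY.realDiff α h u) := by
  ext x y
  refine tsum_congr fun ν => ?_
  rw [diffCoeff, flowY_τ, per]
  congr 3
  rw [add_comm y, AddCircle.coe_add]

theorem lintegral_per (G : AddCircle (2 * π) → AddCircle (2 * π) → ℝ≥0∞) :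
    ∫⁻ x in Set.Ioc (0:ℝ) (2 * π), ∫⁻ y in Set.Ioc (0:ℝ) (2 * π),
      G (x : AddCircle (2 * π)) (y : AddCircle (2 * π)) = ∫⁻ a, ∫⁻ b, G a b := by
  have h1 (a : AddCircle (2 * π)) : ∫⁻ y in Set.Ioc (0:ℝ) (2 * π), G a (y : AddCircle (2 * π)) =
      ∫⁻ b, G a b := by
    have := AddCircle.lintegral_preimage (2 * π) 0 (G a)
    rwa [zero_add] at this
  simp only [h1]
  have := AddCircle.lintegral_preimage (2 * π) 0 fun a => ∫⁻ b, G a b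
  rwa [zero_add] at this

variable {p : ℝ}

theorem Lp2Norm_per (hp : 0 < p) {u : Torus → ℝ} {v : Torus → ℂ}
    (hv : AEStronglyMeasurable v volume) (hu : (fun q => (u q : ℂ)) =ᵐ[volume] v) :
    Lp2Norm p (per u) = eLpNorm v (ENNReal.ofReal p) volume := by
  rw [← ENNReal.rpow_rpow_inv hp.ne' (eLpNorm v _ _), eLpNorm_ofReal_rpow hp, ← one_div, Lp2Norm]
  congr 1
  refine (lintegral_per fun a b => ENNReal.ofReal (|u (a, b)| ^ p)).trans ?_
  have hm : AEMeasurable (fun q => ‖v q‖ₑ ^ p) (volume : Measure Torus) := hv.enorm.pow_const p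
  refine Eq.trans ?_ (lintegral_prod (μ := (volume : Measure (AddCircle (2 * π)))) (ν := volume)
    (fun q => ‖v q‖ₑ ^ p) hm).symm
  refine lintegral_congr_ae ?_
  filter_upwards [Measure.ae_ae_of_ae_prod (μ := volume) (ν := volume) hu] with a ha
  refine lintegral_congr_ae ?_
  filter_upwards [ha] with b hb
  rw [← hb, enorm_rpow_eq_ofReal hp.le, Complex.norm_real, Real.norm_eq_abs]

variable [Fact (1 ≤ ENNReal.ofReal p)]

theorem mixedMod_per (hp : 0 < p) {α₁ α₂ : ℝ} (hα₁ : 0 < α₁) (hα₂ : 0 < α₂) (δ₁ δ₂ : ℝ)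
    {u : Torus → ℝ} {U : Lp ℂ (ENNReal.ofReal p) (volume : Measure Torus)}
    (hu : (fun q => (u q : ℂ)) =ᵐ[volume] U) :
    mixedMod p α₁ α₂ δ₁ δ₂ (per u) = ⨆ (h₁ : ℝ) (_ : |h₁| ≤ δ₁) (h₂ : ℝ) (_ : |h₂| ≤ δ₂),
      ‖(FX p).diff α₁ h₁ ((FY p).diff α₂ h₂ U)‖ₑ := by
  rw [mixedMod]
  refine iSup_congr fun h₁ => iSup_congr fun _ => iSup_congr fun h₂ => iSup_congr fun _ => ?_
  rw [diffY_per, diffX_per]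
  exact (Lp2Norm_per hp (Lp.aestronglyMeasurable _) (flowX.realDiff_ae_eq hα₁ h₁ (flowY.realDiff_ae_eq hα₂ h₂ hu))).trans (Lp.enorm_def _).symm

theorem fourierCoefZ_per {u : Torus → ℝ} (hu : Integrable fun q => (u q : ℂ)) (m n : ℤ) :
    fourierCoefZ (per u) m n = (((2 * π) ^ 2)⁻¹ : ℝ) * ∫ q, (u q : ℂ) * expo (-m) (-n) q := by
  rw [fourierCoefZ, integral_eq_intervalIntegral]
  · congr 1
    refine intervalIntegral.integral_congr fun x _ => intervalIntegral.integral_congr fun y _ => ?_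
    rw [expo_coe, per, chr, chr, ← Complex.exp_add]
    congr 2
    push_cast
    ring
  · exact hu.mul_bdd (c := ‖expo (-m) (-n)‖) (expo (-m) (-n)).continuous.aestronglyMeasurable
      (.of_forall fun q => (expo (-m) (-n)).norm_coe_le_norm q)

end Torus

theorem IsoFlow.S_zero_eq_self {X : Type*} [NormedAddCommGroup X] [NormedSpace ℂ X]
    [CompleteSpace X] (F : IsoFlow X) {x : X} (hx : ∀ t, F.T t x = x) : F.S 0 x = x := by
  rw [F.S_apply]
  simp only [neg_zero, chr_zero_left, hx, one_smul]
  rw [intervalIntegral.integral_const, sub_zero, smul_smul, inv_mul_cancel₀ Real.two_pi_pos.ne',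
    one_smul]

namespace CircleFlow

variable {Ω : Type*} [TopologicalSpace Ω] [MeasurableSpace Ω] {μ : Measure Ω} (Φ : CircleFlow Ω μ)
variable [BorelSpace Ω] [R1Space Ω] [μ.InnerRegularCompactLTTop] [IsFiniteMeasure μ]
variable {p : ℝ} [Fact (1 ≤ ENNReal.ofReal p)]

theorem setIntegral_eq_zero (hp : 1 < p) {U : Lp ℂ (ENNReal.ofReal p) μ} (hU : (Φ.flowLp p).S 0 U = 0)
    {A : Set Ω} (hA : MeasurableSet A) (hinv : ∀ t, Φ.τ t ⁻¹' A = A) : ∫ ω in A, U ω ∂μ = 0 := by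
  have hpq := Real.HolderConjugate.conjExponent hp
  have : Fact (1 ≤ ENNReal.ofReal p.conjExponent) := ⟨by simpa using hpq.symm.lt.le⟩
  have hV := memLp_indicator_const (ENNReal.ofReal p.conjExponent) hA (1 : ℂ)
    (Or.inr (measure_ne_top μ A))
  have h1 (t : ℝ) : (Φ.flowLp p.conjExponent).T t (hV.toLp _) = hV.toLp _ := by
    rw [Φ.flowLp_T_toLp _ hV t]
    congr 1
    conv_rhs => rw [← hinv t]
    ext ω
    exact (Set.indicator_comp_right (Φ.τ t) (s := A) (g := fun _ => (1 : ℂ)) (x := ω)).symm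
  have h2 := (Φ.adjoint_flowLp hpq).S 0 U (hV.toLp _)
  rw [IsoFlow.rev_S, neg_zero, IsoFlow.S_zero_eq_self _ h1, hU, map_zero,
    zero_apply, lpPair_apply] at h2
  rw [h2, ← integral_indicator hA]
  refine integral_congr_ae ?_
  filter_upwards [hV.coeFn_toLp] with ω hω
  rw [hω]
  by_cases h : ω ∈ A <;> simp [h]

end CircleFlow

namespace Torus

/-- The complex space `L_p` of the torus. -/
abbrev TorusLp (p : ℝ) : Type := Lp ℂ (ENNReal.ofReal p) (volume : Measure Torus)

variable {p : ℝ} [Fact (1 ≤ ENNReal.ofReal p)]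

theorem integrable_Lp (U : TorusLp p) : Integrable U :=
  (Lp.memLp U).integrable (Fact.out : 1 ≤ ENNReal.ofReal p)

theorem integrable_mul_expo {u : Torus → ℂ} (hu : Integrable u) (m n : ℤ) :
    Integrable fun q => u q * expo m n q :=
  hu.mul_bdd (c := ‖expo m n‖) (expo m n).continuous.aestronglyMeasurable
    (.of_forall fun q => (expo m n).norm_coe_le_norm q)

/-- The (unnormalized) Fourier coefficients. -/
def coef (u : Torus → ℂ) (m n : ℤ) : ℂ := ∫ q, u q * expo (-m) (-n) q

theorem coef_congr {u v : Torus → ℂ} (h : u =ᵐ[volume] v) (m n : ℤ) : coef u m n = coef v m n := by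
  refine integral_congr_ae ?_
  filter_upwards [h] with q hq
  rw [hq]

theorem toLp_expo_ne_zero (m n : ℤ) :
    ContinuousMap.toLp (ENNReal.ofReal p) (volume : Measure Torus) ℂ (expo m n) ≠ 0 := by
  intro h
  have h0 := ContinuousMap.toLp_injective (p := ENNReal.ofReal p) (𝕜 := ℂ) (volume : Measure Torus)
    (h.trans (map_zero _).symm)
  have h1 := expo_coe m n 0 0
  rw [h0, chr_zero_right, chr_zero_right] at h1
  exact zero_ne_one (h1.trans (one_mul _))

theorem isDeriv_iff (hp : 1 < p) {r₁ r₂ : ℝ} {U V : TorusLp p} :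
    IsoFlow.IsDeriv (FX p) (FY p) r₁ r₂ U V ↔ ∀ m n : ℤ, coef V m n =
      (Complex.I * (m : ℂ)) ^ (r₁ : ℂ) * (Complex.I * (n : ℂ)) ^ (r₂ : ℂ) * coef U m n := by
  refine forall_congr' fun m => forall_congr' fun n => ?_
  rw [S_S hp, S_S hp, smul_smul, smul_left_inj (toLp_expo_ne_zero m n), mul_left_comm]
  have h : ((((2 * π) ^ 2)⁻¹ : ℝ) : ℂ) ≠ 0 := by
    exact_mod_cast (inv_pos.2 (pow_pos Real.two_pi_pos 2)).ne'
  exact mul_right_inj' h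

theorem ext_coef (hp : 1 < p) {U V : TorusLp p} (h : ∀ m n, coef U m n = coef V m n) : U = V := by
  refine IsoFlow.ext_S₂ (FX p) (FY p) fun m n => ?_
  rw [S_S hp, S_S hp]
  congr 2
  exact h m n

theorem S_X_zero_eq_zero (hp : 1 < p) {U : TorusLp p} (h : ∀ n, coef U 0 n = 0) : (FX p).S 0 U = 0 := by
  refine IsoFlow.ext_S₂ (FX p) (FY p) fun m n => ?_
  rw [← (comm_FX_FY p).S_S, IsoFlow.S_S]
  split_ifs with h0
  · rw [h0, S_S hp]
    have := h n
    rw [coef, neg_zero] at this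
    simp [this]
  · simp

theorem S_Y_zero_eq_zero (hp : 1 < p) {U : TorusLp p} (h : ∀ m, coef U m 0 = 0) : (FY p).S 0 U = 0 := by
  refine IsoFlow.ext_S₂ (FX p) (FY p) fun m n => ?_
  rw [IsoFlow.S_S]
  split_ifs with h0
  · rw [h0, S_S hp]
    have := h m
    rw [coef, neg_zero] at this
    simp [this]
  · simp

end Torus

namespace Torus

theorem ae_real_of_ae_circle {P : AddCircle (2 * π) → Prop} (h : ∀ᵐ a, P a) :
    ∀ᵐ x : ℝ, P (x : AddCircle (2 * π)) := by
  rw [← Measure.restrict_univ (μ := (volume : Measure ℝ)), ← iUnion_Ioc_zsmul Real.two_pi_pos,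
    ae_restrict_iUnion_iff]
  intro n
  have := (AddCircle.measurePreserving_mk (2 * π) (n • (2 * π))).quasiMeasurePreserving.ae h
  rwa [add_zsmul, one_zsmul]

theorem intervalIntegral_coe {E : Type*} [NormedAddCommGroup E] [NormedSpace ℝ E]
    (g : AddCircle (2 * π) → E) :
    ∫ x in (0:ℝ)..2 * π, g (x : AddCircle (2 * π)) = ∫ a, g a := by
  have := AddCircle.intervalIntegral_preimage (2 * π) 0 g
  rwa [zero_add] at this

theorem ae_mean_x_eq_zero {u : Torus → ℝ} (hu : Integrable u)
    (h : ∀ A : Set (AddCircle (2 * π)), MeasurableSet A → ∫ q in Set.univ ×ˢ A, u q = 0) :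
    ∀ᵐ y : ℝ, ∫ x in (0:ℝ)..2 * π, per u x y = 0 := by
  have h1 : (fun b : AddCircle (2 * π) => ∫ a : AddCircle (2 * π), u (a, b)) =ᵐ[volume] 0 := by
    refine Integrable.ae_eq_zero_of_forall_setIntegral_eq_zero hu.integral_prod_right fun A hA _ => ?_
    rw [← h A hA]
    have e : (volume : Measure Torus).restrict (Set.univ ×ˢ A) =
        (volume : Measure (AddCircle (2 * π))).prod (volume.restrict A) := by
      rw [show (volume : Measure Torus) = (volume : Measure (AddCircle (2 * π))).prod volume from rfl,
        ← Measure.prod_restrict, Measure.restrict_univ]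
    have hi : Integrable u ((volume : Measure (AddCircle (2 * π))).prod (volume.restrict A)) := by
      rw [← e]
      exact hu.restrict
    rw [e, integral_prod_symm u hi]
  filter_upwards [ae_real_of_ae_circle h1] with y hy
  exact (intervalIntegral_coe fun a => u (a, (y : AddCircle (2 * π)))).trans hy

theorem ae_mean_y_eq_zero {u : Torus → ℝ} (hu : Integrable u)
    (h : ∀ A : Set (AddCircle (2 * π)), MeasurableSet A → ∫ q in A ×ˢ Set.univ, u q = 0) :
    ∀ᵐ x : ℝ, ∫ y in (0:ℝ)..2 * π, per u x y = 0 := by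
  have h1 : (fun a : AddCircle (2 * π) => ∫ b : AddCircle (2 * π), u (a, b)) =ᵐ[volume] 0 := by
    refine Integrable.ae_eq_zero_of_forall_setIntegral_eq_zero hu.integral_prod_left fun A hA _ => ?_
    rw [← h A hA]
    have e : (volume : Measure Torus).restrict (A ×ˢ Set.univ) =
        (volume.restrict A).prod (volume : Measure (AddCircle (2 * π))) := by
      rw [show (volume : Measure Torus) = (volume : Measure (AddCircle (2 * π))).prod volume from rfl,
        ← Measure.prod_restrict, Measure.restrict_univ]
    have hi : Integrable u ((volume.restrict A).prod (volume : Measure (AddCircle (2 * π)))) := by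
      rw [← e]
      exact hu.restrict
    rw [e, integral_prod u hi]
  filter_upwards [ae_real_of_ae_circle h1] with x hx
  exact (intervalIntegral_coe fun b => u ((x : AddCircle (2 * π)), b)).trans hx

theorem coef_zero_left {u : Torus → ℝ} (hu : Integrable fun q => (u q : ℂ))
    (h : ∀ᵐ y : ℝ, ∫ x in (0:ℝ)..2 * π, per u x y = 0) (n : ℤ) : coef (fun q => (u q : ℂ)) 0 n = 0 := by
  have hi := integrable_mul_expo hu (-0) (-n)
  rw [coef, show (volume : Measure Torus) = (volume : Measure (AddCircle (2 * π))).prod volume from rfl,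
    integral_prod_symm _ hi, ← intervalIntegral_coe]
  refine intervalIntegral.integral_zero_ae ?_
  filter_upwards [h] with y hy _
  rw [← intervalIntegral_coe]
  simp only [expo_coe, neg_zero, chr_zero_left, one_mul]
  rw [intervalIntegral.integral_mul_const, intervalIntegral.integral_ofReal]
  change ((∫ x in (0:ℝ)..2 * π, per u x y : ℝ) : ℂ) * _ = 0
  rw [hy, Complex.ofReal_zero, zero_mul]

theorem coef_zero_right {u : Torus → ℝ} (hu : Integrable fun q => (u q : ℂ))
    (h : ∀ᵐ x : ℝ, ∫ y in (0:ℝ)..2 * π, per u x y = 0) (m : ℤ) : coef (fun q => (u q : ℂ)) m 0 = 0 := by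
  have hi := integrable_mul_expo hu (-m) (-0)
  rw [coef, show (volume : Measure Torus) = (volume : Measure (AddCircle (2 * π))).prod volume from rfl,
    integral_prod _ hi, ← intervalIntegral_coe]
  refine intervalIntegral.integral_zero_ae ?_
  filter_upwards [h] with x hx _
  rw [← intervalIntegral_coe]
  simp only [expo_coe, neg_zero, chr_zero_left, mul_one]
  rw [intervalIntegral.integral_mul_const, intervalIntegral.integral_ofReal]
  change ((∫ y in (0:ℝ)..2 * π, per u x y : ℝ) : ℂ) * _ = 0
  rw [hx, Complex.ofReal_zero, zero_mul]

variable {p : ℝ} [Fact (1 ≤ ENNReal.ofReal p)]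

theorem exists_toLp_of_memLp0 (hp : 1 < p) {u : Torus → ℝ} (hu : Measurable u) (h : MemLp0 p (per u)) :
    ∃ U : TorusLp p, (fun q => (u q : ℂ)) =ᵐ[volume] U ∧ (FX p).S 0 U = 0 ∧ (FY p).S 0 U = 0 := by
  have hm : AEStronglyMeasurable (fun q => (u q : ℂ)) volume :=
    (Complex.measurable_ofReal.comp hu).aestronglyMeasurable
  have hL : MemLp (fun q => (u q : ℂ)) (ENNReal.ofReal p) volume := by
    refine ⟨hm, ?_⟩
    rw [← Lp2Norm_per (by linarith) hm (ae_eq_refl _)]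
    exact h.norm_ne_top.lt_top
  have hi := hL.integrable (Fact.out : 1 ≤ ENNReal.ofReal p)
  refine ⟨hL.toLp _, hL.coeFn_toLp.symm, S_X_zero_eq_zero hp fun n => ?_,
    S_Y_zero_eq_zero hp fun m => ?_⟩
  · rw [coef_congr hL.coeFn_toLp, coef_zero_left hi h.mean_x]
  · rw [coef_congr hL.coeFn_toLp, coef_zero_right hi h.mean_y]

theorem memLp0_per (hp : 1 < p) {u : Torus → ℝ} (hu : Measurable u) {U : TorusLp p}
    (hU : (fun q => (u q : ℂ)) =ᵐ[volume] U) (hX : (FX p).S 0 U = 0) (hY : (FY p).S 0 U = 0) :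
    MemLp0 p (per u) := by
  have hi : Integrable u := by
    have := ((integrable_Lp U).congr hU.symm).re
    simpa using this
  have hs (A : Set Torus) (h : ∫ q in A, U q = 0) : ∫ q in A, u q = 0 := by
    rw [← Complex.ofReal_eq_zero, ← integral_complex_ofReal, ← h]
    exact integral_congr_ae (ae_restrict_of_ae hU)
  refine ⟨?_, fun y x => ?_, fun x y => ?_, ?_, ?_, ?_⟩
  · have h : Measurable fun x : ℝ => (x : AddCircle (2 * π)) := AddCircle.measurable_mk'
    exact hu.comp ((h.comp measurable_fst).prodMk (h.comp measurable_snd))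
  · simp only [per, AddCircle.coe_add_period]
  · simp only [per, AddCircle.coe_add_period]
  · rw [Lp2Norm_per (by linarith) (Lp.aestronglyMeasurable U) hU]
    exact Lp.eLpNorm_ne_top U
  · refine ae_mean_x_eq_zero hi fun A hA => hs _ ?_
    refine flowX.setIntegral_eq_zero hp hX (MeasurableSet.univ.prod hA) fun t => ?_
    ext q
    simp
  · refine ae_mean_y_eq_zero hi fun A hA => hs _ ?_
    refine flowY.setIntegral_eq_zero hp hY (hA.prod MeasurableSet.univ) fun t => ?_
    ext q
    simp

theorem conj_expo (m n : ℤ) (q : Torus) : (starRingEnd ℂ) (expo m n q) = expo (-m) (-n) q := by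
  obtain ⟨a, b⟩ := q
  induction a using QuotientAddGroup.induction_on with
  | H s =>
  induction b using QuotientAddGroup.induction_on with
  | H t =>
    have h1 := expo_coe m n s t
    have h2 := expo_coe (-m) (-n) s t
    rw [chr_neg_left, chr_neg_left, ← map_mul, ← h1] at h2
    exact h2.symm

theorem conj_weyl (m : ℤ) (r : ℝ) :
    (starRingEnd ℂ) ((Complex.I * ((-m : ℤ) : ℂ)) ^ (r : ℂ)) = (Complex.I * (m : ℂ)) ^ (r : ℂ) := by
  have h : (Complex.I * (m : ℂ)).arg ≠ π := by
    rw [Ne, Complex.arg_eq_pi_iff]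
    simp
  have := Complex.cpow_conj (Complex.I * (m : ℂ)) (r : ℂ) h
  rw [Complex.conj_ofReal] at this
  rw [this]
  congr 2
  simp

theorem conj_coef (u : Torus → ℂ) (m n : ℤ) :
    (starRingEnd ℂ) (coef u m n) = coef (fun q => (starRingEnd ℂ) (u q)) (-m) (-n) := by
  rw [coef, coef, ← integral_conj]
  refine integral_congr_ae (.of_forall fun q => ?_)
  dsimp only
  rw [map_mul, conj_expo]

theorem re_ae_eq_of_isDeriv (hp : 1 < p) {r₁ r₂ : ℝ} {u : Torus → ℝ} {U V : TorusLp p}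
    (hU : (fun q => (u q : ℂ)) =ᵐ[volume] U) (hV : IsoFlow.IsDeriv (FX p) (FY p) r₁ r₂ U V) :
    (fun q => ((V q).re : ℂ)) =ᵐ[volume] V := by
  rw [isDeriv_iff hp] at hV
  have hL : MemLp (fun q => ((V q).re : ℂ)) (ENNReal.ofReal p) volume := (Lp.memLp V).re.ofReal
  have hE : hL.toLp _ = V := by
    refine ext_coef hp fun m n => ?_
    have hc : coef (fun q => (starRingEnd ℂ) (V q)) m n = coef V m n := by
      have h1 := conj_coef V (-m) (-n)
      rw [neg_neg, neg_neg] at h1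
      rw [← h1, hV, hV, map_mul, map_mul, conj_weyl, conj_weyl, ← coef_congr hU, ← coef_congr hU,
        conj_coef, neg_neg, neg_neg]
      simp only [Complex.conj_ofReal]
    have h2 : coef (fun q => ((V q).re : ℂ)) m n =
        (coef V m n + coef (fun q => (starRingEnd ℂ) (V q)) m n) / 2 := by
      have hi := integrable_Lp V
      have hi' : Integrable fun q => (starRingEnd ℂ) (V q) :=
        (Complex.conjLIE : ℂ →L[ℝ] ℂ).integrable_comp hi
      rw [coef, coef, coef, ← integral_add (integrable_mul_expo hi _ _) (integrable_mul_expo hi' _ _),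
        ← integral_div]
      refine integral_congr_ae (.of_forall fun q => ?_)
      dsimp only
      rw [← add_mul, Complex.add_conj]
      push_cast
      ring
    rw [coef_congr hL.coeFn_toLp, h2, hc]
    ring
  have := hL.coeFn_toLp
  rw [hE] at this
  exact this.symm

theorem hasWeylDeriv_iff (hp : 1 < p) {r₁ r₂ : ℝ} {u v : Torus → ℝ} {U V : TorusLp p}
    (hU : (fun q => (u q : ℂ)) =ᵐ[volume] U) (hV : (fun q => (v q : ℂ)) =ᵐ[volume] V) :
    HasWeylDeriv p r₁ r₂ (per u) (per v) ↔
      MemLp0 p (per v) ∧ IsoFlow.IsDeriv (FX p) (FY p) r₁ r₂ U V := by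
  rw [HasWeylDeriv, isDeriv_iff hp]
  refine and_congr_right fun _ => forall_congr' fun m => forall_congr' fun n => ?_
  rw [fourierCoefZ_per ((integrable_Lp U).congr hU.symm),
    fourierCoefZ_per ((integrable_Lp V).congr hV.symm), mul_left_comm, ← coef_congr hU,
    ← coef_congr hV]
  have h : ((((2 * π) ^ 2)⁻¹ : ℝ) : ℂ) ≠ 0 := by
    exact_mod_cast (inv_pos.2 (pow_pos Real.two_pi_pos 2)).ne'
  exact mul_right_inj' h

end Torus

theorem exists_dyadic_near {δ : ℝ} (h0 : 0 < δ) (h1 : δ ≤ 1) :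
    ∃ n : ℕ, (2 : ℝ)⁻¹ ^ n ≤ δ ∧ δ ≤ 2 * (2 : ℝ)⁻¹ ^ n := by
  obtain ⟨n, hn, hn'⟩ := exists_nat_pow_near_of_lt_one h0 h1 (y := (2 : ℝ)⁻¹) (by norm_num) (by norm_num)
  refine ⟨n + 1, hn.le, hn'.trans (le_of_eq ?_)⟩
  rw [pow_succ]
  ring

namespace IsoFlow

variable {X : Type*} [NormedAddCommGroup X] [NormedSpace ℂ X] [CompleteSpace X] (F G : IsoFlow X)

/-- The mixed modulus of smoothness along two flows. -/
def modulus (α₁ α₂ : ℝ) (x : X) (δ₁ δ₂ : ℝ) : ℝ≥0∞ :=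
  ⨆ (h₁ : ℝ) (_ : |h₁| ≤ δ₁) (h₂ : ℝ) (_ : |h₂| ≤ δ₂), ‖F.diff α₁ h₁ (G.diff α₂ h₂ x)‖ₑ

/-- The weighted integral of the mixed modulus of smoothness. -/
def majorant (r₁ r₂ β₁ β₂ s : ℝ) (x : X) (δ₁ δ₂ : ℝ) : ℝ≥0∞ :=
  ∫⁻ t₁ in Set.Ioo (0:ℝ) δ₁, ∫⁻ t₂ in Set.Ioo (0:ℝ) δ₂,
    ENNReal.ofReal (t₁ ^ (-r₁*s-1) * t₂ ^ (-r₂*s-1)) *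
      F.modulus G (r₁ + β₁) (r₂ + β₂) x t₁ t₂ ^ s

variable {F G}

omit [CompleteSpace X] in
theorem le_modulus {α₁ α₂ δ₁ δ₂ h₁ h₂ : ℝ} (x : X) (hh₁ : |h₁| ≤ δ₁) (hh₂ : |h₂| ≤ δ₂) :
    ‖F.diff α₁ h₁ (G.diff α₂ h₂ x)‖ₑ ≤ F.modulus G α₁ α₂ x δ₁ δ₂ :=
  le_iSup₂_of_le h₁ hh₁ (le_iSup₂_of_le h₂ hh₂ le_rfl)

omit [CompleteSpace X] in
theorem modulus_le {α₁ α₂ δ₁ δ₂ : ℝ} {x : X} {c : ℝ≥0∞}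
    (h : ∀ h₁ h₂, |h₁| ≤ δ₁ → |h₂| ≤ δ₂ → ‖F.diff α₁ h₁ (G.diff α₂ h₂ x)‖ₑ ≤ c) :
    F.modulus G α₁ α₂ x δ₁ δ₂ ≤ c :=
  iSup₂_le fun h₁ hh₁ => iSup₂_le fun h₂ hh₂ => h h₁ h₂ hh₁ hh₂

omit [CompleteSpace X] in
theorem modulus_mono (α₁ α₂ : ℝ) (x : X) {a a' b b' : ℝ} (ha : a ≤ a') (hb : b ≤ b') :
    F.modulus G α₁ α₂ x a b ≤ F.modulus G α₁ α₂ x a' b' :=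
  modulus_le fun _ _ h₁ h₂ => le_modulus x (h₁.trans ha) (h₂.trans hb)

omit [CompleteSpace X] in
theorem modulus_ne_top {α₁ α₂ : ℝ} (hα₁ : 0 < α₁) (hα₂ : 0 < α₂) (x : X) (δ₁ δ₂ : ℝ) :
    F.modulus G α₁ α₂ x δ₁ δ₂ ≠ ⊤ := by
  refine ne_top_of_le_ne_top (ENNReal.ofReal_ne_top (r := diffNorm α₁ * (diffNorm α₂ * ‖x‖)))
    (modulus_le fun h₁ h₂ _ _ => ?_)
  rw [← ofReal_norm]
  refine ENNReal.ofReal_le_ofReal ((F.norm_diff_le hα₁ h₁ _).trans ?_)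
  exact mul_le_mul_of_nonneg_left (G.norm_diff_le hα₂ h₂ x)
    (zero_le_one.trans (one_le_diffNorm hα₁))

variable {R₁ R₂ r₁ r₂ β₁ β₂ : ℝ}

omit [CompleteSpace X] in
theorem tsum_diff_le_majorant (hr₁ : 0 < r₁) (hr₂ : 0 < r₂) {s : ℝ} (hs : 0 < s) {n₁ n₂ : ℕ}
    {δ₁ δ₂ : ℝ} (hδ₁ : (2 : ℝ)⁻¹ ^ n₁ ≤ δ₁) (hδ₂ : (2 : ℝ)⁻¹ ^ n₂ ≤ δ₂) (f : X) :
    ∑' i : ℕ, ∑' k : ℕ,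
        (ENNReal.ofReal (((2 : ℝ) ^ r₁) ^ (n₁ + i) * ((2 : ℝ) ^ r₂) ^ (n₂ + k)) *
        ‖F.diff (r₁ + β₁) ((2 : ℝ)⁻¹ ^ (n₁ + i + 1))
          (G.diff (r₂ + β₂) ((2 : ℝ)⁻¹ ^ (n₂ + k + 1)) f)‖ₑ) ^ s ≤
      4 * F.majorant G r₁ r₂ β₁ β₂ s f δ₁ δ₂ := by
  refine le_trans ?_ (tsum_le_lintegral₂ (Φ := F.modulus G (r₁ + β₁) (r₂ + β₂) f)
    (fun ha hb => modulus_mono _ _ f ha hb) hr₁ hr₂ hs hδ₁ hδ₂)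
  refine ENNReal.tsum_le_tsum fun i => ENNReal.tsum_le_tsum fun k => ENNReal.rpow_le_rpow
    (mul_le_mul' le_rfl (le_modulus f ?_ ?_)) hs.le
  all_goals rw [abs_of_nonneg (by positivity)]

theorem exists_modulus_deriv_le {θ K : ℝ} (hX : SmoothNorm X θ K)
    (hc : F.Comm G) (hF : F.RieszBound R₁)
    (hG : G.RieszBound R₂) (hr₁ : 0 < r₁) (hr₂ : 0 < r₂) (hβ₁ : 0 < β₁) (hβ₂ : 0 < β₂) :
    ∃ C : ℝ, 0 < C ∧ ∀ (δ₁ δ₂ : ℝ) (f g : X), 0 < δ₁ → δ₁ ≤ 1 → 0 < δ₂ → δ₂ ≤ 1 →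
      IsDeriv F G r₁ r₂ f g → F.S 0 g = 0 → G.S 0 g = 0 →
      F.modulus G β₁ β₂ g δ₁ δ₂ ≤
        ENNReal.ofReal C * F.majorant G r₁ r₂ β₁ β₂ θ f δ₁ δ₂ ^ (1 / θ) := by
  obtain ⟨C, hC, H⟩ := exists_enorm_diff_deriv_rpow_le hX hc hF hG hr₁ hr₂ hβ₁ hβ₂
  have hθ : 0 < θ := by linarith [hX.one_le]
  refine ⟨(C * 4) ^ (1 / θ), by positivity, fun δ₁ δ₂ f g h₁0 h₁1 h₂0 h₂1 hfg hF0 hG0 => ?_⟩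
  obtain ⟨n₁, hn₁, hn₁'⟩ := exists_dyadic_near h₁0 h₁1
  obtain ⟨n₂, hn₂, hn₂'⟩ := exists_dyadic_near h₂0 h₂1
  refine modulus_le fun h₁ h₂ hh₁ hh₂ => ?_
  have h := (H n₁ n₂ h₁ h₂ f g hfg hF0 hG0 (hh₁.trans hn₁') (hh₂.trans hn₂')).trans
    (mul_le_mul' le_rfl (tsum_diff_le_majorant hr₁ hr₂ hθ hn₁ hn₂ f))
  rw [← ENNReal.ofReal_rpow_of_pos (by positivity), ← ENNReal.mul_rpow_of_nonneg _ _ (by positivity),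
    one_div, ENNReal.le_rpow_inv_iff hθ, ENNReal.ofReal_mul hC.le, mul_assoc]
  simpa using h

theorem exists_isDeriv_of_majorant {θ K : ℝ} (hX : SmoothNorm X θ K)
    (hc : F.Comm G) (hF : F.RieszBound R₁)
    (hG : G.RieszBound R₂) (hr₁ : 0 < r₁) (hr₂ : 0 < r₂) (hβ₁ : 0 < β₁) (hβ₂ : 0 < β₂) {f : X}
    (hF0 : F.S 0 f = 0) (hG0 : G.S 0 f = 0)
    (hf : F.majorant G r₁ r₂ β₁ β₂ θ f 1 1 ^ (1 / θ) ≠ ⊤) :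
    ∃ g : X, IsDeriv F G r₁ r₂ f g ∧ F.S 0 g = 0 ∧ G.S 0 g = 0 := by
  have hθ : 0 < θ := by linarith [hX.one_le]
  refine exists_isDeriv hX hc hF hG hr₁ hr₂ hβ₁ hβ₂ f hF0 hG0 ?_
  refine ne_top_of_le_ne_top ?_ (tsum_diff_le_majorant (δ₁ := 1) (δ₂ := 1) hr₁ hr₂ hθ
    (by simp) (by simp) f)
  refine ENNReal.mul_ne_top (by simp) fun h => hf ?_
  rw [h, ENNReal.top_rpow_of_pos (by positivity)]

theorem exists_majorant_le {τ C₁ C₂ : ℝ} (hc : F.Comm G)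
    (hF : F.RieszBound R₁) (hG : G.RieszBound R₂) (hr₁ : 0 < r₁) (hr₂ : 0 < r₂)
    (hβ₁ : 0 < β₁) (hβ₂ : 0 < β₂) (hτ : 1 ≤ τ)
    (hC₁ : 0 < C₁) (H₁ : ∀ (n N : ℕ) (x : X),
      ∑ i ∈ Finset.range N, ‖F.P (fb n i) x‖ ^ τ ≤ C₁ * ‖x‖ ^ τ)
    (hC₂ : 0 < C₂) (H₂ : ∀ (n N : ℕ) (x : X),
      ∑ i ∈ Finset.range N, ‖G.P (fb n i) x‖ ^ τ ≤ C₂ * ‖x‖ ^ τ) :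
    ∃ C : ℝ, 0 < C ∧ ∀ (δ₁ δ₂ : ℝ) (f g : X), 0 < δ₁ → δ₁ ≤ 1 → 0 < δ₂ → δ₂ ≤ 1 →
      IsDeriv F G r₁ r₂ f g → F.S 0 f = 0 → G.S 0 f = 0 →
      F.majorant G r₁ r₂ β₁ β₂ τ f δ₁ δ₂ ^ (1 / τ) ≤
        ENNReal.ofReal C * F.modulus G β₁ β₂ g δ₁ δ₂ := by
  obtain ⟨C, hC, H⟩ := exists_tsum_diff_integral_rpow_le hc hF hG hr₁ hr₂ hβ₁ hβ₂ hτ hC₁ H₁ hC₂ H₂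
  have hτ0 : 0 < τ := by linarith
  refine ⟨C ^ (1 / τ), by positivity, fun δ₁ δ₂ f g h₁0 h₁1 h₂0 h₂1 hfg hF0 hG0 => ?_⟩
  obtain ⟨n₁, hn₁, hn₁'⟩ := exists_dyadic_near h₁0 h₁1
  obtain ⟨n₂, hn₂, hn₂'⟩ := exists_dyadic_near h₂0 h₂1
  have hfin := modulus_ne_top (F := F) (G := G) hβ₁ hβ₂ g δ₁ δ₂
  have h1 := H n₁ n₂ f g (F.modulus G β₁ β₂ g δ₁ δ₂).toReal hfg hF0 hG0 fun h₁ h₂ hh₁ hh₂ => by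
    rw [← toReal_enorm]
    exact ENNReal.toReal_mono hfin (le_modulus g (hh₁.trans hn₁) (hh₂.trans hn₂))
  have h2 := (lintegral_le_tsum₂ (Φ := F.modulus G (r₁ + β₁) (r₂ + β₂) f)
    (fun ha hb => modulus_mono _ _ f ha hb) hr₁ hr₂ hτ0 hn₁' hn₂').trans h1
  rw [ENNReal.ofReal_toReal hfin] at h2
  rw [one_div, ENNReal.rpow_inv_le_iff hτ0, ENNReal.mul_rpow_of_nonneg _ _ hτ0.le,
    ENNReal.ofReal_rpow_of_pos (by positivity), ← Real.rpow_mul hC.le, inv_mul_cancel₀ hτ0.ne',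
    Real.rpow_one]
  exact h2

end IsoFlow

namespace Torus

variable {p β₁ β₂ r₁ r₂ : ℝ} [Fact (1 ≤ ENNReal.ofReal p)]

theorem derivMajorant_per (hp : 0 < p) (hβ₁ : 0 < β₁) (hβ₂ : 0 < β₂) (hr₁ : 0 < r₁) (hr₂ : 0 < r₂)
    (s a b : ℝ) {u : Torus → ℝ} {U : TorusLp p} (hu : (fun q => (u q : ℂ)) =ᵐ[volume] U) :
    derivMajorant p β₁ β₂ r₁ r₂ s a b (per u) =
      (FX p).majorant (FY p) r₁ r₂ β₁ β₂ s U a b ^ (1 / s) := by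
  rw [derivMajorant, IsoFlow.majorant]
  simp only [mixedMod_per hp (add_pos hr₁ hβ₁) (add_pos hr₂ hβ₂) _ _ hu]
  rfl

theorem exists_mixedMod_deriv_le (hp : 1 < p) (hβ₁ : 0 < β₁) (hβ₂ : 0 < β₂) (hr₁ : 0 < r₁)
    (hr₂ : 0 < r₂) : ∃ C : ℝ, 0 < C ∧ ∀ (f : ℝ → ℝ → ℝ) (δ₁ δ₂ : ℝ), MemLp0 p f →
      δ₁ ∈ Set.Ioo (0:ℝ) (1/2) → δ₂ ∈ Set.Ioo (0:ℝ) (1/2) →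
      derivMajorant p β₁ β₂ r₁ r₂ (min 2 p) 1 1 f ≠ ⊤ →
        ∃ g : ℝ → ℝ → ℝ, HasWeylDeriv p r₁ r₂ f g ∧
          mixedMod p β₁ β₂ δ₁ δ₂ g ≤
            ENNReal.ofReal C * derivMajorant p β₁ β₂ r₁ r₂ (min 2 p) δ₁ δ₂ f := by
  have hp0 : 0 < p := by linarith
  obtain ⟨K, hX⟩ := exists_smoothNorm_Lp (μ := (volume : Measure Torus)) hp
  obtain ⟨R₁, hF⟩ := exists_rieszBound_FX hp
  obtain ⟨R₂, hG⟩ := exists_rieszBound_FY hp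
  obtain ⟨C, hC, H⟩ :=
    IsoFlow.exists_modulus_deriv_le hX (comm_FX_FY p) hF hG hr₁ hr₂ hβ₁ hβ₂
  refine ⟨C, hC, fun f δ₁ δ₂ hf hδ₁ hδ₂ hfin => ?_⟩
  obtain ⟨u, hu, rfl⟩ := exists_per_eq hf.meas hf.periodic_x hf.periodic_y
  obtain ⟨U, hU, hX0, hY0⟩ := exists_toLp_of_memLp0 hp hu hf
  rw [derivMajorant_per hp0 hβ₁ hβ₂ hr₁ hr₂ _ _ _ hU] at hfin
  obtain ⟨V, hUV, hVX, hVY⟩ := IsoFlow.exists_isDeriv_of_majorant hX (comm_FX_FY p) hF hG hr₁ hr₂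
    hβ₁ hβ₂ hX0 hY0 hfin
  have hV := re_ae_eq_of_isDeriv hp hU hUV
  have hm : Measurable fun q => (V q).re :=
    Complex.measurable_re.comp (Lp.stronglyMeasurable V).measurable
  refine ⟨per fun q => (V q).re,
    (hasWeylDeriv_iff hp hU hV).2 ⟨memLp0_per hp hm hV hVX hVY, hUV⟩, ?_⟩
  rw [derivMajorant_per hp0 hβ₁ hβ₂ hr₁ hr₂ _ _ _ hU, mixedMod_per hp0 hβ₁ hβ₂ _ _ hV]
  exact H δ₁ δ₂ U V hδ₁.1 (by linarith [hδ₁.2]) hδ₂.1 (by linarith [hδ₂.2]) hUV hVX hVY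

omit [Fact (1 ≤ ENNReal.ofReal p)] in
theorem holderConjugate_min_max {q : ℝ} (hpq : p.HolderConjugate q) :
    (min 2 q).HolderConjugate (max 2 p) := by
  rcases le_total p 2 with h | h
  · have hq : 2 ≤ q := by
      have := hpq.inv_add_inv_eq_one
      have h1 : (2 : ℝ)⁻¹ ≤ p⁻¹ := inv_anti₀ hpq.pos h
      exact (inv_le_inv₀ hpq.symm.pos two_pos).1 (by linarith)
    rw [min_eq_left hq, max_eq_left h]
    exact Real.HolderConjugate.two_two
  · have hq : q ≤ 2 := by
      have := hpq.inv_add_inv_eq_one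
      have h1 : p⁻¹ ≤ (2 : ℝ)⁻¹ := inv_anti₀ two_pos h
      exact (inv_le_inv₀ two_pos hpq.symm.pos).1 (by linarith)
    rw [min_eq_right hq, max_eq_right h]
    exact hpq.symm

theorem exists_derivMajorant_le (hp : 1 < p) (hβ₁ : 0 < β₁) (hβ₂ : 0 < β₂) (hr₁ : 0 < r₁)
    (hr₂ : 0 < r₂) : ∃ C : ℝ, 0 < C ∧ ∀ (f g : ℝ → ℝ → ℝ) (δ₁ δ₂ : ℝ), MemLp0 p f →
      δ₁ ∈ Set.Ioo (0:ℝ) (1/2) → δ₂ ∈ Set.Ioo (0:ℝ) (1/2) → HasWeylDeriv p r₁ r₂ f g →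
        derivMajorant p β₁ β₂ r₁ r₂ (max 2 p) δ₁ δ₂ f ≤
          ENNReal.ofReal C * mixedMod p β₁ β₂ δ₁ δ₂ g := by
  have hp0 : 0 < p := by linarith
  have hpq := Real.HolderConjugate.conjExponent hp
  have hq := hpq.symm.lt
  have : Fact (1 ≤ ENNReal.ofReal p.conjExponent) := ⟨by simpa using hq.le⟩
  obtain ⟨K, hY⟩ := exists_smoothNorm_Lp (μ := (volume : Measure Torus)) hq
  obtain ⟨R₁, hF⟩ := exists_rieszBound_FX hp
  obtain ⟨R₂, hG⟩ := exists_rieszBound_FY hp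
  obtain ⟨S₁, hF'⟩ := exists_rieszBound_FX hq
  obtain ⟨S₂, hG'⟩ := exists_rieszBound_FY hq
  obtain ⟨C₁, hC₁, H₁⟩ := (flowX.adjoint_flowLp hpq).exists_sum_rpow_le hF'.rev hY
    (holderConjugate_min_max hpq)
  obtain ⟨C₂, hC₂, H₂⟩ := (flowY.adjoint_flowLp hpq).exists_sum_rpow_le hG'.rev hY
    (holderConjugate_min_max hpq)
  obtain ⟨C, hC, H⟩ := IsoFlow.exists_majorant_le (comm_FX_FY p) hF hG hr₁ hr₂ hβ₁ hβ₂
    (one_le_two.trans (le_max_left 2 p)) hC₁ H₁ hC₂ H₂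
  refine ⟨C, hC, fun f g δ₁ δ₂ hf hδ₁ hδ₂ hfg => ?_⟩
  obtain ⟨u, hu, rfl⟩ := exists_per_eq hf.meas hf.periodic_x hf.periodic_y
  obtain ⟨U, hU, hX0, hY0⟩ := exists_toLp_of_memLp0 hp hu hf
  obtain ⟨v, hv, rfl⟩ := exists_per_eq hfg.1.meas hfg.1.periodic_x hfg.1.periodic_y
  obtain ⟨V, hV, -⟩ := exists_toLp_of_memLp0 hp hv hfg.1
  rw [derivMajorant_per hp0 hβ₁ hβ₂ hr₁ hr₂ _ _ _ hU, mixedMod_per hp0 hβ₁ hβ₂ _ _ hV]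
  exact H δ₁ δ₂ U V hδ₁.1 (by linarith [hδ₁.2]) hδ₂.1 (by linarith [hδ₂.2])
    ((hasWeylDeriv_iff hp hU hV).1 hfg).2 hX0 hY0

end Torus

/-- Sharp two-sided relation between the mixed modulus of smoothness of the mixed
Weyl derivative and that of the function itself (Theorem 8.1). -/
theorem modulus_of_derivative (p β₁ β₂ r₁ r₂ : ℝ) (hp : 1 < p)
    (hβ₁ : 0 < β₁) (hβ₂ : 0 < β₂) (hr₁ : 0 < r₁) (hr₂ : 0 < r₂) :
    ∃ C : ℝ, 0 < C ∧ ∀ (f : ℝ → ℝ → ℝ) (δ₁ δ₂ : ℝ), MemLp0 p f →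
      δ₁ ∈ Set.Ioo (0:ℝ) (1/2) → δ₂ ∈ Set.Ioo (0:ℝ) (1/2) →
      (derivMajorant p β₁ β₂ r₁ r₂ (min 2 p) 1 1 f ≠ ⊤ →
        ∃ g : ℝ → ℝ → ℝ, HasWeylDeriv p r₁ r₂ f g ∧
          mixedMod p β₁ β₂ δ₁ δ₂ g ≤
            ENNReal.ofReal C * derivMajorant p β₁ β₂ r₁ r₂ (min 2 p) δ₁ δ₂ f) ∧
      (∀ g : ℝ → ℝ → ℝ, HasWeylDeriv p r₁ r₂ f g →
        derivMajorant p β₁ β₂ r₁ r₂ (max 2 p) δ₁ δ₂ f ≤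
          ENNReal.ofReal C * mixedMod p β₁ β₂ δ₁ δ₂ g) := by
  have : Fact (1 ≤ ENNReal.ofReal p) := ⟨by simpa using hp.le⟩
  obtain ⟨C₁, hC₁, H₁⟩ := Torus.exists_mixedMod_deriv_le hp hβ₁ hβ₂ hr₁ hr₂
  obtain ⟨C₂, hC₂, H₂⟩ := Torus.exists_derivMajorant_le hp hβ₁ hβ₂ hr₁ hr₂
  refine ⟨max C₁ C₂, lt_max_of_lt_left hC₁, fun f δ₁ δ₂ hf hδ₁ hδ₂ => ⟨fun hfin => ?_, fun g hg => ?_⟩⟩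
  · obtain ⟨g, hg, h⟩ := H₁ f δ₁ δ₂ hf hδ₁ hδ₂ hfin
    exact ⟨g, hg, h.trans (mul_le_mul' (ENNReal.ofReal_le_ofReal (le_max_left _ _)) le_rfl)⟩
  · exact (H₂ f g δ₁ δ₂ hf hδ₁ hδ₂ hg).trans
      (mul_le_mul' (ENNReal.ofReal_le_ofReal (le_max_right _ _)) le_rfl)

end
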